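/- Let p = (p0,p1,p2) ∈ [0,1)³ be self-dual, i.e., κ_△(p) = 0. Then: (a) if P^□_{(p0, 1−p0)} has the box-crossing property, then so does P^△_p; (b) if p0 > 0 and P^△_p has the box-crossing property, then so does P^□_{(p0, 1−p0)}; (c) P^△_p has the box-crossing property if and only if P^⬡_{1−p} has it, where 1−p = (1−p0,1−p1,1−p2). -/

import Mathlib

open MeasureTheory Set

set_option linter.unusedVariables false

namespace Perc

/-- Points of the plane. -/
abbrev Pt := ℝ × ℝ

/-- A lattice embedded in the plane, with edges indexed by `E`;
each edge is embedded as the segment between the two endpoints given by `ends`. -/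
structure LatticeOn (E : Type) where
  ends : E → Pt × Pt

/-- Bond configurations. -/
abbrev Config (E : Type) := E → Bool

/-- `P` is the Bernoulli bond-percolation product measure in which edge `e`
is open with probability `p e`, independently over edges. -/
def IsBernoulliProduct {E : Type} (p : E → ℝ) (P : Measure (Config E)) : Prop :=
  IsProbabilityMeasure P ∧
    ∀ (s : Finset E) (f : E → Bool),
      P {ω | ∀ e ∈ s, ω e = f e} =
        ∏ e ∈ s, ENNReal.ofReal (if f e then p e else 1 - p e)

/-- The union of the closed segments of the open edges. -/
def openEdgeSet {E : Type} (L : LatticeOn E) (ω : Config E) : Set Pt :=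
  ⋃ e ∈ {e : E | ω e = true}, segment ℝ (L.ends e).1 (L.ends e).2

/-- There is an arc, contained in `S` and in the union of the open edges,
with one endpoint in `A` and the other in `B`. -/
def CrossingIn {E : Type} (L : LatticeOn E) (ω : Config E) (S A B : Set Pt) : Prop :=
  ∃ γ : ℝ → Pt, ContinuousOn γ (Icc 0 1) ∧ γ 0 ∈ A ∧ γ 1 ∈ B ∧
    ∀ t ∈ Icc (0:ℝ) 1, γ t ∈ S ∩ openEdgeSet L ω

/-- Rotation of the plane by angle `θ`. -/
noncomputable def rot (θ : ℝ) (z : Pt) : Pt :=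
  (Real.cos θ * z.1 - Real.sin θ * z.2, Real.sin θ * z.1 + Real.cos θ * z.2)

/-- `f` comprises a rotation and a translation. -/
def IsRotTrans (f : Pt → Pt) : Prop := ∃ θ : ℝ, ∃ t : Pt, f = fun z => rot θ z + t

def stdRect (h l : ℝ) : Set Pt := {z | 0 ≤ z.1 ∧ z.1 ≤ h ∧ 0 ≤ z.2 ∧ z.2 ≤ l}
def leftSide (h l : ℝ) : Set Pt := {z | z.1 = 0 ∧ 0 ≤ z.2 ∧ z.2 ≤ l}
def rightSide (h l : ℝ) : Set Pt := {z | z.1 = h ∧ 0 ≤ z.2 ∧ z.2 ≤ l}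
def bottomSide (h l : ℝ) : Set Pt := {z | z.2 = 0 ∧ 0 ≤ z.1 ∧ z.1 ≤ h}
def topSide (h l : ℝ) : Set Pt := {z | z.2 = l ∧ 0 ≤ z.1 ∧ z.1 ≤ h}

/-- The box `f(stdRect h l)` (where `f` is a rotation plus translation) possesses
open crossings in both directions. -/
def HasBoxCrossings {E : Type} (L : LatticeOn E) (ω : Config E) (h l : ℝ) (f : Pt → Pt) : Prop :=
  CrossingIn L ω (f '' stdRect h l) (f '' leftSide h l) (f '' rightSide h l) ∧
  CrossingIn L ω (f '' stdRect h l) (f '' bottomSide h l) (f '' topSide h l)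

/-- The box-crossing property: for every `α > 0` there is `δ > 0` such that every box
of size `αN × N` (any position and orientation) possesses open crossings with
probability at least `δ`, for all large `N`. -/
def BoxCrossingProperty {E : Type} (L : LatticeOn E) (P : Measure (Config E)) : Prop :=
  ∀ α : ℝ, 0 < α → ∃ δ : ℝ, 0 < δ ∧ ∃ N₀ : ℕ, ∀ N : ℕ, N₀ ≤ N →
    ∀ f : Pt → Pt, IsRotTrans f →
      ENNReal.ofReal δ ≤ P {ω | HasBoxCrossings L ω (α * N) N f}

/-- Horizontal-crossing event of the box `[-m,m] × [0,n]`. -/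
def Ch {E : Type} (L : LatticeOn E) (m n : ℝ) (ω : Config E) : Prop :=
  CrossingIn L ω {z | -m ≤ z.1 ∧ z.1 ≤ m ∧ 0 ≤ z.2 ∧ z.2 ≤ n}
    {z | z.1 = -m ∧ 0 ≤ z.2 ∧ z.2 ≤ n} {z | z.1 = m ∧ 0 ≤ z.2 ∧ z.2 ≤ n}

/-- Vertical-crossing event of the box `[-m,m] × [0,n]`. -/
def Cv {E : Type} (L : LatticeOn E) (m n : ℝ) (ω : Config E) : Prop :=
  CrossingIn L ω {z | -m ≤ z.1 ∧ z.1 ≤ m ∧ 0 ≤ z.2 ∧ z.2 ≤ n}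
    {z | z.2 = 0 ∧ -m ≤ z.1 ∧ z.1 ≤ m} {z | z.2 = n ∧ -m ≤ z.1 ∧ z.1 ≤ m}

/-- `u` and `v` are the endpoints of some open edge. -/
def openAdj {E : Type} (L : LatticeOn E) (ω : Config E) (u v : Pt) : Prop :=
  ∃ e, ω e = true ∧ (L.ends e = (u, v) ∨ L.ends e = (v, u))

/-- `u` and `v` are joined by a path of open edges. -/
def openConn {E : Type} (L : LatticeOn E) (ω : Config E) : Pt → Pt → Prop :=
  Relation.ReflTransGen (openAdj L ω)

/-- The open cluster at `v`. -/
def cluster {E : Type} (L : LatticeOn E) (ω : Config E) (v : Pt) : Set Pt :=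
  {u | openConn L ω v u}

/-- The vertex set of the lattice. -/
def vertexSet {E : Type} (L : LatticeOn E) : Set Pt :=
  ⋃ e : E, {(L.ends e).1, (L.ends e).2}

/-- `v` is the endpoint of an infinite open self-avoiding path. -/
def ConnToInfinity {E : Type} (L : LatticeOn E) (ω : Config E) (v : Pt) : Prop :=
  ∃ γ : ℕ → Pt, γ 0 = v ∧ Function.Injective γ ∧ ∀ n, openAdj L ω (γ n) (γ (n + 1))

/-- Euclidean distance on the plane. -/
noncomputable def edist2 (u v : Pt) : ℝ := Real.sqrt ((u.1 - v.1) ^ 2 + (u.2 - v.2) ^ 2)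

/-- `rad (C_v) ≥ r`, where `rad (C_v)` is the supremum of all `x` such that `C_v`
meets the complement of the open Euclidean ball `v + S_x`. -/
def RadiusGE {E : Type} (L : LatticeOn E) (ω : Config E) (v : Pt) (r : ℝ) : Prop :=
  ∀ x : ℝ, x < r → ∃ u ∈ cluster L ω v, x ≤ edist2 v u

/-- `κ_□`. -/
def kappaS (a b : ℝ) : ℝ := a + b - 1
/-- `κ_△`. -/
def kappaT (a b c : ℝ) : ℝ := a + b + c - a * b * c - 1
/-- `κ_⬡`. -/
def kappaH (a b c : ℝ) : ℝ := -kappaT (1 - a) (1 - b) (1 - c)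

/-- Edges of a square-type lattice: `(a, b, true)` is the `horizontal`-class edge
at `(a,b)` and `(a, b, false)` the `vertical`-class edge at `(a,b)`. -/
abbrev SqE := ℤ × ℤ × Bool
/-- Edges of the triangular lattice (also indexing the dual hexagonal edges):
`(a, b, i)` with `i = 0` horizontal, `i = 1` the right edge of an upwards pointing
triangle, `i = 2` the left edge of an upwards pointing triangle, in row `b`. -/
abbrev TriE := ℤ × ℤ × Fin 3

/-- The unit square lattice, with vertex set `ℤ²`. -/
noncomputable def sqLattice : LatticeOn SqE :=
  ⟨fun e =>
    if e.2.2 then (((e.1 : ℝ), (e.2.1 : ℝ)), ((e.1 : ℝ) + 1, (e.2.1 : ℝ)))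
    else (((e.1 : ℝ), (e.2.1 : ℝ)), ((e.1 : ℝ), (e.2.1 : ℝ) + 1))⟩

/-- The dual of the unit square lattice (shifted by `(1/2, 1/2)`), with each dual edge
indexed by the primal edge it crosses. -/
noncomputable def sqDualLattice : LatticeOn SqE :=
  ⟨fun e =>
    if e.2.2 then
      (((e.1 : ℝ) + 1 / 2, (e.2.1 : ℝ) - 1 / 2), ((e.1 : ℝ) + 1 / 2, (e.2.1 : ℝ) + 1 / 2))
    else
      (((e.1 : ℝ) - 1 / 2, (e.2.1 : ℝ) + 1 / 2), ((e.1 : ℝ) + 1 / 2, (e.2.1 : ℝ) + 1 / 2))⟩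

/-- Vertices of the triangular lattice (equilateral triangles of side `√3`,
one family of edges horizontal). -/
noncomputable def tv (a b : ℤ) : Pt :=
  (Real.sqrt 3 * ((a : ℝ) + (b : ℝ) / 2), 3 / 2 * (b : ℝ))

/-- The triangular lattice. -/
noncomputable def triLattice : LatticeOn TriE :=
  ⟨fun e =>
    if e.2.2 = 0 then (tv e.1 e.2.1, tv (e.1 + 1) e.2.1)
    else if e.2.2 = 1 then (tv (e.1 + 1) e.2.1, tv e.1 (e.2.1 + 1))
    else (tv e.1 e.2.1, tv e.1 (e.2.1 + 1))⟩

/-- Circumcentre of the upwards pointing triangle with base vertex `tv a b`. -/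
noncomputable def hup (a b : ℤ) : Pt :=
  (Real.sqrt 3 * ((a : ℝ) + ((b : ℝ) + 1) / 2), 3 / 2 * (b : ℝ) + 1 / 2)

/-- Circumcentre of the downwards pointing triangle below the edge `tv a b – tv (a+1) b`. -/
noncomputable def hdown (a b : ℤ) : Pt :=
  (Real.sqrt 3 * ((a : ℝ) + ((b : ℝ) + 1) / 2), 3 / 2 * (b : ℝ) - 1 / 2)

/-- The hexagonal lattice, the planar dual of `triLattice`, with vertices at the
circumcentres of the triangles; each hexagonal edge is indexed by the triangular
edge it crosses. -/
noncomputable def hexLattice : LatticeOn TriE :=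
  ⟨fun e =>
    if e.2.2 = 0 then (hdown e.1 e.2.1, hup e.1 e.2.1)
    else if e.2.2 = 1 then (hup e.1 e.2.1, hdown e.1 (e.2.1 + 1))
    else (hup e.1 e.2.1, hdown (e.1 - 1) (e.2.1 + 1))⟩

/-- The square lattice with horizontal edges of length `√3` and vertical edges of
length `1` (as in the mixed lattices). -/
noncomputable def sqStretch : LatticeOn SqE :=
  ⟨fun e =>
    if e.2.2 then
      ((Real.sqrt 3 * (e.1 : ℝ), (e.2.1 : ℝ)), (Real.sqrt 3 * ((e.1 : ℝ) + 1), (e.2.1 : ℝ)))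
    else ((Real.sqrt 3 * (e.1 : ℝ), (e.2.1 : ℝ)), (Real.sqrt 3 * (e.1 : ℝ), (e.2.1 : ℝ) + 1))⟩

/-- Vertices of the square lattice rotated by `π/4`. -/
noncomputable def rv (a b : ℤ) : Pt :=
  (((a : ℝ) - (b : ℝ)) / Real.sqrt 2, ((a : ℝ) + (b : ℝ)) / Real.sqrt 2)

/-- The square lattice rotated by `π/4`: edges `(a,b,true)` are inclined at angle `π/4`
and edges `(a,b,false)` at angle `3π/4`; the row (height) of such an edge is `a + b`. -/
noncomputable def rsqLattice : LatticeOn SqE :=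
  ⟨fun e =>
    if e.2.2 then (rv e.1 e.2.1, rv (e.1 + 1) e.2.1)
    else (rv e.1 e.2.1, rv e.1 (e.2.1 + 1))⟩

/-- Inhomogeneous intensities on the square lattice: `ph` on horizontal edges,
`pv` on vertical ones. -/
def sqInt (ph pv : ℝ) : SqE → ℝ := fun e => if e.2.2 then ph else pv

/-- Inhomogeneous intensities on the triangular (or hexagonal) lattice:
`p0` on class-0 edges, `p1` on class-1, `p2` on class-2. -/
def triInt (p0 p1 p2 : ℝ) : TriE → ℝ := fun e => ![p0, p1, p2] e.2.2

/-- Highly inhomogeneous intensities on the triangular (or hexagonal) lattice: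
`p` on horizontal-class edges, `q n` on right edges of upwards pointing triangles at
height `n`, `q' n` on left edges of upwards pointing triangles at height `n`. -/
def triHI (p : ℝ) (q q' : ℤ → ℝ) : TriE → ℝ := fun e =>
  if e.2.2 = 0 then p else if e.2.2 = 1 then q e.2.1 else q' e.2.1

/-- Highly inhomogeneous intensities on the rotated square lattice: `q n` on edges
inclined at `π/4` at height `n`, `q' n` on edges inclined at `3π/4` at height `n`. -/
def rsqHI (q q' : ℤ → ℝ) : SqE → ℝ := fun e =>
  if e.2.2 then q (e.1 + e.2.1) else q' (e.1 + e.2.1)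


section Probability

/-- The Bernoulli law with parameter `q` clipped to `[0,1]`. -/
noncomputable def bern (q : ℝ) : Measure Bool :=
  ENNReal.ofReal (max 0 (min q 1)) • Measure.dirac true +
    ENNReal.ofReal (1 - max 0 (min q 1)) • Measure.dirac false

instance (q : ℝ) : IsProbabilityMeasure (bern q) := by
  constructor
  have h0 : 0 ≤ max 0 (min q 1) := le_max_left _ _
  have h1 : max 0 (min q 1) ≤ 1 := max_le zero_le_one (min_le_right _ _)
  simp only [bern, Measure.add_apply, Measure.smul_apply, measure_univ, smul_eq_mul, mul_one]
  rw [← ENNReal.ofReal_add h0 (by linarith)]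
  simp

lemma bern_singleton {q : ℝ} (h : q ∈ Icc (0 : ℝ) 1) (b : Bool) :
    bern q {b} = ENNReal.ofReal (if b then q else 1 - q) := by
  have : max 0 (min q 1) = q := by
    rw [min_eq_left h.2, max_eq_right h.1]
  cases b <;> simp [bern, this]

/-- The product measure with edge intensities `p`. -/
noncomputable def prodBern {E : Type} (p : E → ℝ) : Measure (Config E) :=
  Measure.infinitePi fun e => bern (p e)

instance {E : Type} (p : E → ℝ) : IsProbabilityMeasure (prodBern p) := by
  unfold prodBern; infer_instance

lemma prodBern_cylinder {E : Type} {p : E → ℝ} (hp : ∀ e, p e ∈ Icc (0 : ℝ) 1)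
    (s : Finset E) (f : E → Bool) :
    prodBern p {ω | ∀ e ∈ s, ω e = f e} =
      ∏ e ∈ s, ENNReal.ofReal (if f e then p e else 1 - p e) := by
  have : {ω : Config E | ∀ e ∈ s, ω e = f e} = Set.pi s fun e => {f e} := by
    ext ω; simp [Set.mem_pi]
  rw [this, prodBern, Measure.infinitePi_pi _ (fun _ _ => MeasurableSet.singleton _)]
  exact Finset.prod_congr rfl fun e _ => bern_singleton (hp e) _

lemma isBernoulliProduct_prodBern {E : Type} {p : E → ℝ} (hp : ∀ e, p e ∈ Icc (0 : ℝ) 1) :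
    IsBernoulliProduct p (prodBern p) :=
  ⟨inferInstance, prodBern_cylinder hp⟩

lemma IsBernoulliProduct.eq_prodBern {E : Type} {p : E → ℝ} (hp : ∀ e, p e ∈ Icc (0 : ℝ) 1)
    {P : Measure (Config E)} (hP : IsBernoulliProduct p P) : P = prodBern p := by
  classical
  have := hP.1
  have key : ∀ (s s' : Finset E) (f : E → Bool) (t : E → Set Bool), Disjoint s s' →
      P {ω | (∀ e ∈ s', ω e = f e) ∧ ∀ e ∈ s, ω e ∈ t e} =
        (∏ e ∈ s', bern (p e) {f e}) * ∏ e ∈ s, bern (p e) (t e) := by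
    intro s
    induction s using Finset.induction_on with
    | empty =>
      intro s' f t _
      simp only [Finset.notMem_empty, false_imp_iff, implies_true, and_true, Finset.prod_empty,
        mul_one]
      rw [hP.2]
      exact Finset.prod_congr rfl fun e _ => (bern_singleton (hp e) _).symm
    | insert a s ha ih =>
      intro s' f t hd
      rw [Finset.disjoint_insert_left] at hd
      have hs : ∀ b : Bool, P {ω | (∀ e ∈ insert a s', ω e = Function.update f a b e) ∧
          ∀ e ∈ s, ω e ∈ t e} =
          bern (p a) {b} * (∏ e ∈ s', bern (p e) {f e}) * ∏ e ∈ s, bern (p e) (t e) := by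
        intro b
        rw [ih (insert a s') _ t (by simp [ha, hd.2]), Finset.prod_insert hd.1]
        congr 2
        · simp
        · refine Finset.prod_congr rfl fun e he => ?_
          rw [Function.update_of_ne (by rintro rfl; exact hd.1 he)]
      have hrw : ∀ b : Bool, {ω : Config E | (∀ e ∈ insert a s', ω e = Function.update f a b e) ∧
          ∀ e ∈ s, ω e ∈ t e} = {ω | ω a = b ∧ (∀ e ∈ s', ω e = f e) ∧ ∀ e ∈ s, ω e ∈ t e} := by
        intro b
        ext ω
        simp only [Finset.mem_insert, forall_eq_or_imp, Function.update_self, mem_ofPred_eq,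
          and_assoc, and_congr_right_iff, and_congr_left_iff]
        intro _ _
        refine forall₂_congr fun e he => ?_
        rw [Function.update_of_ne (by rintro rfl; exact hd.1 he)]
      have hm : ∀ b : Bool, MeasurableSet {ω : Config E | ω a = b} := fun b =>
        measurableSet_eq_fun (measurable_pi_apply a) measurable_const
      have hsplit : ∀ A : Set (Config E), P A = P {ω | ω a = true ∧ ω ∈ A} +
          P {ω | ω a = false ∧ ω ∈ A} := by
        intro A
        rw [← measure_inter_add_sdiff A (hm true)]
        congr 2 <;> ext ω <;> simp [and_comm]
      have hb : bern (p a) (t a) = (if true ∈ t a then bern (p a) {true} else 0) +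
          (if false ∈ t a then bern (p a) {false} else 0) := by
        rw [← measure_inter_add_sdiff (t a) (MeasurableSet.singleton true)]
        congr 1
        · by_cases h : true ∈ t a
          · rw [if_pos h, inter_eq_right.2 (by simpa using h)]
          · rw [if_neg h]
            have : t a ∩ {true} = ∅ := by ext x; cases x <;> simp [h]
            rw [this, measure_empty]
        · by_cases h : false ∈ t a
          · rw [if_pos h]; congr 1; ext x; cases x <;> simp [h]
          · rw [if_neg h]
            have : t a \ {true} = ∅ := by ext x; cases x <;> simp [h]
            rw [this, measure_empty]
      rw [hsplit, Finset.prod_insert ha, hb]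
      have hfin : ∀ b : Bool, P {ω | ω a = b ∧ ω ∈ {ω : Config E | (∀ e ∈ s', ω e = f e) ∧
          ∀ e ∈ insert a s, ω e ∈ t e}} = (if b ∈ t a then bern (p a) {b} else 0) *
          ((∏ e ∈ s', bern (p e) {f e}) * ∏ e ∈ s, bern (p e) (t e)) := by
        intro b
        by_cases h : b ∈ t a
        · rw [if_pos h, ← mul_assoc, ← hs b, hrw b]
          congr 1; ext ω
          simp only [Finset.mem_insert, forall_eq_or_imp, mem_ofPred_eq]
          constructor
          · rintro ⟨h1, h2, h3, h4⟩; exact ⟨h1, h2, h4⟩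
          · rintro ⟨h1, h2, h4⟩; exact ⟨h1, h2, h1 ▸ h, h4⟩
        · rw [if_neg h, zero_mul]
          convert measure_empty (μ := P)
          ext ω
          simp only [Finset.mem_insert, forall_eq_or_imp, mem_ofPred_eq, mem_empty_iff_false,
            iff_false, not_and]
          rintro rfl _ h'; exact absurd h' h
      rw [hfin, hfin]
      ring
  refine Measure.eq_infinitePi _ fun s t ht => ?_
  have := key s ∅ (fun _ => true) t (by simp)
  simpa [Set.pi] using this

lemma prodBern_map_comp {E E' : Type} (p : E → ℝ) (ι : E' → E) (hι : Function.Injective ι) :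
    (prodBern p).map (fun ω e => ω (ι e)) = prodBern fun e => p (ι e) := by
  classical
  refine Measure.eq_infinitePi _ fun s t ht => ?_
  rw [Measure.map_apply (by fun_prop) (.pi s.countable_toSet fun _ _ => ht _)]
  have hinv : ∀ e, (Function.extend ι t fun _ => univ) (ι e) = t e := fun e => hι.extend_apply _ _ _
  have : (fun (ω : Config E) e => ω (ι e)) ⁻¹' (Set.pi (s : Set E') t) =
      Set.pi ((s.image ι : Finset E) : Set E) (Function.extend ι t fun _ => univ) := by
    ext ω; simp only [mem_preimage, Set.mem_pi, Finset.mem_coe, Finset.forall_mem_image, hinv]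
  rw [this, prodBern, Measure.infinitePi_pi, Finset.prod_image (fun a _ b _ h => hι h)]
  · simp only [hinv]
  · intro e _; exact MeasurableSet.of_discrete

/-- Flipping all edges turns intensities `p` into `1 - p`. -/
lemma prodBern_map_not {E : Type} {p : E → ℝ} (hp : ∀ e, p e ∈ Icc (0 : ℝ) 1) :
    (prodBern p).map (fun ω e => !(ω e)) = prodBern fun e => 1 - p e := by
  unfold prodBern
  rw [Measure.infinitePi_map_pi (f := fun _ b => !b) _ (fun _ => Measurable.of_discrete)]
  congr 1
  ext e : 1
  have h1 : 1 - p e ∈ Icc (0 : ℝ) 1 := ⟨by linarith [(hp e).2], by linarith [(hp e).1]⟩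
  refine Measure.ext_of_singleton fun b => ?_
  rw [Measure.map_apply Measurable.of_discrete (MeasurableSet.singleton _)]
  have : (fun b => !b) ⁻¹' {b} = {!b} := by ext x; cases x <;> cases b <;> simp
  rw [this, bern_singleton (hp e), bern_singleton h1]
  cases b <;> simp

/-- The measure of an event depends only on the intensities of the edges it depends on. -/
lemma prodBern_congr {E : Type} [Countable E] {p q : E → ℝ} {F : Set E} (hpq : ∀ e ∈ F, p e = q e)
    {A : Set (Config E)} (hA : MeasurableSet A)
    (hF : ∀ ω ω' : Config E, (∀ e ∈ F, ω e = ω' e) → ω ∈ A → ω' ∈ A) :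
    prodBern p A = prodBern q A := by
  classical
  have key : ∀ p : E → ℝ, prodBern p A = prodBern (fun e : F => p e)
      ((fun (ω : Config F) e => if h : e ∈ F then ω ⟨e, h⟩ else true) ⁻¹' A) := by
    intro p
    have hm : Measurable (fun (ω : Config F) (e : E) => if h : e ∈ F then ω ⟨e, h⟩ else true) := by
      refine measurable_pi_lambda _ fun e => ?_
      by_cases h : e ∈ F
      · simp only [h, dif_pos]; fun_prop
      · simp only [h, dif_neg, not_false_eq_true]; fun_prop
    rw [← prodBern_map_comp p (Subtype.val : F → E) Subtype.val_injective,
      Measure.map_apply (by fun_prop) (hm hA)]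
    congr 1
    ext ω
    constructor
    · intro h; exact hF _ _ (fun e he => by simp [he]) h
    · intro h; exact hF _ _ (fun e he => by simp [he]) h
  rw [key p, key q]
  congr 2
  ext e
  exact hpq e e.2

/-- Resampling a single edge. -/
lemma resample_le {E : Type} [DecidableEq E] {p : E → ℝ} (e : E) (b : Bool)
    {G : Set (Config E)} (hG : MeasurableSet G) :
    bern (p e) {b} * prodBern p {ω | Function.update ω e b ∈ G} ≤ prodBern p G := by
  have hm : Measurable fun x : Config E × Bool => Function.update x.1 e x.2 := by
    refine measurable_pi_lambda _ fun e' => ?_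
    by_cases h : e' = e
    · subst h; simp only [Function.update_self]; fun_prop
    · simp only [Function.update_of_ne h]; fun_prop
  have hmap : ((prodBern p).prod (bern (p e))).map (fun x => Function.update x.1 e x.2) =
      prodBern p := by
    refine Measure.eq_infinitePi _ fun s t ht => ?_
    rw [Measure.map_apply hm (.pi s.countable_toSet fun _ _ => ht _)]
    by_cases he : e ∈ s
    · have : (fun x : Config E × Bool => Function.update x.1 e x.2) ⁻¹' (Set.pi (s : Set E) t) =
          (Set.pi ((s.erase e : Finset E) : Set E) t) ×ˢ t e := by
        ext ⟨ω, b⟩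
        simp only [mem_preimage, Set.mem_pi, Finset.mem_coe, Finset.mem_erase, mem_prod]
        constructor
        · intro h
          refine ⟨fun i hi => ?_, by simpa using h e he⟩
          simpa [Function.update_of_ne hi.1] using h i hi.2
        · rintro ⟨h1, h2⟩ i hi
          by_cases hie : i = e
          · subst hie; simpa using h2
          · simpa [Function.update_of_ne hie] using h1 i ⟨hie, hi⟩
      rw [this, Measure.prod_prod, prodBern, Measure.infinitePi_pi _ (fun _ _ => ht _),
        Finset.prod_erase_mul _ _ he]
    · have : (fun x : Config E × Bool => Function.update x.1 e x.2) ⁻¹' (Set.pi (s : Set E) t) =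
          (Set.pi (s : Set E) t) ×ˢ univ := by
        ext ⟨ω, b⟩
        simp only [mem_preimage, Set.mem_pi, Finset.mem_coe, mem_prod, mem_univ, and_true]
        refine forall₂_congr fun i hi => ?_
        rw [Function.update_of_ne (by rintro rfl; exact he hi)]
      rw [this, Measure.prod_prod, prodBern, Measure.infinitePi_pi _ (fun _ _ => ht _),
        measure_univ, mul_one]
  conv_rhs => rw [← hmap, Measure.map_apply hm hG]
  rw [mul_comm, ← Measure.prod_prod]
  refine measure_mono ?_
  rintro ⟨ω, c⟩ ⟨h1, h2⟩
  simp only [mem_singleton_iff] at h2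
  subst h2
  exact h1

end Probability

section Coupling

/-- A triangle configuration `t` and a star configuration `h` connect the same pairs of leaves
(edge `k` of the triangle is opposite to leaf `k`). -/
def Compat (t h : Fin 3 → Bool) : Prop :=
  ∀ k, (t k = true ∨ (t (k + 1) = true ∧ t (k + 2) = true)) ↔
    (h (k + 1) = true ∧ h (k + 2) = true)

instance (t h : Fin 3 → Bool) : Decidable (Compat t h) := by unfold Compat; infer_instance

noncomputable def triWt (p : Fin 3 → ℝ) (t : Fin 3 → Bool) : ℝ :=
  ∏ i, if t i then p i else 1 - p i

noncomputable def coupleWt (p : Fin 3 → ℝ) (x : (Fin 3 → Bool) × (Fin 3 → Bool)) : ℝ :=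
  if Compat x.1 x.2 then
    (if x.1 = ![false, false, false] then triWt (fun i => 1 - p i) x.2 else triWt p x.1) else 0

lemma sum_fin_three_bool (f : (Fin 3 → Bool) → ℝ) :
    ∑ t, f t = ∑ a, ∑ b, ∑ c, f ![a, b, c] := by
  rw [← Fintype.sum_bijective (fun x : Bool × Bool × Bool => ![x.1, x.2.1, x.2.2])
    (by decide) (fun x => f ![x.1, x.2.1, x.2.2]) f (fun _ => rfl)]
  simp only [Fintype.sum_prod_type]

lemma eq_vec_three (t : Fin 3 → Bool) : t = ![t 0, t 1, t 2] := by
  ext i; fin_cases i <;> rfl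

lemma coupleWt_fst (p : Fin 3 → ℝ) (hsd : kappaT (p 0) (p 1) (p 2) = 0) (t : Fin 3 → Bool) :
    ∑ h, coupleWt p (t, h) = triWt p t := by
  unfold kappaT at hsd
  rw [eq_vec_three t]
  generalize t 0 = a
  generalize t 1 = b
  generalize t 2 = c
  rw [sum_fin_three_bool]
  cases a <;> cases b <;> cases c <;>
    simp [coupleWt, triWt, Compat, Fin.forall_fin_succ, Fin.prod_univ_three]
  linear_combination hsd

lemma coupleWt_snd (p : Fin 3 → ℝ) (hsd : kappaT (p 0) (p 1) (p 2) = 0) (h : Fin 3 → Bool) :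
    ∑ t, coupleWt p (t, h) = triWt (fun i => 1 - p i) h := by
  unfold kappaT at hsd
  rw [eq_vec_three h]
  generalize h 0 = a
  generalize h 1 = b
  generalize h 2 = c
  rw [sum_fin_three_bool]
  cases a <;> cases b <;> cases c <;>
    simp [coupleWt, triWt, Compat, Fin.forall_fin_succ, Fin.prod_univ_three] 
  linear_combination hsd

lemma triWt_nonneg {p : Fin 3 → ℝ} (hp : ∀ i, p i ∈ Icc (0 : ℝ) 1) (t : Fin 3 → Bool) :
    0 ≤ triWt p t := by
  refine Finset.prod_nonneg fun i _ => ?_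
  split_ifs
  · exact (hp i).1
  · linarith [(hp i).2]

lemma one_sub_mem_Icc {q : ℝ} (h : q ∈ Icc (0 : ℝ) 1) : 1 - q ∈ Icc (0 : ℝ) 1 :=
  ⟨by linarith [h.2], by linarith [h.1]⟩

lemma coupleWt_nonneg {p : Fin 3 → ℝ} (hp : ∀ i, p i ∈ Icc (0 : ℝ) 1)
    (x : (Fin 3 → Bool) × (Fin 3 → Bool)) : 0 ≤ coupleWt p x := by
  unfold coupleWt
  split_ifs
  · exact triWt_nonneg (fun i => one_sub_mem_Icc (hp i)) _
  · exact triWt_nonneg hp _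
  · exact le_rfl

lemma infinitePi_bern_singleton {p : Fin 3 → ℝ} (hp : ∀ i, p i ∈ Icc (0 : ℝ) 1)
    (t : Fin 3 → Bool) :
    Measure.infinitePi (fun i => bern (p i)) {t} = ENNReal.ofReal (triWt p t) := by
  rw [Measure.infinitePi_singleton_of_fintype, triWt, ENNReal.ofReal_prod_of_nonneg]
  · exact Finset.prod_congr rfl fun i _ => bern_singleton (hp i) _
  · intro i _
    split_ifs
    · exact (hp i).1
    · linarith [(hp i).2]

/-- The star-triangle coupling. -/
lemma exists_coupling {p : Fin 3 → ℝ} (hp : ∀ i, p i ∈ Icc (0 : ℝ) 1)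
    (hsd : kappaT (p 0) (p 1) (p 2) = 0) :
    ∃ ν : Measure ((Fin 3 → Bool) × (Fin 3 → Bool)), IsProbabilityMeasure ν ∧
      ν.map Prod.fst = Measure.infinitePi (fun i => bern (p i)) ∧
      ν.map Prod.snd = Measure.infinitePi (fun i => bern (1 - p i)) ∧
      ∀ᵐ x ∂ν, Compat x.1 x.2 := by
  classical
  let ν : Measure ((Fin 3 → Bool) × (Fin 3 → Bool)) :=
    ∑ x, ENNReal.ofReal (coupleWt p x) • Measure.dirac x
  have happ : ∀ s, ν s = ∑ x, if x ∈ s then ENNReal.ofReal (coupleWt p x) else 0 := by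
    intro s
    simp only [ν, Measure.coe_finsetSum, Finset.sum_apply, Measure.smul_apply, smul_eq_mul]
    refine Finset.sum_congr rfl fun x _ => ?_
    rw [Measure.dirac_apply' _ MeasurableSet.of_discrete]
    by_cases h : x ∈ s <;> simp [h]
  have h1 : ν.map Prod.fst = Measure.infinitePi (fun i => bern (p i)) := by
    refine Measure.ext_of_singleton fun t => ?_
    rw [Measure.map_apply measurable_fst (MeasurableSet.singleton _), happ,
      infinitePi_bern_singleton hp, ← coupleWt_fst p hsd t,
      ENNReal.ofReal_sum_of_nonneg (fun h _ => coupleWt_nonneg hp _), Fintype.sum_prod_type,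
      Finset.sum_eq_single t]
    · simp
    · intro b _ hb; simp [hb]
    · simp
  have h2 : ν.map Prod.snd = Measure.infinitePi (fun i => bern (1 - p i)) := by
    refine Measure.ext_of_singleton fun t => ?_
    rw [Measure.map_apply measurable_snd (MeasurableSet.singleton _), happ,
      infinitePi_bern_singleton (fun i => one_sub_mem_Icc (hp i)), ← coupleWt_snd p hsd t,
      ENNReal.ofReal_sum_of_nonneg (fun h _ => coupleWt_nonneg hp _), Fintype.sum_prod_type_right,
      Finset.sum_eq_single t]
    · simp
    · intro b _ hb; simp [hb]
    · simp
  refine ⟨ν, ?_, h1, h2, ?_⟩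
  · constructor
    have : (ν.map Prod.fst) univ = 1 := by rw [h1]; simp
    rwa [Measure.map_apply measurable_fst MeasurableSet.univ, preimage_univ] at this
  · rw [ae_iff, happ]
    refine Finset.sum_eq_zero fun x _ => ?_
    split_ifs with h
    · have : ¬ Compat x.1 x.2 := h
      simp [coupleWt, this]
    · rfl

/-- Blockwise star-triangle transformation: a comparison of probabilities between two product
measures whose edges are grouped in triangles, respectively stars. -/
lemma exists_block_coupling {E J : Type} [Countable J] (σ τ : E ≃ J × Fin 3) {p q : E → ℝ}
    (hp : ∀ e, p e ∈ Icc (0 : ℝ) 1)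
    (hsd : ∀ j, kappaT (p (σ.symm (j, 0))) (p (σ.symm (j, 1))) (p (σ.symm (j, 2))) = 0)
    (hq : ∀ x, q (τ.symm x) = 1 - p (σ.symm x)) :
    ∃ Q : Measure (Config E × Config E), Q.map Prod.fst = prodBern p ∧
      Q.map Prod.snd = prodBern q ∧
      ∀ᵐ x ∂Q, ∀ j, Compat (fun i => x.1 (σ.symm (j, i))) (fun i => x.2 (τ.symm (j, i))) := by
  classical
  choose ν hν h1 h2 hc using fun j => exists_coupling (p := fun i => p (σ.symm (j, i)))
    (fun i => hp _) (hsd j)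
  have reidx : ∀ (σ : E ≃ J × Fin 3) (p : E → ℝ) (π : (Fin 3 → Bool) × (Fin 3 → Bool) → Fin 3 → Bool)
      (hπ : ∀ j, (ν j).map π = Measure.infinitePi (fun i => bern (p (σ.symm (j, i))))),
      (Measure.infinitePi ν).map (fun ω e => π (ω (σ e).1) (σ e).2) = prodBern p := by
    intro σ p π hπ
    have e1 : (Measure.infinitePi ν).map (fun ω j => π (ω j)) =
        Measure.infinitePi fun j => Measure.infinitePi fun i => bern (p (σ.symm (j, i))) := by
      rw [Measure.infinitePi_map_pi (f := fun _ => π) _ (fun _ => Measurable.of_discrete)]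
      congr 1; ext j : 1; exact hπ j
    have e2 := Measure.infinitePi_map_curry_symm
      (fun (j : J) (i : Fin 3) => bern (p (σ.symm (j, i))))
    have e3 := prodBern_map_comp (fun x : J × Fin 3 => p (σ.symm x)) σ σ.injective
    simp only [Equiv.symm_apply_apply] at e3
    rw [← e3, prodBern]
    change _ = Measure.map _ (Measure.infinitePi fun x : J × Fin 3 => bern (p (σ.symm (x.1, x.2))))
    rw [← e2, ← e1, Measure.map_map (by fun_prop), Measure.map_map (by fun_prop)]
    · rfl
    · refine measurable_pi_lambda _ fun j => ?_
      exact (Measurable.of_discrete (f := π)).comp (measurable_pi_apply j)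
    · fun_prop
  have hm : ∀ (σ : E ≃ J × Fin 3) (π : (Fin 3 → Bool) × (Fin 3 → Bool) → Fin 3 → Bool),
      Measurable fun (ω : J → (Fin 3 → Bool) × (Fin 3 → Bool)) (e : E) => π (ω (σ e).1) (σ e).2 := by
    intro σ π
    refine measurable_pi_lambda _ fun e => ?_
    exact (Measurable.of_discrete (f := fun x => π x (σ e).2)).comp (measurable_pi_apply (σ e).1)
  refine ⟨(Measure.infinitePi ν).map (fun ω => (fun e => (ω (σ e).1).1 (σ e).2,
    fun e => (ω (τ e).1).2 (τ e).2)), ?_, ?_, ?_⟩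
  · rw [Measure.map_map measurable_fst ((hm σ Prod.fst).prodMk (hm τ Prod.snd))]
    exact reidx σ p Prod.fst h1
  · rw [Measure.map_map measurable_snd ((hm σ Prod.fst).prodMk (hm τ Prod.snd))]
    refine reidx τ q Prod.snd fun j => ?_
    simp only [hq]
    exact h2 j
  · rw [ae_all_iff]
    intro j
    rw [ae_map_iff ((hm σ Prod.fst).prodMk (hm τ Prod.snd)).aemeasurable]
    · have : ∀ᵐ x ∂(Measure.infinitePi ν), Compat (x j).1 (x j).2 :=
        (measurePreserving_eval_infinitePi ν j).quasiMeasurePreserving.ae (hc j)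
      filter_upwards [this] with x hx
      simpa using hx
    · have : Measurable fun x : Config E × Config E =>
          ((fun i => x.1 (σ.symm (j, i)) : Fin 3 → Bool), (fun i => x.2 (τ.symm (j, i)) : Fin 3 → Bool)) := by
        fun_prop
      exact measurableSet_preimage this (t := {y | Compat y.1 y.2}) MeasurableSet.of_discrete

/-- Transfer of events from triangles to stars. -/
lemma transfer_tri_star {E J : Type} [Countable J] (σ τ : E ≃ J × Fin 3) {p q : E → ℝ}
    (hp : ∀ e, p e ∈ Icc (0 : ℝ) 1)
    (hsd : ∀ j, kappaT (p (σ.symm (j, 0))) (p (σ.symm (j, 1))) (p (σ.symm (j, 2))) = 0)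
    (hq : ∀ x, q (τ.symm x) = 1 - p (σ.symm x)) {A A' : Set (Config E)} (hA : MeasurableSet A)
    (h : ∀ t s : Config E, (∀ j, Compat (fun i => t (σ.symm (j, i))) (fun i => s (τ.symm (j, i)))) →
      t ∈ A → s ∈ A') : prodBern p A ≤ prodBern q A' := by
  obtain ⟨Q, h1, h2, h3⟩ := exists_block_coupling σ τ hp hsd hq
  rw [← h1, Measure.map_apply measurable_fst hA, ← h2]
  refine le_trans (measure_mono_ae ?_) (Measure.le_map_apply measurable_snd.aemeasurable _)
  filter_upwards [h3] with x hx hxA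
  exact h _ _ hx hxA

/-- Transfer of events from stars to triangles. -/
lemma transfer_star_tri {E J : Type} [Countable J] (σ τ : E ≃ J × Fin 3) {p q : E → ℝ}
    (hp : ∀ e, p e ∈ Icc (0 : ℝ) 1)
    (hsd : ∀ j, kappaT (p (σ.symm (j, 0))) (p (σ.symm (j, 1))) (p (σ.symm (j, 2))) = 0)
    (hq : ∀ x, q (τ.symm x) = 1 - p (σ.symm x)) {A A' : Set (Config E)} (hA : MeasurableSet A)
    (h : ∀ t s : Config E, (∀ j, Compat (fun i => t (σ.symm (j, i))) (fun i => s (τ.symm (j, i)))) →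
      s ∈ A → t ∈ A') : prodBern q A ≤ prodBern p A' := by
  obtain ⟨Q, h1, h2, h3⟩ := exists_block_coupling σ τ hp hsd hq
  rw [← h1, ← h2, Measure.map_apply measurable_snd hA]
  refine le_trans (measure_mono_ae ?_) (Measure.le_map_apply measurable_fst.aemeasurable _)
  filter_upwards [h3] with x hx hxA
  exact h _ _ hx hxA

end Coupling

section Graph

variable {E V : Type}

/-- One step, inside `S`, along an edge satisfying `o`. -/
def Stp (en : E → V × V) (o : E → Prop) (S : Set V) (x y : V) : Prop :=
  x ∈ S ∧ y ∈ S ∧ ∃ e, o e ∧ (en e = (x, y) ∨ en e = (y, x))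

/-- `x` and `y` are joined inside `S` by a path of edges satisfying `o`. -/
def Conn (en : E → V × V) (o : E → Prop) (S : Set V) (x y : V) : Prop :=
  x ∈ S ∧ Relation.ReflTransGen (Stp en o S) x y

/-- The predicate of being an open edge. -/
def Op (ω : Config E) : E → Prop := fun e => ω e = true

variable {en : E → V × V} {o o' : E → Prop} {S S' : Set V} {x y z : V}

lemma Stp.symm (h : Stp en o S x y) : Stp en o S y x := by
  obtain ⟨hx, hy, e, he, h⟩ := h
  exact ⟨hy, hx, e, he, h.symm⟩

lemma Conn.refl (hx : x ∈ S) : Conn en o S x x := ⟨hx, .refl⟩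

lemma Conn.trans (h : Conn en o S x y) (h' : Conn en o S y z) : Conn en o S x z :=
  ⟨h.1, h.2.trans h'.2⟩

lemma Conn.tail (h : Conn en o S x y) (h' : Stp en o S y z) : Conn en o S x z :=
  ⟨h.1, h.2.tail h'⟩

lemma Stp.conn (h : Stp en o S x y) : Conn en o S x y := ⟨h.1, .single h⟩

lemma Conn.mem_right (h : Conn en o S x y) : y ∈ S := by
  obtain ⟨hx, h⟩ := h
  induction h with
  | refl => exact hx
  | tail _ h _ => exact h.2.1

lemma Conn.symm (h : Conn en o S x y) : Conn en o S y x :=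
  ⟨h.mem_right, @Std.Symm.symm _ _ (@Relation.ReflTransGen.stdSymm _ _ ⟨fun _ _ h => h.symm⟩) _ _ h.2⟩

lemma Stp.mono (ho : ∀ e, (en e).1 ∈ S → (en e).2 ∈ S → o e → o' e) (hS : S ⊆ S')
    (h : Stp en o S x y) : Stp en o' S' x y := by
  obtain ⟨hx, hy, e, he, h⟩ := h
  refine ⟨hS hx, hS hy, e, ?_, h⟩
  rcases h with h | h <;> exact ho e (by rw [h]; assumption) (by rw [h]; assumption) he

lemma Conn.mono' (ho : ∀ e, (en e).1 ∈ S → (en e).2 ∈ S → o e → o' e) (hS : S ⊆ S')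
    (h : Conn en o S x y) : Conn en o' S' x y :=
  ⟨hS h.1, Relation.ReflTransGen.mono (fun _ _ h => Stp.mono ho hS h) _ _ h.2⟩

lemma Conn.mono (hS : S ⊆ S') (h : Conn en o S x y) : Conn en o S' x y :=
  h.mono' (fun _ _ _ h => h) hS

@[elab_as_elim]
lemma Conn.induct {P : (y : V) → Conn en o S x y → Prop} {y : V} (h : Conn en o S x y)
    (h0 : ∀ hx : x ∈ S, P x (.refl hx))
    (hs : ∀ y z (hxy : Conn en o S x y) (hyz : Stp en o S y z), P y hxy → P z (hxy.tail hyz)) :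
    P y h := by
  obtain ⟨hx, h⟩ := h
  induction h with
  | refl => exact h0 hx
  | tail h h' ih => exact hs _ _ ⟨hx, h⟩ h' ih

lemma Conn.map {E' V' : Type} {en' : E' → V' × V'} {o' : E' → Prop} {S' : Set V'} (φ : V → V')
    (hS : ∀ x ∈ S, φ x ∈ S')
    (h : ∀ e, o e → ∃ e', o' e' ∧ (en' e' = (φ (en e).1, φ (en e).2) ∨
      en' e' = (φ (en e).2, φ (en e).1)))
    (hc : Conn en o S x y) : Conn en' o' S' (φ x) (φ y) := by
  induction hc using Conn.induct with
  | h0 hx => exact .refl (hS _ hx)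
  | hs y z hy hyz ih =>
    refine ih.tail ⟨hS _ hyz.1, hS _ hyz.2.1, ?_⟩
    obtain ⟨-, -, e, he, h'⟩ := hyz
    obtain ⟨e', he', h''⟩ := h e he
    refine ⟨e', he', ?_⟩
    rcases h' with h' | h' <;> rw [h'] at h'' <;> tauto

/-- The first step of a nontrivial path. -/
lemma Conn.head_cases (h : Conn en o S x y) :
    x = y ∨ ∃ z, Stp en o S x z ∧ Conn en o S z y := by
  obtain ⟨hx, h⟩ := h
  rcases Relation.ReflTransGen.cases_head h with h | ⟨z, h1, h2⟩
  · exact .inl h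
  · exact .inr ⟨z, h1, h1.2.1, h2⟩

/-- The path up to the first visit of `B`. -/
lemma Conn.first_hit (h : Conn en o S x y) (B : Set V) (hx : x ∉ B) (hy : y ∈ B) :
    ∃ w z, Conn en o (S \ B) x w ∧ Stp en o S w z ∧ z ∈ B := by
  have : (∃ w z, Conn en o (S \ B) x w ∧ Stp en o S w z ∧ z ∈ B) ∨ Conn en o (S \ B) x y := by
    clear hy
    induction h using Conn.induct with
    | h0 hx' => exact .inr (.refl ⟨hx', hx⟩)
    | hs y z _ hyz ih =>
      rcases ih with h | h
      · exact .inl h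
      · by_cases hz : z ∈ B
        · exact .inl ⟨y, z, h, hyz, hz⟩
        · exact .inr (h.tail ⟨⟨hyz.1, h.mem_right.2⟩, ⟨hyz.2.1, hz⟩, hyz.2.2⟩)
  rcases this with h | h
  · exact h
  · exact absurd hy h.mem_right.2

lemma Conn.exists_finset (h : Conn en o S x y) :
    ∃ F : Finset E, (∀ e ∈ F, o e) ∧ Conn en (· ∈ F) S x y := by
  classical
  induction h using Conn.induct with
  | h0 hx => exact ⟨∅, by simp, .refl hx⟩
  | hs y z _ hyz ih =>
    obtain ⟨F, hF, hc⟩ := ih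
    obtain ⟨hy, hz, e, he, h'⟩ := hyz
    refine ⟨insert e F, ?_, ?_⟩
    · simpa [he] using hF
    · exact (hc.mono' (fun e _ _ h => Finset.mem_insert_of_mem h) le_rfl).tail
        ⟨hy, hz, e, Finset.mem_insert_self _ _, h'⟩

lemma measurableSet_conn [Countable E] (en : E → V × V) (S : Set V) (x y : V) :
    MeasurableSet {ω : Config E | Conn en (Op ω) S x y} := by
  have : {ω : Config E | Conn en (Op ω) S x y} =
      ⋃ F ∈ {F : Finset E | Conn en (· ∈ F) S x y}, ⋂ e ∈ F, {ω | ω e = true} := by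
    ext ω
    simp only [mem_ofPred_eq, mem_iUnion, mem_iInter, exists_prop]
    constructor
    · intro h
      obtain ⟨F, hF, hc⟩ := h.exists_finset
      exact ⟨F, hc, hF⟩
    · rintro ⟨F, hc, hF⟩
      exact hc.mono' (fun e _ _ he => hF e he) le_rfl
  rw [this]
  refine MeasurableSet.biUnion (Set.to_countable _) fun F _ => ?_
  refine F.measurableSet_biInter fun e _ => ?_
  exact measurableSet_eq_fun (measurable_pi_apply e) measurable_const

end Graph

section Increasing

variable {E : Type}

/-- `A` is an increasing event depending only on the edges in `F`. -/
def LocInc (F : Set E) (A : Set (Config E)) : Prop :=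
  ∀ ω ω' : Config E, (∀ e ∈ F, ω e = true → ω' e = true) → ω ∈ A → ω' ∈ A

lemma LocInc.mono {F F' : Set E} {A : Set (Config E)} (h : LocInc F A) (hF : F ⊆ F') :
    LocInc F' A := fun ω ω' h' => h ω ω' fun e he => h' e (hF he)

lemma LocInc.inter {F : Set E} {A B : Set (Config E)} (hA : LocInc F A) (hB : LocInc F B) :
    LocInc F (A ∩ B) := fun ω ω' h h' => ⟨hA ω ω' h h'.1, hB ω ω' h h'.2⟩

lemma LocInc.congr {F : Set E} {A : Set (Config E)} (hA : LocInc F A) (ω ω' : Config E)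
    (h : ∀ e ∈ F, ω e = ω' e) : ω ∈ A → ω' ∈ A :=
  hA ω ω' fun e he h' => (h e he) ▸ h'

lemma locInc_conn {V : Type} (en : E → V × V) (S : Set V) (x y : V) :
    LocInc {e | (en e).1 ∈ S ∧ (en e).2 ∈ S} {ω | Conn en (Op ω) S x y} := by
  intro ω ω' h hc
  exact Conn.mono' (fun e h1 h2 he => h e ⟨h1, h2⟩ he) le_rfl hc

lemma prodBern_eq_sum {p : E → ℝ} (hp : ∀ e, p e ∈ Icc (0 : ℝ) 1) (F : Finset E)
    {A : Set (Config E)} (hA : LocInc (F : Set E) A) [DecidablePred (· ∈ A)] [DecidableEq E] :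
    prodBern p A = ENNReal.ofReal (∑ f : F → Bool, (∏ e, if f e then p e else 1 - p e) *
      if (fun e => if h : e ∈ F then f ⟨e, h⟩ else true) ∈ A then 1 else 0) := by
  set ext : (F → Bool) → Config E := fun f e => if h : e ∈ F then f ⟨e, h⟩ else true with hext
  have hm : Measurable fun (ω : Config E) (e : F) => ω e := by fun_prop
  have hA' : A = (fun (ω : Config E) (e : F) => ω e) ⁻¹' (ext ⁻¹' A) := by
    ext ω
    constructor
    · intro h; exact hA.congr _ _ (fun e he => by simp [hext, Finset.mem_coe.1 he]) h
    · intro h; exact hA.congr _ _ (fun e he => by simp [hext, Finset.mem_coe.1 he]) h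
  have h1 : prodBern p A = prodBern (fun e : F => p e) (ext ⁻¹' A) := by
    rw [← prodBern_map_comp p (Subtype.val : F → E) Subtype.val_injective,
      Measure.map_apply hm MeasurableSet.of_discrete, ← hA']
  have h2 : ext ⁻¹' A = ((Finset.univ.filter fun f => ext f ∈ A : Finset (F → Bool)) : Set _) := by
    ext f; simp
  rw [h1, h2, ← sum_measure_singleton, Finset.sum_filter, ENNReal.ofReal_sum_of_nonneg]
  · refine Finset.sum_congr rfl fun f _ => ?_
    split_ifs with h
    · rw [prodBern, Measure.infinitePi_singleton_of_fintype, mul_one,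
        ENNReal.ofReal_prod_of_nonneg]
      · exact Finset.prod_congr rfl fun e _ => bern_singleton (hp e) _
      · intro e _
        split_ifs
        · exact (hp e).1
        · linarith [(hp e).2]
    · simp
  · intro f _
    refine mul_nonneg (Finset.prod_nonneg fun e _ => ?_) (by split_ifs <;> norm_num)
    split_ifs
    · exact (hp e).1
    · linarith [(hp e).2]

/-- The Harris–FKG inequality. -/
lemma prodBern_inter_ge {p : E → ℝ} (hp : ∀ e, p e ∈ Icc (0 : ℝ) 1) {F : Set E} (hF : F.Finite)
    {A B : Set (Config E)} (hA : LocInc F A) (hB : LocInc F B) :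
    prodBern p A * prodBern p B ≤ prodBern p (A ∩ B) := by
  classical
  obtain ⟨F, rfl⟩ := hF.exists_finset_coe
  set w : (F → Bool) → ℝ := fun f => ∏ e, if f e then p e else 1 - p e with hw
  have hw0 : 0 ≤ w := by
    intro f
    refine Finset.prod_nonneg fun e _ => ?_
    split_ifs
    · exact (hp e).1
    · linarith [(hp e).2]
  have hmono : ∀ {A : Set (Config E)}, LocInc (F : Set E) A → Monotone fun f : F → Bool =>
      if (fun e => if h : e ∈ F then f ⟨e, h⟩ else true) ∈ A then (1 : ℝ) else 0 := by
    intro A hA f g hfg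
    dsimp only
    split_ifs with h1 h2 h2
    · exact le_rfl
    · refine absurd (hA _ _ (fun e he => ?_) h1) h2
      have he' : e ∈ F := he
      simp only [he', dif_pos]
      intro h
      have := hfg ⟨e, he'⟩
      rw [h] at this
      exact top_le_iff.1 this
    · norm_num
    · exact le_rfl
  have hfkg := fkg (μ := w) (f := fun f : F → Bool =>
      if (fun e => if h : e ∈ F then f ⟨e, h⟩ else true) ∈ A then (1 : ℝ) else 0)
      (g := fun f : F → Bool =>
      if (fun e => if h : e ∈ F then f ⟨e, h⟩ else true) ∈ B then (1 : ℝ) else 0) hw0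
      (fun f => by dsimp only; split_ifs <;> simp) (fun f => by dsimp only; split_ifs <;> simp)
      (hmono hA) (hmono hB) (by
        intro a b
        simp only [hw, ← Finset.prod_mul_distrib]
        refine le_of_eq (Finset.prod_congr rfl fun e _ => ?_)
        simp only [Pi.inf_apply, Pi.sup_apply]
        have key : ∀ x y : Bool, ((if x then p e else 1 - p e) * if y then p e else 1 - p e) =
            (if x ⊓ y then p e else 1 - p e) * if x ⊔ y then p e else 1 - p e := by
          intro x y
          cases x <;> cases y <;> simp [mul_comm]
        exact key _ _)
  have hone : ∑ f, w f = 1 := by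
    have := prodBern_eq_sum hp F (A := univ) (fun _ _ _ _ => trivial)
    simp only [measure_univ, mem_univ, if_true, mul_one] at this
    have h2 := congrArg ENNReal.toReal this
    rw [ENNReal.toReal_ofReal (Finset.sum_nonneg fun f _ => hw0 f)] at h2
    simpa using h2.symm
  rw [hone, one_mul] at hfkg
  rw [prodBern_eq_sum hp F hA, prodBern_eq_sum hp F hB, prodBern_eq_sum hp F (hA.inter hB),
    ← ENNReal.ofReal_mul]
  · refine ENNReal.ofReal_le_ofReal (hfkg.trans (le_of_eq ?_))
    refine Finset.sum_congr rfl fun f _ => ?_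
    congr 1
    simp only [mem_inter_iff, ite_and]
    split_ifs <;> simp
  · exact Finset.sum_nonneg fun f _ => mul_nonneg (hw0 f) (by split_ifs <;> simp)

lemma prodBern_biInter_ge {p : E → ℝ} (hp : ∀ e, p e ∈ Icc (0 : ℝ) 1) {F : Set E} (hF : F.Finite)
    {I : Type} (s : Finset I) {A : I → Set (Config E)} (hA : ∀ i ∈ s, LocInc F (A i)) :
    ∏ i ∈ s, prodBern p (A i) ≤ prodBern p (⋂ i ∈ s, A i) := by
  classical
  induction s using Finset.induction_on with
  | empty => simp
  | insert a s ha ih =>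
    rw [Finset.prod_insert ha, Finset.set_biInter_insert]
    refine le_trans (mul_le_mul_right (ih fun i hi => hA i (Finset.mem_insert_of_mem hi)) _) ?_
    refine prodBern_inter_ge hp hF (hA a (Finset.mem_insert_self _ _)) ?_
    intro ω ω' h hω
    simp only [mem_iInter] at hω ⊢
    exact fun i hi => hA i (Finset.mem_insert_of_mem hi) ω ω' h (hω i hi)

end Increasing

section Blocks

/-- Endpoints of triangular edges in lattice coordinates. -/
def triEnd (e : TriE) : (ℤ × ℤ) × (ℤ × ℤ) :=
  if e.2.2 = 0 then ((e.1, e.2.1), (e.1 + 1, e.2.1))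
  else if e.2.2 = 1 then ((e.1 + 1, e.2.1), (e.1, e.2.1 + 1))
  else ((e.1, e.2.1), (e.1, e.2.1 + 1))

/-- Vertices of the hexagonal lattice: `(a, b, true)` is the upward triangle at `(a, b)` and
`(a, b, false)` the downward triangle below the horizontal edge at `(a, b)`. -/
abbrev HV := ℤ × ℤ × Bool

/-- Endpoints of hexagonal edges. -/
def hexEnd (e : TriE) : HV × HV :=
  if e.2.2 = 0 then ((e.1, e.2.1, false), (e.1, e.2.1, true))
  else if e.2.2 = 1 then ((e.1, e.2.1, true), (e.1, e.2.1 + 1, false))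
  else ((e.1, e.2.1, true), (e.1 - 1, e.2.1 + 1, false))

@[simp] lemma triEnd_zero (a b : ℤ) : triEnd (a, b, 0) = ((a, b), (a + 1, b)) := rfl
@[simp] lemma triEnd_one (a b : ℤ) : triEnd (a, b, 1) = ((a + 1, b), (a, b + 1)) := rfl
@[simp] lemma triEnd_two (a b : ℤ) : triEnd (a, b, 2) = ((a, b), (a, b + 1)) := rfl
@[simp] lemma hexEnd_zero (a b : ℤ) : hexEnd (a, b, 0) = ((a, b, false), (a, b, true)) := rfl
@[simp] lemma hexEnd_one (a b : ℤ) : hexEnd (a, b, 1) = ((a, b, true), (a, b + 1, false)) := rfl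
@[simp] lemma hexEnd_two (a b : ℤ) :
    hexEnd (a, b, 2) = ((a, b, true), (a - 1, b + 1, false)) := rfl

lemma triE_cases {P : TriE → Prop} (h0 : ∀ a b, P (a, b, 0)) (h1 : ∀ a b, P (a, b, 1))
    (h2 : ∀ a b, P (a, b, 2)) (e : TriE) : P e := by
  obtain ⟨a, b, i⟩ := e
  fin_cases i
  · exact h0 a b
  · exact h1 a b
  · exact h2 a b

/-- Compatibility of a triangular and a hexagonal configuration when each upward triangle is
replaced by a star. -/
def CompatUp (t s : TriE → Prop) : Prop := ∀ a b,
  (t (a - 1, b + 1, 0) ∨ t (a - 1, b, 1) ∧ t (a, b, 2) ↔ s (a, b, 1) ∧ s (a, b, 2)) ∧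
  (t (a - 1, b, 1) ∨ t (a, b, 2) ∧ t (a - 1, b + 1, 0) ↔ s (a, b, 2) ∧ s (a, b, 0)) ∧
  (t (a, b, 2) ∨ t (a - 1, b + 1, 0) ∧ t (a - 1, b, 1) ↔ s (a, b, 0) ∧ s (a, b, 1))

/-- Compatibility of a hexagonal and a triangular configuration when the star at each downward
triangle is replaced by a triangle. -/
def CompatDown (s t : TriE → Prop) : Prop := ∀ a b,
  (t (a, b, 0) ∨ t (a, b, 1) ∧ t (a, b, 2) ↔ s (a, b - 1, 1) ∧ s (a + 1, b - 1, 2)) ∧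
  (t (a, b, 1) ∨ t (a, b, 2) ∧ t (a, b, 0) ↔ s (a + 1, b - 1, 2) ∧ s (a, b, 0)) ∧
  (t (a, b, 2) ∨ t (a, b, 0) ∧ t (a, b, 1) ↔ s (a, b, 0) ∧ s (a, b - 1, 1))

/-- Grouping of triangular edges by the star replacing them. -/
def upBlock : TriE ≃ (ℤ × ℤ) × Fin 3 where
  toFun e := if e.2.2 = 0 then ((e.1 + 1, e.2.1 - 1), 0)
    else if e.2.2 = 1 then ((e.1 + 1, e.2.1), 1) else ((e.1, e.2.1), 2)
  invFun x := if x.2 = 0 then (x.1.1 - 1, x.1.2 + 1, 0)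
    else if x.2 = 1 then (x.1.1 - 1, x.1.2, 1) else (x.1.1, x.1.2, 2)
  left_inv e := by
    induction e using triE_cases <;> simp
  right_inv x := by
    obtain ⟨⟨a, b⟩, i⟩ := x
    fin_cases i <;> simp

/-- Grouping of hexagonal edges by their downward endpoint. -/
def downBlock : TriE ≃ (ℤ × ℤ) × Fin 3 where
  toFun e := if e.2.2 = 0 then ((e.1, e.2.1), 0)
    else if e.2.2 = 1 then ((e.1, e.2.1 + 1), 1) else ((e.1 - 1, e.2.1 + 1), 2)
  invFun x := if x.2 = 0 then (x.1.1, x.1.2, 0)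
    else if x.2 = 1 then (x.1.1, x.1.2 - 1, 1) else (x.1.1 + 1, x.1.2 - 1, 2)
  left_inv e := by
    induction e using triE_cases <;> simp
  right_inv x := by
    obtain ⟨⟨a, b⟩, i⟩ := x
    fin_cases i <;> simp

/-- Grouping of edges by position. -/
def idBlock : TriE ≃ (ℤ × ℤ) × Fin 3 := (Equiv.prodAssoc ℤ ℤ (Fin 3)).symm

lemma tri_le_hex {p0 : ℝ} {q q' : ℤ → ℝ} (hp : ∀ e, triHI p0 q q' e ∈ Icc (0 : ℝ) 1)
    (hsd : ∀ b, kappaT p0 (q b) (q' b) = 0) {A A' : Set (Config TriE)} (hA : MeasurableSet A)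
    (h : ∀ t s : Config TriE, CompatUp (Op t) (Op s) → t ∈ A → s ∈ A') :
    prodBern (triHI p0 q q') A ≤ prodBern (fun e => 1 - triHI p0 q q' e) A' := by
  refine transfer_tri_star upBlock idBlock hp ?_ ?_ hA ?_
  · rintro ⟨a, b⟩
    simpa [upBlock, triHI] using hsd b
  · rintro ⟨⟨a, b⟩, i⟩
    fin_cases i <;> simp [upBlock, idBlock, triHI]
  · intro t s hc
    refine h t s fun a b => ?_
    have := hc (a, b)
    simp only [Compat, upBlock, idBlock] at this
    refine ⟨by simpa [Op] using this 0, by simpa [Op] using this 1, by simpa [Op] using this 2⟩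

lemma hex_le_tri {p0 : ℝ} {q q' : ℤ → ℝ} (hp : ∀ e, triHI p0 q q' e ∈ Icc (0 : ℝ) 1)
    (hsd : ∀ b, kappaT p0 (q b) (q' b) = 0) {A A' : Set (Config TriE)} (hA : MeasurableSet A)
    (h : ∀ s t : Config TriE, CompatDown (Op s) (Op t) → s ∈ A → t ∈ A') :
    prodBern (fun e => 1 - triHI p0 q q' e) A ≤
      prodBern (triHI p0 (fun b => q (b - 1)) (fun b => q' (b - 1))) A' := by
  refine transfer_star_tri idBlock downBlock ?_ ?_ ?_ hA ?_
  · intro e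
    induction e using triE_cases with
    | h0 a b => simpa [triHI] using hp (a, b, 0)
    | h1 a b => simpa [triHI] using hp (a, b - 1, 1)
    | h2 a b => simpa [triHI] using hp (a, b - 1, 2)
  · rintro ⟨a, b⟩
    simpa [idBlock, triHI] using hsd (b - 1)
  · rintro ⟨⟨a, b⟩, i⟩
    fin_cases i <;> simp [downBlock, idBlock, triHI]
  · intro t s hc
    refine h s t fun a b => ?_
    have := hc (a, b)
    simp only [Compat, downBlock, idBlock] at this
    refine ⟨by simpa [Op] using this 0, by simpa [Op] using this 1, by simpa [Op] using this 2⟩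

/-- The upward triangle replacing a triangular edge. -/
def edgeUp (e : TriE) : HV :=
  if e.2.2 = 0 then (e.1 + 1, e.2.1 - 1, true)
  else if e.2.2 = 1 then (e.1 + 1, e.2.1, true) else (e.1, e.2.1, true)

lemma Conn.tri_to_hex {t s : TriE → Prop} (hc : CompatUp t s) {S : Set (ℤ × ℤ)} {S' : Set HV}
    (hS : ∀ u ∈ S, (u.1, u.2, false) ∈ S')
    (hU : ∀ e, (triEnd e).1 ∈ S → (triEnd e).2 ∈ S → edgeUp e ∈ S') {u v : ℤ × ℤ}
    (h : Conn triEnd t S u v) : Conn hexEnd s S' (u.1, u.2, false) (v.1, v.2, false) := by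
  induction h using Conn.induct with
  | h0 hx => exact .refl (hS _ hx)
  | hs y z hy hyz ih =>
    refine ih.trans ?_
    obtain ⟨h1, h2, e, he, h⟩ := hyz
    have key : Conn hexEnd s S' ((triEnd e).1.1, (triEnd e).1.2, false)
        ((triEnd e).2.1, (triEnd e).2.2, false) := by
      have h1' : (triEnd e).1 ∈ S := by rcases h with h | h <;> rw [h] <;> assumption
      have h2' : (triEnd e).2 ∈ S := by rcases h with h | h <;> rw [h] <;> assumption
      have h3 := hU e h1' h2'
      have h4 := hS _ h1'
      have h5 := hS _ h2'
      clear h hS hU ih hy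
      induction e using triE_cases with
      | h0 a b =>
        have h6 := (hc (a + 1) (b - 1)).1.1 (.inl (by simpa using he))
        refine Conn.trans (y := (a + 1, b - 1, true)) (Stp.conn ?_) (Stp.conn ?_)
        · exact ⟨h4, h3, _, h6.2, .inr (by simp)⟩
        · exact ⟨h3, h5, _, h6.1, .inl (by simp)⟩
      | h1 a b =>
        have h6 := (hc (a + 1) b).2.1.1 (.inl (by simpa using he))
        refine Conn.trans (y := (a + 1, b, true)) (Stp.conn ?_) (Stp.conn ?_)
        · exact ⟨h4, h3, _, h6.2, .inl (by simp)⟩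
        · exact ⟨h3, h5, _, h6.1, .inl (by simp)⟩
      | h2 a b =>
        have h6 := (hc a b).2.2.1 (.inl he)
        refine Conn.trans (y := (a, b, true)) (Stp.conn ?_) (Stp.conn ?_)
        · exact ⟨h4, h3, _, h6.1, .inl (by simp)⟩
        · exact ⟨h3, h5, _, h6.2, .inl (by simp)⟩
    rcases h with h | h <;> rw [h] at key
    · exact key
    · exact key.symm

lemma Stp.hex_down {s : TriE → Prop} {S : Set HV} {a b : ℤ} {y : HV}
    (h : Stp hexEnd s S (a, b, false) y) :
    (s (a, b, 0) ∧ y = (a, b, true)) ∨ (s (a, b - 1, 1) ∧ y = (a, b - 1, true)) ∨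
      (s (a + 1, b - 1, 2) ∧ y = (a + 1, b - 1, true)) := by
  obtain ⟨-, -, e, he, h⟩ := h
  induction e using triE_cases with
  | h0 a' b' =>
    simp [Prod.ext_iff] at h
    obtain ⟨⟨rfl, rfl⟩, h1, h2, h3⟩ := h
    exact .inl ⟨he, by ext <;> simp [*]⟩
  | h1 a' b' =>
    simp [Prod.ext_iff] at h
    obtain ⟨⟨h1, h2, h3⟩, rfl, rfl⟩ := h
    exact .inr (.inl ⟨by simpa using he, by ext <;> simp [*]⟩)
  | h2 a' b' =>
    simp [Prod.ext_iff] at h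
    obtain ⟨⟨h1, h2, h3⟩, rfl, rfl⟩ := h
    exact .inr (.inr ⟨by simpa using he, by ext <;> simp [*]⟩)

lemma Stp.hex_up {s : TriE → Prop} {S : Set HV} {a b : ℤ} {y : HV}
    (h : Stp hexEnd s S (a, b, true) y) :
    (s (a, b, 0) ∧ y = (a, b, false)) ∨ (s (a, b, 1) ∧ y = (a, b + 1, false)) ∨
      (s (a, b, 2) ∧ y = (a - 1, b + 1, false)) := by
  obtain ⟨-, -, e, he, h⟩ := h
  induction e using triE_cases with
  | h0 a' b' =>
    simp [Prod.ext_iff] at h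
    obtain ⟨⟨h1, h2, h3⟩, rfl, rfl⟩ := h
    exact .inl ⟨he, by ext <;> simp [*]⟩
  | h1 a' b' =>
    simp [Prod.ext_iff] at h
    obtain ⟨⟨rfl, rfl⟩, h1, h2, h3⟩ := h
    exact .inr (.inl ⟨by simpa using he, by ext <;> simp [*]⟩)
  | h2 a' b' =>
    simp [Prod.ext_iff] at h
    obtain ⟨⟨rfl, rfl⟩, h1, h2, h3⟩ := h
    exact .inr (.inr ⟨by simpa using he, by ext <;> simp [*]⟩)

lemma Stp.exists_up {s : TriE → Prop} {S : Set HV} {a b : ℤ} {y : HV}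
    (h : Stp hexEnd s S (a, b, false) y) : ∃ z : ℤ × ℤ, y = (z.1, z.2, true) := by
  rcases h.hex_down with h | h | h
  · exact ⟨(a, b), h.2⟩
  · exact ⟨(a, b - 1), h.2⟩
  · exact ⟨(a + 1, b - 1), h.2⟩

/-- A path between two distinct downward triangles starts and ends with upward ones. -/
lemma Conn.hex_trim {s : TriE → Prop} {S : Set HV} {u v : ℤ × ℤ} (huv : u ≠ v)
    (h : Conn hexEnd s S (u.1, u.2, false) (v.1, v.2, false)) :
    ∃ z z' : ℤ × ℤ, Stp hexEnd s S (u.1, u.2, false) (z.1, z.2, true) ∧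
      Stp hexEnd s S (v.1, v.2, false) (z'.1, z'.2, true) ∧
      Conn hexEnd s S (z.1, z.2, true) (z'.1, z'.2, true) := by
  rcases h.head_cases with h | ⟨w, hw, h⟩
  · simp [Prod.ext_iff] at h huv
    exact absurd h.2 (huv h.1)
  obtain ⟨z, rfl⟩ := hw.exists_up
  rcases h.symm.head_cases with h | ⟨w', hw', h⟩
  · simp at h
  obtain ⟨z', rfl⟩ := hw'.exists_up
  exact ⟨z, z', hw, hw', h.symm⟩

/-- Passing from the star at a downward triangle to the triangle replacing it. -/
lemma star_to_tri {s t : TriE → Prop} (hc : CompatDown s t) {S : Set HV} {S' : Set (ℤ × ℤ)}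
    (hS : ∀ a b, (a, b, true) ∈ S → (a, b + 1) ∈ S') {a b : ℤ}
    (h0 : (a, b + 1) ∈ S' ∨ ¬ t (a, b, 1)) (h1 : (a, b) ∈ S') (h2 : (a + 1, b) ∈ S')
    {w w' : ℤ × ℤ} (hw : Stp hexEnd s S (a, b, false) (w.1, w.2, true))
    (hw' : Stp hexEnd s S (a, b, false) (w'.1, w'.2, true)) :
    Conn triEnd t S' (w.1, w.2 + 1) (w'.1, w'.2 + 1) := by
  obtain ⟨c0, c1, c2⟩ := hc a b
  have m := hS _ _ hw.2.1
  have m' := hS _ _ hw'.2.1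
  have e0 : t (a, b, 0) → Conn triEnd t S' (a, b) (a + 1, b) := fun h =>
    Stp.conn ⟨h1, h2, _, h, .inl rfl⟩
  have e1 : (a, b + 1) ∈ S' → t (a, b, 1) → Conn triEnd t S' (a + 1, b) (a, b + 1) :=
    fun m h => Stp.conn ⟨h2, m, _, h, .inl rfl⟩
  have e2 : (a, b + 1) ∈ S' → t (a, b, 2) → Conn triEnd t S' (a, b) (a, b + 1) :=
    fun m h => Stp.conn ⟨h1, m, _, h, .inl rfl⟩
  have f0 : s (a, b - 1, 1) → s (a + 1, b - 1, 2) → Conn triEnd t S' (a, b) (a + 1, b) := by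
    intro i j
    rcases c0.2 ⟨i, j⟩ with h | ⟨h, h'⟩
    · exact e0 h
    · rcases h0 with h0 | h0
      · exact (e2 h0 h').trans (e1 h0 h).symm
      · exact absurd h h0
  have f1 : (a, b + 1) ∈ S' → s (a + 1, b - 1, 2) → s (a, b, 0) →
      Conn triEnd t S' (a + 1, b) (a, b + 1) := by
    intro m i j
    rcases c1.2 ⟨i, j⟩ with h | ⟨h, h'⟩
    · exact e1 m h
    · exact (e0 h').symm.trans (e2 m h)
  have f2 : (a, b + 1) ∈ S' → s (a, b, 0) → s (a, b - 1, 1) →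
      Conn triEnd t S' (a, b) (a, b + 1) := by
    intro m i j
    rcases c2.2 ⟨i, j⟩ with h | ⟨h, h'⟩
    · exact e2 m h
    · exact (e0 h).trans (e1 m h')
  obtain ⟨w1, w2⟩ := w
  obtain ⟨w1', w2'⟩ := w'
  rcases hw.hex_down with ⟨i, h⟩ | ⟨i, h⟩ | ⟨i, h⟩ <;>
    rcases hw'.hex_down with ⟨j, h'⟩ | ⟨j, h'⟩ | ⟨j, h'⟩ <;>
    simp only [Prod.mk.injEq, and_true] at h h' <;> obtain ⟨rfl, rfl⟩ := h <;>
    obtain ⟨rfl, rfl⟩ := h' <;> simp only [sub_add_cancel] at m m' ⊢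
  · exact .refl m
  · exact (f2 m i j).symm
  · exact (f1 m j i).symm
  · exact f2 m' j i
  · exact .refl m
  · exact f0 i j
  · exact f1 m' i j
  · exact (f0 j i).symm
  · exact .refl m

lemma Conn.hex_to_tri {s t : TriE → Prop} (hc : CompatDown s t) {S : Set HV} {S' : Set (ℤ × ℤ)}
    (hS : ∀ a b, (a, b, true) ∈ S → (a, b + 1) ∈ S')
    (hD : ∀ a b, (a, b, false) ∈ S →
      ((a, b + 1) ∈ S' ∨ ¬ t (a, b, 1)) ∧ (a, b) ∈ S' ∧ (a + 1, b) ∈ S')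
    {u v : ℤ × ℤ} (h : Conn hexEnd s S (u.1, u.2, true) (v.1, v.2, true)) :
    Conn triEnd t S' (u.1, u.2 + 1) (v.1, v.2 + 1) := by
  have : ∃ w : ℤ × ℤ, (((w.1, w.2, true) = ((v.1, v.2, true) : HV)) ∨
      Stp hexEnd s S (v.1, v.2, true) (w.1, w.2, true)) ∧
      Conn triEnd t S' (u.1, u.2 + 1) (w.1, w.2 + 1) := by
    generalize ((v.1, v.2, true) : HV) = y at h
    induction h using Conn.induct with
    | h0 hx => exact ⟨u, .inl rfl, .refl (hS _ _ hx)⟩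
    | hs y z hy hyz ih =>
      obtain ⟨a, b, i⟩ := y
      obtain ⟨w, hw, hcon⟩ := ih
      cases i with
      | true =>
        have hw : (w.1, w.2, true) = ((a, b, true) : HV) := by
          rcases hw with hw | hw
          · exact hw
          · rcases hw.hex_up with h | h | h <;> simp at h
        exact ⟨w, .inr (hw ▸ hyz.symm), hcon⟩
      | false =>
        have hw : Stp hexEnd s S (a, b, false) (w.1, w.2, true) := by
          rcases hw with hw | hw
          · simp at hw
          · exact hw
        obtain ⟨w', rfl⟩ := hyz.exists_up
        obtain ⟨d0, d1, d2⟩ := hD _ _ hyz.1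
        exact ⟨w', .inl rfl, hcon.trans (star_to_tri hc hS d0 d1 d2 hw hyz)⟩
  obtain ⟨w, hw, hcon⟩ := this
  rcases hw with hw | hw
  · simp only [Prod.mk.injEq, and_true] at hw
    rwa [hw.1, hw.2] at hcon
  · rcases hw.hex_up with h | h | h <;> simp at h

end Blocks

section Planarity

/-- The strip of the triangular lattice containing a triangle. -/
def strip (x : HV) : ℤ := if x.2.2 then x.2.1 else x.2.1 - 1

/-- The triangle lies weakly to the left of the edge, in the strip of the edge. -/
def LeftOf (e : TriE) (x : HV) : Prop :=
  (e.2.2 = 1 ∧ (x.2.2 = true ∧ x.2.1 = e.2.1 ∧ x.1 ≤ e.1 ∨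
    x.2.2 = false ∧ x.2.1 = e.2.1 + 1 ∧ x.1 < e.1)) ∨
  (e.2.2 = 2 ∧ (x.2.2 = true ∧ x.2.1 = e.2.1 ∧ x.1 < e.1 ∨
    x.2.2 = false ∧ x.2.1 = e.2.1 + 1 ∧ x.1 < e.1))

/-- The vertices whose leftward ray meets the edge dual to a hexagonal edge. -/
def Toggle (e : TriE) (v : ℤ × ℤ) : Prop := e.2.2 = 0 ∧ v.2 = e.2.1 ∧ e.1 < v.1

lemma toggle_iff {e e' : TriE} (h : e ≠ e') :
    (Toggle e' (triEnd e).1 ↔ Toggle e' (triEnd e).2) ↔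
      (LeftOf e (hexEnd e').1 ↔ LeftOf e (hexEnd e').2) := by
  induction e using triE_cases with
  | h0 a b =>
    induction e' using triE_cases with
    | h0 a' b' =>
      simp only [Toggle, LeftOf, triEnd_zero, hexEnd_zero, ne_eq, Prod.mk.injEq] at h ⊢
      simp
      intro hb
      have : a ≠ a' := fun h' => h ⟨h', hb, trivial⟩
      constructor <;> intro _ <;> omega
    | h1 a' b' => simp [Toggle, LeftOf]
    | h2 a' b' => simp [Toggle, LeftOf]
  | h1 a b =>
    induction e' using triE_cases with
    | h0 a' b' =>
      simp [Toggle, LeftOf]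
      by_cases hb : b = b'
      · subst hb; simp
      · by_cases hb' : b + 1 = b'
        · subst hb'; simp
        · have : ¬ b' = b := fun h => hb h.symm
          have : ¬ b' = b + 1 := fun h => hb' h.symm
          simp [*]
    | h1 a' b' =>
      simp only [Toggle, LeftOf, ne_eq, Prod.mk.injEq, hexEnd_one] at h ⊢
      simp
      intro hb
      have : a ≠ a' := fun h' => h ⟨h', hb.symm, trivial⟩
      omega
    | h2 a' b' =>
      simp [Toggle, LeftOf]
  | h2 a b =>
    induction e' using triE_cases with
    | h0 a' b' =>
      simp [Toggle, LeftOf]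
      by_cases hb : b = b'
      · subst hb; simp
      · by_cases hb' : b + 1 = b'
        · subst hb'; simp
        · have : ¬ b' = b := fun h => hb h.symm
          have : ¬ b' = b + 1 := fun h => hb' h.symm
          simp [*]
    | h1 a' b' =>
      simp [Toggle, LeftOf]
    | h2 a' b' =>
      simp only [Toggle, LeftOf, ne_eq, Prod.mk.injEq, hexEnd_two] at h ⊢
      simp
      intro hb
      have : a ≠ a' := fun h' => h ⟨h', hb.symm, trivial⟩
      omega

lemma toggle_right {e : TriE} {c : ℤ} (h : (hexEnd e).1.2.2 = true → (hexEnd e).1.1 < c)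
    (h' : (hexEnd e).2.2.2 = true → (hexEnd e).2.1 < c) {a b : ℤ} (ha : c ≤ a) :
    Toggle e (a, b) ↔ ¬ ((strip (hexEnd e).1 < b) ↔ (strip (hexEnd e).2 < b)) := by
  induction e using triE_cases with
  | h0 i j =>
    simp at h'
    simp [Toggle, strip]
    omega
  | h1 i j => simp [Toggle, strip]
  | h2 i j => simp [Toggle, strip]

lemma toggle_left {e : TriE} {c : ℤ} (h : (hexEnd e).1.2.2 = true → c ≤ (hexEnd e).1.1)
    (h' : (hexEnd e).2.2.2 = true → c ≤ (hexEnd e).2.1) {a b : ℤ} (ha : a ≤ c) :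
    ¬ Toggle e (a, b) := by
  induction e using triE_cases with
  | h0 i j =>
    simp at h'
    simp [Toggle]
    omega
  | h1 i j => simp [Toggle]
  | h2 i j => simp [Toggle]

lemma iff_chain {a b t₁ t₂ x y z : Prop} (h : (t₁ ↔ t₂) ↔ (y ↔ z)) (h' : (a ↔ b) ↔ (x ↔ y)) :
    (¬ (a ↔ t₁) ↔ ¬ (b ↔ t₂)) ↔ (x ↔ z) := by
  by_cases p1 : a <;> by_cases p2 : b <;> by_cases p3 : x <;> by_cases p4 : y <;>
    by_cases p5 : z <;> by_cases p6 : t₁ <;> simp_all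

/-- A horizontal triangular path and a vertical hexagonal path use dual edges. -/
lemma not_cross {t d : TriE → Prop} (htd : ∀ e, t e → ¬ d e) {S : Set (ℤ × ℤ)} {S' : Set HV}
    {u v : ℤ × ℤ} {x y : HV} {r₁ r₂ c₁ c₂ : ℤ} (ht : Conn triEnd t S u v)
    (hS : ∀ z ∈ S, r₁ ≤ z.2 ∧ z.2 ≤ r₂) (hu : u.1 ≤ c₁) (hv : c₂ ≤ v.1)
    (hd : Conn hexEnd d S' x y)
    (hS' : ∀ z ∈ S', z.2.2 = true → c₁ ≤ z.1 ∧ z.1 < c₂) (hx : strip x < r₁)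
    (hy : r₂ ≤ strip y) : False := by
  have key : ∃ φ : ℤ × ℤ → Prop,
      (∀ e, ¬ d e → ((φ (triEnd e).1 ↔ φ (triEnd e).2) ↔ (LeftOf e x ↔ LeftOf e y))) ∧
      (∀ a b, a ≤ c₁ → ¬ φ (a, b)) ∧
      (∀ a b, c₂ ≤ a → (φ (a, b) ↔ ¬ (strip x < b ↔ strip y < b))) := by
    clear hy ht
    induction hd using Conn.induct with
    | h0 hx => exact ⟨fun _ => False, by simp, by simp, by simp⟩
    | hs y z hy hyz ih =>
      obtain ⟨φ, h1, h2, h3⟩ := ih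
      obtain ⟨hy', hz', e', he', hyz⟩ := hyz
      have hm : (hexEnd e').1 ∈ S' ∧ (hexEnd e').2 ∈ S' := by
        rcases hyz with h | h <;> rw [h] <;> exact ⟨by assumption, by assumption⟩
      have hl : ∀ e, (LeftOf e (hexEnd e').1 ↔ LeftOf e (hexEnd e').2) ↔
          (LeftOf e y ↔ LeftOf e z) := by
        intro e; rcases hyz with h | h <;> rw [h]; exact iff_comm
      have hs : ∀ b, ((strip (hexEnd e').1 < b) ↔ (strip (hexEnd e').2 < b)) ↔
          (strip y < b ↔ strip z < b) := by
        intro e; rcases hyz with h | h <;> rw [h]; exact iff_comm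
      refine ⟨fun v => ¬ (φ v ↔ Toggle e' v), ?_, ?_, ?_⟩
      · intro e he
        have hne : e ≠ e' := by rintro rfl; exact he he'
        have := toggle_iff hne
        rw [hl e] at this
        have h1 := h1 e he
        exact iff_chain this h1
      · intro a b ha
        have := toggle_left (fun h => (hS' _ hm.1 h).1) (fun h => (hS' _ hm.2 h).1) (b := b) ha
        simp [h2 a b ha, this]
      · intro a b ha
        have := toggle_right (fun h => (hS' _ hm.1 h).2) (fun h => (hS' _ hm.2 h).2) (b := b) ha
        rw [hs b] at this
        show ¬ (φ (a, b) ↔ Toggle e' (a, b)) ↔ _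
        rw [this, h3 a b ha]
        generalize (strip x < b) = p1
        generalize (strip y < b) = p2
        generalize (strip z < b) = p3
        by_cases h1 : p1 <;> by_cases h2 : p2 <;> by_cases h3 : p3 <;> simp [*]
  obtain ⟨φ, h1, h2, h3⟩ := key
  have : ¬ φ v := by
    clear hv
    induction ht using Conn.induct with
    | h0 h => exact h2 _ _ hu
    | hs w z _ hwz ih =>
      obtain ⟨hw, hz, e, he, h⟩ := hwz
      have hl : ∀ q, strip q < r₁ ∨ r₂ ≤ strip q → ¬ LeftOf e q := by
        intro q hq hl
        have hm : (triEnd e).1 ∈ S ∧ (triEnd e).2 ∈ S := by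
          rcases h with h | h <;> rw [h] <;> exact ⟨by assumption, by assumption⟩
        have m1 := hS _ hm.1
        have m2 := hS _ hm.2
        obtain ⟨q1, q2, q3⟩ := q
        clear h h1
        induction e using triE_cases with
        | h0 a b => simp [LeftOf] at hl
        | h1 a b =>
          simp [LeftOf] at hl m1 m2
          simp [strip] at hq
          cases q3 <;> simp at hq hl <;> omega
        | h2 a b =>
          simp [LeftOf] at hl m1 m2
          simp [strip] at hq
          cases q3 <;> simp at hq hl <;> omega
      have := (h1 e (htd e he)).2 ⟨fun h => absurd h (hl x (.inl hx)),
        fun h => absurd h (hl y (.inr hy))⟩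
      rcases h with h | h <;> rw [h] at this <;> tauto
  have hv' := hS _ ht.mem_right
  refine this ((h3 v.1 v.2 hv).2 ?_)
  rw [iff_true_left (by omega)]
  omega

/-- Crossings in the two directions meet. -/
lemma cross_meet {o : TriE → Prop} {S S' : Set (ℤ × ℤ)} {u v x y : ℤ × ℤ} {r₁ r₂ c₁ c₂ : ℤ}
    (hV : Conn triEnd o S u v) (hH : Conn triEnd o S' x y)
    (hS' : ∀ z ∈ S', r₁ ≤ z.2 ∧ z.2 ≤ r₂) (hx : x.1 ≤ c₁) (hy : c₂ ≤ y.1)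
    (hS : ∀ z ∈ S, c₁ ≤ z.1 ∧ z.1 < c₂) (hu : u.2 < r₁) (hv : r₂ ≤ v.2) :
    ∃ z, Conn triEnd o S u z ∧ Conn triEnd o S' x z := by
  by_contra! hne
  set A := {z | Conn triEnd o S u z}
  set B := {z | Conn triEnd o S' x z}
  have hHt : Conn triEnd (fun e => (triEnd e).1 ∈ B ∧ (triEnd e).2 ∈ B) S' x y := by
    clear hy
    induction hH using Conn.induct with
    | h0 h => exact .refl h
    | hs w z hw hwz ih =>
      refine ih.tail ?_
      obtain ⟨h1, h2, e, he, h⟩ := hwz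
      have hw : w ∈ B := hw
      have hz : z ∈ B := Conn.tail hw ⟨h1, h2, e, he, h⟩
      refine ⟨h1, h2, e, ?_, h⟩
      rcases h with h | h <;> rw [h] <;> exact ⟨by assumption, by assumption⟩
  have hVd : Conn hexEnd (fun e => (triEnd e).1 ∈ A ∨ (triEnd e).2 ∈ A)
      {z | z.2.2 = true → (z.1, z.2.1) ∈ S} (u.1, u.2, true) (v.1, v.2, true) := by
    clear hv
    induction hV using Conn.induct with
    | h0 h => exact .refl (fun _ => h)
    | hs w z hw hwz ih =>
      refine ih.trans ?_
      clear ih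
      obtain ⟨h1, h2, e, he, h⟩ := hwz
      have hw : w ∈ A := hw
      have hz : z ∈ A := Conn.tail hw ⟨h1, h2, e, he, h⟩
      have m1 : (triEnd e).1 ∈ S ∧ (triEnd e).2 ∈ S := by
        rcases h with h | h <;> rw [h] <;> exact ⟨by assumption, by assumption⟩
      have m2 : (triEnd e).1 ∈ A ∧ (triEnd e).2 ∈ A := by
        rcases h with h | h <;> rw [h] <;> exact ⟨by assumption, by assumption⟩
      have key : Conn hexEnd (fun e => (triEnd e).1 ∈ A ∨ (triEnd e).2 ∈ A)
          {z | z.2.2 = true → (z.1, z.2.1) ∈ S} ((triEnd e).1.1, (triEnd e).1.2, true)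
          ((triEnd e).2.1, (triEnd e).2.2, true) := by
        clear h
        induction e using triE_cases with
        | h0 a b =>
          refine Conn.trans (y := (a, b + 1, false))
            (Stp.conn ⟨fun _ => m1.1, by simp, (a, b, 1), .inl m2.2, .inl rfl⟩)
            (Stp.conn ⟨by simp, fun _ => m1.2, (a + 1, b, 2), .inl m2.2, .inr (by simp)⟩)
        | h1 a b =>
          refine Conn.trans (y := (a, b + 1, false))
            (Stp.conn ⟨fun _ => m1.1, by simp, (a + 1, b, 2), .inl m2.1, .inl (by simp)⟩)
            (Stp.conn ⟨by simp, fun _ => m1.2, (a, b + 1, 0), .inl m2.2, .inl (by simp)⟩)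
        | h2 a b =>
          refine Conn.trans (y := (a, b + 1, false))
            (Stp.conn ⟨fun _ => m1.1, by simp, (a, b, 1), .inr m2.2, .inl (by simp)⟩)
            (Stp.conn ⟨by simp, fun _ => m1.2, (a, b + 1, 0), .inl m2.2, .inl (by simp)⟩)
      rcases h with h | h <;> rw [h] at key
      · exact key
      · exact key.symm
  refine not_cross ?_ hHt hS' hx hy hVd (fun z hz h => hS _ (hz h)) (by simpa [strip] using hu)
    (by simpa [strip] using hv)
  rintro e ⟨h1, h2⟩ (h | h)
  · exact hne _ h h1
  · exact hne _ h h2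

/-- If a box has no horizontal triangular crossing then it has a dual vertical one. -/
lemma exists_dual_cross {o : TriE → Prop} {x₁ x₂ r₁ r₂ : ℤ} (hx : x₁ ≤ x₂) (hr : r₁ ≤ r₂)
    (h : ∀ u v : ℤ × ℤ, u.1 = x₁ → v.1 = x₂ →
      ¬ Conn triEnd o {z | x₁ ≤ z.1 ∧ z.1 ≤ x₂ ∧ r₁ ≤ z.2 ∧ z.2 ≤ r₂} u v) :
    ∃ a a', Conn hexEnd (fun e => ¬ o e)
      {z | x₁ ≤ z.1 ∧ z.1 < x₂ ∧ r₁ ≤ z.2.1 ∧ z.2.1 ≤ r₂} (a, r₁, false) (a', r₂, true) := by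
  classical
  set D : Set (ℤ × ℤ) := {z | x₁ ≤ z.1 ∧ z.1 ≤ x₂ ∧ r₁ ≤ z.2 ∧ z.2 ≤ r₂} with hD
  set D' : Set HV := {z | x₁ ≤ z.1 ∧ z.1 < x₂ ∧ r₁ ≤ z.2.1 ∧ z.2.1 ≤ r₂} with hD'
  set R : Set (ℤ × ℤ) := {z | ∃ u : ℤ × ℤ, u.1 = x₁ ∧ Conn triEnd o D u z} with hR
  set c : TriE → Prop := fun e => ¬ ((triEnd e).1 ∈ R ↔ (triEnd e).2 ∈ R) with hc
  set K : Set HV := {y | ∃ a, Conn hexEnd c D' (a, r₁, false) y} with hK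
  suffices ∃ a, (a, r₂, true) ∈ K by
    obtain ⟨a', a, h⟩ := this
    refine ⟨a, a', h.mono' ?_ le_rfl⟩
    intro e m1 m2 he ho
    have m : (triEnd e).1 ∈ D ∧ (triEnd e).2 ∈ D := by
      clear he ho
      induction e using triE_cases <;> simp [hD, hD'] at m1 m2 ⊢ <;> omega
    refine he ⟨?_, ?_⟩
    · rintro ⟨u, hu, hc⟩
      exact ⟨u, hu, hc.tail ⟨m.1, m.2, e, ho, .inl rfl⟩⟩
    · rintro ⟨u, hu, hc⟩
      exact ⟨u, hu, hc.tail ⟨m.2, m.1, e, ho, .inr rfl⟩⟩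
  let s : ℤ → ℤ → ZMod 2 := fun a b => if (a, b) ∈ R then 1 else 0
  let k : HV → ZMod 2 := fun y => if y ∈ K then 1 else 0
  have two : (2 : ZMod 2) = 0 := rfl
  have hk : ∀ e, (hexEnd e).1 ∈ D' → (hexEnd e).2 ∈ D' →
      (s (triEnd e).1.1 (triEnd e).1.2 + s (triEnd e).2.1 (triEnd e).2.2) * k (hexEnd e).1 =
      (s (triEnd e).1.1 (triEnd e).1.2 + s (triEnd e).2.1 (triEnd e).2.2) * k (hexEnd e).2 := by
    intro e m1 m2
    by_cases he : c e
    · have : (hexEnd e).1 ∈ K ↔ (hexEnd e).2 ∈ K := by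
        constructor
        · rintro ⟨a, hc⟩
          exact ⟨a, hc.tail ⟨m1, m2, e, he, .inl rfl⟩⟩
        · rintro ⟨a, hc⟩
          exact ⟨a, hc.tail ⟨m2, m1, e, he, .inr rfl⟩⟩
      simp only [k, this]
    · have : s (triEnd e).1.1 (triEnd e).1.2 + s (triEnd e).2.1 (triEnd e).2.2 = 0 := by
        have he' : (triEnd e).1 ∈ R ↔ (triEnd e).2 ∈ R := not_not.1 he
        simp only [s, Prod.mk.eta, he']
        split_ifs
        · rfl
        · rfl
      rw [this, zero_mul, zero_mul]
  have hs1 : ∀ b, r₁ ≤ b → b ≤ r₂ → s x₁ b = 1 := fun b h1 h2 => by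
    have : (x₁, b) ∈ R := ⟨(x₁, b), rfl, .refl ⟨le_rfl, hx, h1, h2⟩⟩
    simp [s, this]
  have hs2 : ∀ b, s x₂ b = 0 := fun b => by
    have : (x₂, b) ∉ R := by
      rintro ⟨u, hu, hc⟩
      exact h u _ hu rfl hc
    simp [s, this]
  let F : ℤ → ℤ → ZMod 2 := fun a b => (s a b + s a (b + 1)) * k (a, b, true)
  let g : ℤ → ℤ → ZMod 2 := fun a b => (s a b + s (a + 1) b) * k (a, b, true)
  have hgF : ∀ a b, x₁ ≤ a → a < x₂ → r₁ ≤ b → b < r₂ →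
      g a (b + 1) - g a b = F (a + 1) b - F a b := by
    intro a b ha ha' hb hb'
    have e1 := hk (a, b, 1) (by simp [hD']; omega) (by simp [hD']; omega)
    have e2 := hk (a, b + 1, 0) (by simp [hD']; omega) (by simp [hD']; omega)
    have e3 : (s (a + 1) b + s (a + 1) (b + 1)) * k (a + 1, b, true) =
        (s (a + 1) b + s (a + 1) (b + 1)) * k (a, b + 1, false) := by
      rcases eq_or_ne (a + 1) x₂ with h | h
      · rw [h, hs2, hs2]; simp
      · have := hk (a + 1, b, 2) (by simp [hD']; omega) (by simp [hD']; omega)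
        simpa using this
    simp only [triEnd_one, hexEnd_one, triEnd_zero, hexEnd_zero] at e1 e2
    simp only [g, F]
    linear_combination e1 - e2 - e3 + (s a (b + 1) * k (a, b + 1, false)
      - s (a + 1) b * k (a, b, true)) * two
  obtain ⟨m, rfl⟩ : ∃ m : ℕ, x₂ = x₁ + m := ⟨(x₂ - x₁).toNat, by omega⟩
  obtain ⟨l, rfl⟩ : ∃ l : ℕ, r₂ = r₁ + l := ⟨(r₂ - r₁).toNat, by omega⟩
  have hsum : ∀ j : ℕ, j ≤ l → ∑ i ∈ Finset.range m, g (x₁ + i) (r₁ + j) = 1 := by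
    intro j
    induction j with
    | zero =>
      intro _
      have : ∀ i ∈ Finset.range m, g (x₁ + i) (r₁ + (0 : ℕ)) =
          s (x₁ + (i + 1 : ℕ)) r₁ - s (x₁ + i) r₁ := by
        intro i hi
        have hi : i < m := Finset.mem_range.1 hi
        have hm : (hexEnd (x₁ + i, r₁, 0)).1 ∈ K := ⟨x₁ + i, .refl (by simp [hD']; omega)⟩
        have := hk (x₁ + i, r₁, 0) (by simp [hD']; omega) (by simp [hD']; omega)
        simp only [triEnd_zero] at this
        simp only [g, Nat.cast_zero, add_zero]
        have h1 : k (hexEnd (x₁ + i, r₁, 0)).1 = 1 := by simp only [k, hm, if_true]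
        rw [h1] at this
        simp only [hexEnd_zero] at this
        rw [← this]
        push_cast
        rw [← add_assoc]
        linear_combination (s (x₁ + i) r₁) * two
      rw [Finset.sum_congr rfl this, Finset.sum_range_sub (fun i : ℕ => s (x₁ + i) r₁), hs2,
        Nat.cast_zero, add_zero, hs1 _ le_rfl hr]
      rfl
    | succ j ih =>
      intro hj
      have ih := ih (by omega)
      have : ∑ i ∈ Finset.range m, (g (x₁ + i) (r₁ + j + 1) - g (x₁ + i) (r₁ + j)) =
          F (x₁ + m) (r₁ + j) - F (x₁ + (0 : ℕ)) (r₁ + j) := by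
        rw [← Finset.sum_range_sub (fun i : ℕ => F (x₁ + i) (r₁ + j))]
        refine Finset.sum_congr rfl fun i hi => ?_
        have hi : i < m := Finset.mem_range.1 hi
        rw [hgF _ _ (by omega) (by omega) (by omega) (by omega)]
        push_cast
        rw [← add_assoc]
      have h1 : F (x₁ + m) (r₁ + j) = 0 := by simp [F, hs2]
      have h2 : F (x₁ + (0 : ℕ)) (r₁ + j) = 0 := by
        simp only [F, Nat.cast_zero, add_zero]
        rw [hs1 _ (by omega) (by omega), hs1 _ (by omega) (by omega)]
        rw [show (1 + 1 : ZMod 2) = 0 from rfl, zero_mul]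
      rw [h1, h2, Finset.sum_sub_distrib, ih, sub_zero, sub_eq_zero] at this
      rw [← this]
      push_cast
      simp only [add_assoc]
  have := hsum l le_rfl
  obtain ⟨i, _, hi⟩ := Finset.exists_ne_zero_of_sum_ne_zero (this.trans_ne one_ne_zero)
  refine ⟨x₁ + i, by_contra fun hK => hi ?_⟩
  simp [g, k, hK]

/-- Transposition on edges. -/
def swapE (e : TriE) : TriE :=
  if e.2.2 = 0 then (e.2.1, e.1, 2) else if e.2.2 = 1 then (e.2.1, e.1, 1) else (e.2.1, e.1, 0)

/-- Transposition on triangles. -/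
def swapH (x : HV) : HV := if x.2.2 then (x.2.1, x.1, true) else (x.2.1 - 1, x.1 + 1, false)

@[simp] lemma swapE_zero (a b : ℤ) : swapE (a, b, 0) = (b, a, 2) := rfl
@[simp] lemma swapE_one (a b : ℤ) : swapE (a, b, 1) = (b, a, 1) := rfl
@[simp] lemma swapE_two (a b : ℤ) : swapE (a, b, 2) = (b, a, 0) := rfl
@[simp] lemma swapH_up (a b : ℤ) : swapH (a, b, true) = (b, a, true) := rfl
@[simp] lemma swapH_down (a b : ℤ) : swapH (a, b, false) = (b - 1, a + 1, false) := rfl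

@[simp] lemma swapE_swapE (e : TriE) : swapE (swapE e) = e := by
  induction e using triE_cases <;> rfl

@[simp] lemma swapH_swapH (x : HV) : swapH (swapH x) = x := by
  obtain ⟨a, b, i⟩ := x
  cases i <;> simp

lemma triEnd_swapE (e : TriE) : triEnd (swapE e) = ((triEnd e).1.swap, (triEnd e).2.swap) ∨
    triEnd (swapE e) = ((triEnd e).2.swap, (triEnd e).1.swap) := by
  induction e using triE_cases <;> simp

lemma hexEnd_swapE (e : TriE) : hexEnd (swapE e) = (swapH (hexEnd e).1, swapH (hexEnd e).2) ∨
    hexEnd (swapE e) = (swapH (hexEnd e).2, swapH (hexEnd e).1) := by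
  induction e using triE_cases <;> simp

lemma Conn.tri_swap {o : TriE → Prop} {S : Set (ℤ × ℤ)} {x y : ℤ × ℤ}
    (h : Conn triEnd o S x y) :
    Conn triEnd (fun e => o (swapE e)) {z | z.swap ∈ S} x.swap y.swap :=
  h.map Prod.swap (fun x hx => by simpa using hx)
    fun e he => ⟨swapE e, by simpa using he, triEnd_swapE e⟩

lemma Conn.hex_swap {o : TriE → Prop} {S : Set HV} {x y : HV} (h : Conn hexEnd o S x y) :
    Conn hexEnd (fun e => o (swapE e)) {z | swapH z ∈ S} (swapH x) (swapH y) :=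
  h.map swapH (fun x hx => by simpa using hx)
    fun e he => ⟨swapE e, by simpa using he, hexEnd_swapE e⟩

/-- A vertical triangular path and a horizontal hexagonal path use dual edges. -/
lemma not_cross_swap {t d : TriE → Prop} (htd : ∀ e, t e → ¬ d e) {S : Set (ℤ × ℤ)} {S' : Set HV}
    {u v : ℤ × ℤ} {x y : HV} {r₁ r₂ c₁ c₂ : ℤ} (ht : Conn triEnd t S u v)
    (hS : ∀ z ∈ S, c₁ ≤ z.1 ∧ z.1 ≤ c₂) (hu : u.2 ≤ r₁) (hv : r₂ ≤ v.2)
    (hd : Conn hexEnd d S' x y)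
    (hS' : ∀ z ∈ S', z.2.2 = true → r₁ ≤ z.2.1 ∧ z.2.1 < r₂) (hx : x.1 < c₁)
    (hy : c₂ ≤ y.1) : False := by
  have hs : ∀ x : HV, strip (swapH x) = x.1 := by
    rintro ⟨a, b, i⟩
    cases i <;> simp [strip]
  refine not_cross (r₁ := c₁) (r₂ := c₂) (c₁ := r₁) (c₂ := r₂)
    (fun e => htd (swapE e)) ht.tri_swap (fun z hz => hS _ hz) hu hv hd.hex_swap ?_
    (by rwa [hs]) (by rwa [hs])
  rintro ⟨a, b, i⟩ hz rfl
  exact hS' _ hz rfl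

/-- If a box has no vertical triangular crossing then it has a dual horizontal one. -/
lemma exists_dual_cross_swap {o : TriE → Prop} {x₁ x₂ r₁ r₂ : ℤ} (hx : x₁ ≤ x₂) (hr : r₁ ≤ r₂)
    (h : ∀ u v : ℤ × ℤ, u.2 = r₁ → v.2 = r₂ →
      ¬ Conn triEnd o {z | x₁ ≤ z.1 ∧ z.1 ≤ x₂ ∧ r₁ ≤ z.2 ∧ z.2 ≤ r₂} u v) :
    ∃ b b', Conn hexEnd (fun e => ¬ o e)
      {z | if z.2.2 then x₁ ≤ z.1 ∧ z.1 ≤ x₂ ∧ r₁ ≤ z.2.1 ∧ z.2.1 < r₂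
        else x₁ ≤ z.1 + 1 ∧ z.1 + 1 ≤ x₂ ∧ r₁ < z.2.1 ∧ z.2.1 ≤ r₂}
      (x₁ - 1, b, false) (x₂, b', true) := by
  obtain ⟨a, a', hc⟩ := exists_dual_cross (o := fun e => o (swapE e)) hr hx fun u v hu hv hc =>
    h u.swap v.swap hu hv ((hc.tri_swap).mono' (fun e _ _ he => by simpa using he)
      (fun z hz => by simp at hz ⊢; omega))
  refine ⟨a + 1, a', hc.hex_swap.mono' (fun e _ _ he => by simpa using he) ?_⟩
  rintro ⟨a, b, i⟩ hz
  cases i <;> simp at hz ⊢ <;> omega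

end Planarity

section CrossingEvents

variable {E V : Type}

/-- The event that `A` and `B` are joined by an open path inside `S`. -/
def Crs (en : E → V × V) (S A B : Set V) : Set (Config E) :=
  {ω | ∃ u ∈ A, ∃ v ∈ B, Conn en (Op ω) S u v}

lemma measurableSet_crs [Countable E] [Countable V] (en : E → V × V) (S A B : Set V) :
    MeasurableSet (Crs en S A B) := by
  have : Crs en S A B = ⋃ u ∈ A, ⋃ v ∈ B, {ω | Conn en (Op ω) S u v} := by
    ext ω; simp [Crs]
  rw [this]
  exact MeasurableSet.biUnion (Set.to_countable _) fun u _ =>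
    MeasurableSet.biUnion (Set.to_countable _) fun v _ => measurableSet_conn en S u v

lemma locInc_crs (en : E → V × V) (S A B : Set V) :
    LocInc {e | (en e).1 ∈ S ∧ (en e).2 ∈ S} (Crs en S A B) := by
  rintro ω ω' h ⟨u, hu, v, hv, hc⟩
  exact ⟨u, hu, v, hv, locInc_conn en S u v ω ω' h hc⟩

lemma crs_mono {en : E → V × V} {S S' A A' B B' : Set V} (hS : S ⊆ S') (hA : A ⊆ A')
    (hB : B ⊆ B') : Crs en S A B ⊆ Crs en S' A' B' := by
  rintro ω ⟨u, hu, v, hv, hc⟩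
  exact ⟨u, hA hu, v, hB hv, hc.mono hS⟩

lemma prodBern_crs_congr [Countable E] [Countable V] {p q : E → ℝ} {en : E → V × V}
    {S A B : Set V} (h : ∀ e, (en e).1 ∈ S → (en e).2 ∈ S → p e = q e) :
    prodBern p (Crs en S A B) = prodBern q (Crs en S A B) :=
  prodBern_congr (fun e he => h e he.1 he.2) (measurableSet_crs en S A B)
    (locInc_crs en S A B).congr

lemma prodBern_exists_eq_zero [Countable E] {p : E → ℝ} (F : Set E) (b : Bool)
    (hp : ∀ e ∈ F, p e = if b then 0 else 1) :
    prodBern p {ω | ∃ e ∈ F, ω e = b} = 0 := by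
  have : {ω : Config E | ∃ e ∈ F, ω e = b} = ⋃ e ∈ F, {ω | ω e = b} := by ext; simp
  rw [this, measure_biUnion_null_iff (Set.to_countable _)]
  intro e he
  have h01 : p e ∈ Icc (0 : ℝ) 1 := by rw [hp e he]; cases b <;> simp
  rw [prodBern]
  have := Measure.infinitePi_map_eval (μ := fun e => bern (p e)) e
  have h2 : {ω : Config E | ω e = b} = (fun ω : Config E => ω e) ⁻¹' {b} := rfl
  rw [h2, ← Measure.map_apply (measurable_pi_apply e) (MeasurableSet.singleton b)]
  erw [this]
  rw [bern_singleton h01, hp e he]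
  cases b <;> simp

end CrossingEvents

section Transport

/-- Intensities `(p₀, p₁, p₂)` on the rows below `n` and `(p₀, 0, 1 - p₀)` on the others. -/
noncomputable def mixed (p0 p1 p2 : ℝ) (n : ℤ) : TriE → ℝ :=
  triHI p0 (fun b => if b < n then p1 else 0) (fun b => if b < n then p2 else 1 - p0)

variable {p0 p1 p2 : ℝ}

lemma mixed_mem (h0 : p0 ∈ Icc (0 : ℝ) 1) (h1 : p1 ∈ Icc (0 : ℝ) 1) (h2 : p2 ∈ Icc (0 : ℝ) 1)
    (n : ℤ) (e : TriE) : mixed p0 p1 p2 n e ∈ Icc (0 : ℝ) 1 := by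
  have h3 : (0 : ℝ) ∈ Icc (0 : ℝ) 1 := by simp
  have h4 := one_sub_mem_Icc h0
  simp only [mixed, triHI]
  split_ifs <;> assumption

lemma mixed_selfDual (hsd : kappaT p0 p1 p2 = 0) (n b : ℤ) :
    kappaT p0 (if b < n then p1 else 0) (if b < n then p2 else 1 - p0) = 0 := by
  split_ifs
  · exact hsd
  · simp [kappaT]

lemma mixed_shift (n : ℤ) :
    triHI p0 (fun b => if b - 1 < n then p1 else 0) (fun b => if b - 1 < n then p2 else 1 - p0) =
      mixed p0 p1 p2 (n + 1) := by
  simp only [mixed, sub_lt_iff_lt_add]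

lemma mixed_eq_of_lt {n : ℤ} {e : TriE} (h : e.2.2 ≠ 0 → e.2.1 < n) :
    mixed p0 p1 p2 n e = triInt p0 p1 p2 e := by
  induction e using triE_cases with
  | h0 a b => simp [mixed, triHI, triInt]
  | h1 a b => simp [mixed, triHI, triInt] at h ⊢; omega
  | h2 a b => simp [mixed, triHI, triInt] at h ⊢; omega

lemma mixed_eq_of_le {n : ℤ} {e : TriE} (h : e.2.2 ≠ 0 → n ≤ e.2.1) :
    mixed p0 p1 p2 n e = triInt p0 0 (1 - p0) e := by
  induction e using triE_cases with
  | h0 a b => simp [mixed, triHI, triInt]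
  | h1 a b => simp [mixed, triHI, triInt] at h ⊢; omega
  | h2 a b => simp [mixed, triHI, triInt] at h ⊢; omega

lemma mixed_hex_le (h0 : p0 ∈ Icc (0 : ℝ) 1) (h1 : p1 ∈ Icc (0 : ℝ) 1) (h2 : p2 ∈ Icc (0 : ℝ) 1)
    (hsd : kappaT p0 p1 p2 = 0) {n R : ℤ} (hn : n < R) {A A' : Set (Config TriE)}
    (hA : MeasurableSet A)
    (h : ∀ s t : Config TriE, CompatDown (Op s) (Op t) → (∀ a, ¬ Op t (a, R, 1)) →
      s ∈ A → t ∈ A') :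
    prodBern (fun e => 1 - mixed p0 p1 p2 n e) A ≤ prodBern (mixed p0 p1 p2 (n + 1)) A' := by
  have := hex_le_tri (mixed_mem h0 h1 h2 n) (mixed_selfDual hsd n) hA
    (A' := A' ∪ {t | ∃ e ∈ range fun a : ℤ => ((a, R, 1) : TriE), t e = true}) (by
      intro s t hc hs
      by_cases ht : ∀ a, ¬ Op t (a, R, 1)
      · exact .inl (h s t hc ht hs)
      · push Not at ht
        obtain ⟨a, ha⟩ := ht
        exact .inr ⟨_, ⟨a, rfl⟩, ha⟩)
  rw [mixed_shift] at this
  refine (this.trans (measure_union_le _ _)).trans (le_of_eq ?_)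
  rw [prodBern_exists_eq_zero, add_zero]
  rintro _ ⟨a, rfl⟩
  simp [mixed, triHI]
  omega

lemma horizontal_step (h0 : p0 ∈ Icc (0 : ℝ) 1) (h1 : p1 ∈ Icc (0 : ℝ) 1)
    (h2 : p2 ∈ Icc (0 : ℝ) 1) (hsd : kappaT p0 p1 p2 = 0) {n r R x₁ x₂ : ℤ} (hn : n < R)
    (hx : x₁ < x₂) :
    prodBern (mixed p0 p1 p2 n)
        (Crs triEnd {z | r ≤ z.2 ∧ z.2 ≤ R} {z | z.1 ≤ x₁} {z | x₂ ≤ z.1}) ≤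
      prodBern (mixed p0 p1 p2 (n + 1))
        (Crs triEnd {z | r ≤ z.2 ∧ z.2 ≤ R} {z | z.1 ≤ x₁ + 1} {z | x₂ ≤ z.1}) := by
  set S : Set HV := {z | if z.2.2 then r ≤ z.2.1 + 1 ∧ z.2.1 < R else r ≤ z.2.1 ∧ z.2.1 ≤ R} with hS
  refine le_trans (tri_le_hex (mixed_mem h0 h1 h2 n) (mixed_selfDual hsd n)
    (measurableSet_crs _ _ _ _) (A' := Crs hexEnd S {z | z.2.2 = true ∧ z.1 ≤ x₁ + 1}
      {z | z.2.2 = true ∧ x₂ ≤ z.1}) ?_)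
    (mixed_hex_le h0 h1 h2 hsd hn (measurableSet_crs _ _ _ _) ?_)
  · rintro t s hc ⟨u, hu, v, hv, h⟩
    simp only [mem_ofPred_eq] at hu hv
    have h' := h.tri_to_hex hc (S' := S) (fun u hu => by simpa [hS] using hu) (by
      intro e
      induction e using triE_cases <;> simp [hS, edgeUp])
    obtain ⟨z, z', hz, hz', hzz⟩ := h'.hex_trim (by rintro rfl; omega)
    refine ⟨_, ⟨rfl, ?_⟩, _, ⟨rfl, ?_⟩, hzz⟩
    · rcases hz.hex_down with ⟨-, h⟩ | ⟨-, h⟩ | ⟨-, h⟩ <;> simp at h <;> simp <;> omega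
    · rcases hz'.hex_down with ⟨-, h⟩ | ⟨-, h⟩ | ⟨-, h⟩ <;> simp at h <;> simp <;> omega
  · rintro s t hc ht ⟨⟨u1, u2, i⟩, hu, ⟨v1, v2, j⟩, hv, h⟩
    obtain ⟨rfl, hu⟩ := hu
    obtain ⟨rfl, hv⟩ := hv
    refine ⟨_, hu, _, hv, Conn.hex_to_tri hc (S := S) (u := (u1, u2)) (v := (v1, v2)) ?_ ?_ h⟩
    · intro a b h
      simp [hS] at h ⊢
      omega
    · intro a b h
      simp [hS] at h ⊢
      refine ⟨?_, by omega⟩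
      by_cases hb : b = R
      · subst hb
        exact .inr (ht a)
      · left; omega

/-- Transport of horizontal crossings from the square to the triangular lattice. -/
lemma horizontal_transport (h0 : p0 ∈ Icc (0 : ℝ) 1) (h1 : p1 ∈ Icc (0 : ℝ) 1)
    (h2 : p2 ∈ Icc (0 : ℝ) 1) (hsd : kappaT p0 p1 p2 = 0) {r x₁ x₂ : ℤ} (k : ℕ)
    (hx : x₁ + k ≤ x₂) :
    prodBern (triInt p0 0 (1 - p0))
        (Crs triEnd {z | r ≤ z.2 ∧ z.2 ≤ r + k} {z | z.1 ≤ x₁} {z | x₂ ≤ z.1}) ≤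
      prodBern (triInt p0 p1 p2)
        (Crs triEnd {z | r ≤ z.2 ∧ z.2 ≤ r + k} {z | z.1 ≤ x₁ + k} {z | x₂ ≤ z.1}) := by
  have key : ∀ i : ℕ, i ≤ k → prodBern (mixed p0 p1 p2 r)
        (Crs triEnd {z | r ≤ z.2 ∧ z.2 ≤ r + k} {z | z.1 ≤ x₁} {z | x₂ ≤ z.1}) ≤
      prodBern (mixed p0 p1 p2 (r + i))
        (Crs triEnd {z | r ≤ z.2 ∧ z.2 ≤ r + k} {z | z.1 ≤ x₁ + i} {z | x₂ ≤ z.1}) := by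
    intro i
    induction i with
    | zero => intro _; simp
    | succ i ih =>
      intro hi
      refine (ih (by omega)).trans ?_
      have := horizontal_step h0 h1 h2 hsd (n := r + i) (r := r) (R := r + k) (x₁ := x₁ + i)
        (x₂ := x₂) (by omega) (by omega)
      push_cast
      simpa only [add_assoc] using this
  have := key k le_rfl
  rw [prodBern_crs_congr (q := triInt p0 0 (1 - p0)),
    prodBern_crs_congr (p := mixed p0 p1 p2 (r + k)) (q := triInt p0 p1 p2)] at this
  · exact this
  · intro e m1 m2
    refine mixed_eq_of_lt fun h => ?_
    induction e using triE_cases <;> simp at h m1 m2 ⊢ <;> omega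
  · intro e m1 m2
    refine mixed_eq_of_le fun h => ?_
    induction e using triE_cases <;> simp at h m1 m2 ⊢ <;> omega

end Transport

section Leaf

variable {E V : Type} {en : E → V × V} {o o' : E → Prop} {S : Set V} {x y : V}

/-- A path between vertices other than `l` can avoid `l` if `l` has a single neighbour. -/
lemma Conn.remove_leaf {l d : V} (hd : d ≠ l)
    (ho : ∀ e, o e → (en e).1 ≠ l → (en e).2 ≠ l → o' e) (hl : ∀ z, Stp en o S l z → z = d)
    (hx : x ≠ l) (hy : y ≠ l) (h : Conn en o S x y) : Conn en o' S x y := by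
  have : (y ≠ l ∧ Conn en o' S x y) ∨ (y = l ∧ Conn en o' S x d) := by
    clear hy
    induction h using Conn.induct with
    | h0 hx' => exact .inl ⟨hx, .refl hx'⟩
    | hs y z _ hyz ih =>
      rcases ih with ⟨hy, h⟩ | ⟨rfl, h⟩
      · by_cases hz : z = l
        · subst hz
          exact .inr ⟨rfl, hl _ hyz.symm ▸ h⟩
        · refine .inl ⟨hz, h.tail ⟨hyz.1, hyz.2.1, ?_⟩⟩
          obtain ⟨-, -, e, he, h'⟩ := hyz
          refine ⟨e, ho e he ?_ ?_, h'⟩ <;> rcases h' with h' | h' <;> rw [h'] <;> assumption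
      · rw [hl _ hyz]
        exact .inl ⟨hd, h⟩
  rcases this with h | h
  · exact h.2
  · exact absurd h.1 hy

end Leaf

section VerticalTransport

/-- Part of the hexagonal lattice explored by crossings from row `R` down to row `j`. -/
def hexDrop (x w j R : ℤ) : Set HV :=
  {z | x ≤ z.1 ∧ z.1 ≤ w ∧ j ≤ z.2.1 ∧ (if z.2.2 then z.2.1 < R else z.2.1 ≤ R)}

/-- The part `hexDrop x w j R` extended by the upward triangles on its lower right side. -/
def hexDropExt (x w j R : ℤ) : Set HV :=
  {z | x ≤ z.1 ∧ j ≤ z.2.1 + 1 ∧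
    (if z.2.2 then z.1 ≤ w + 1 ∧ z.2.1 < R else z.1 ≤ w ∧ z.2.1 ≤ R)}

/-- Downward triangles at height `R`. -/
def hexTop (R : ℤ) : Set HV := {z | z.2.1 = R ∧ z.2.2 = false}

variable {p0 p1 p2 : ℝ} {x w j R n : ℤ}

/-- The downward triangle at `(a, j)` is joined to height `R`. -/
def hexReach (x w R j a : ℤ) : Set (Config TriE) :=
  Crs hexEnd (hexDrop x w j R) (hexTop R) {(a, j, false)}

/-- Some downward triangle at height `j` is joined to height `R`. -/
def hexReachAny (x w R j : ℤ) : Set (Config TriE) := ⋃ a ∈ Icc x w, hexReach x w R j a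

/-- Some upward triangle at height `j - 1` is joined to height `R`. -/
def hexReachUp (x w R j : ℤ) : Set (Config TriE) :=
  Crs hexEnd (hexDropExt x w j R) (hexTop R) {z | z.2.1 = j - 1 ∧ z.2.2 = true}

/-- Vertical crossings of the triangular lattice from height `R` to height `j`. -/
def triReach (x w R j : ℤ) : Set (Config TriE) :=
  Crs triEnd {z | x ≤ z.1 ∧ z.1 ≤ w ∧ z.2 ≤ R} {z | z.2 = R} {z | z.2 ≤ j}

lemma measurableSet_hexReach (x w R j a : ℤ) : MeasurableSet (hexReach x w R j a) :=
  measurableSet_crs _ _ _ _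

lemma measurableSet_hexReachAny (x w R j : ℤ) : MeasurableSet (hexReachAny x w R j) :=
  MeasurableSet.biUnion (Set.to_countable _) fun a _ => measurableSet_hexReach x w R j a

lemma triReach_hexReachAny {t s : Config TriE} (hc : CompatUp (Op t) (Op s)) (hj : j < R)
    (h : t ∈ triReach x w R j) : s ∈ hexReachAny x w R j := by
  obtain ⟨u, hu, v, hv, h⟩ := h
  simp only [mem_ofPred_eq] at hu hv
  obtain ⟨y, z, h1, h2, h3⟩ := h.first_hit {z | z.2 ≤ j} (by simp; omega) hv
  obtain ⟨a, b⟩ := z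
  have m := h2.2.1
  have m' := h1.mem_right
  simp only [mem_ofPred_eq, mem_sdiff] at h3 m m'
  have hb : b = j := by
    obtain ⟨-, -, e, -, he⟩ := h2
    induction e using triE_cases <;> simp [Prod.ext_iff] at he <;> omega
  subst hb
  simp only [hexReachAny, mem_iUnion]
  refine ⟨a, ⟨m.1, m.2.1⟩, (u.1, u.2, false), ⟨hu, rfl⟩, _, rfl, ?_⟩
  set T : Set (ℤ × ℤ) := {z | x ≤ z.1 ∧ z.1 ≤ w ∧ z.2 ≤ R ∧ b ≤ z.2 ∧ (z.2 = b → z.1 = a)}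
  have h4 : Conn triEnd (Op t) T u (a, b) := by
    refine (h1.mono ?_).tail ⟨?_, ?_, h2.2.2⟩
    · rintro z ⟨hz, hz'⟩
      simp only [mem_ofPred_eq] at hz hz'
      simp only [T, mem_ofPred_eq]
      omega
    · simp only [T, mem_ofPred_eq]
      refine ⟨m'.1.1, m'.1.2.1, m'.1.2.2, ?_, ?_⟩ <;> omega
    · simp only [T, mem_ofPred_eq]
      refine ⟨m.1, m.2.1, m.2.2, le_rfl, fun _ => trivial⟩
  refine h4.tri_to_hex hc ?_ ?_
  · intro u hu
    simp only [T, mem_ofPred_eq] at hu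
    simp only [hexDrop, mem_ofPred_eq]
    simp
    omega
  · intro e
    induction e using triE_cases <;> simp [T, hexDrop, edgeUp] <;> omega

lemma hexReachUp_triReach {s t : Config TriE} (hc : CompatDown (Op s) (Op t))
    (ht : ∀ a, ¬ Op t (a, R, 1)) (h : s ∈ hexReachUp x w R j) : t ∈ triReach x (w + 1) R j := by
  obtain ⟨⟨u1, u2, i⟩, hu, ⟨c, d, i'⟩, hv, h⟩ := h
  simp only [hexTop, mem_ofPred_eq] at hu hv
  obtain ⟨rfl, rfl⟩ := hu
  obtain ⟨rfl, rfl⟩ := hv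
  rcases h.head_cases with h | ⟨z, hz, h⟩
  · simp at h
  obtain ⟨z, rfl⟩ := hz.exists_up
  have hz2 : z.2 + 1 = u2 := by
    have m := hz.2.1
    simp [hexDropExt] at m
    rcases hz.hex_down with ⟨-, h⟩ | ⟨-, h⟩ | ⟨-, h⟩ <;> simp at h <;> omega
  refine ⟨(z.1, z.2 + 1), hz2, (c, j - 1 + 1), by simp, ?_⟩
  refine Conn.hex_to_tri hc (u := z) (v := (c, j - 1)) ?_ ?_ h
  · intro a b hab
    simp [hexDropExt] at hab ⊢
    omega
  · intro a b hab
    simp [hexDropExt] at hab ⊢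
    refine ⟨?_, by omega⟩
    by_cases hb : b = u2
    · subst hb
      exact .inr (ht a)
    · left; omega

lemma hexDrop_subset_ext {i : ℤ} (hi : j ≤ i + 1) : hexDrop x w i R ⊆ hexDropExt x w j R := by
  rintro ⟨a, b, i⟩
  cases i <;> simp [hexDrop, hexDropExt] <;> omega

lemma hexReachAny_subset_up (hj : j - 1 < R) : hexReachAny x w R (j - 1) ⊆ hexReachUp x w R j := by
  intro ω hω
  simp only [hexReachAny, mem_iUnion] at hω
  obtain ⟨a, ha, u, hu, v, rfl, h⟩ := hω
  rcases h.symm.head_cases with h | ⟨z, hz, h⟩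
  · rw [← h] at hu
    simp [hexTop] at hu
    omega
  · obtain ⟨z, rfl⟩ := hz.exists_up
    refine ⟨u, hu, _, ⟨?_, rfl⟩, h.symm.mono (hexDrop_subset_ext (by omega))⟩
    have m := hz.2.1
    simp [hexDrop] at m
    rcases hz.hex_down with ⟨-, h⟩ | ⟨-, h⟩ | ⟨-, h⟩ <;> simp at h <;> simp <;> omega

lemma hexReach_up_right {ω : Config TriE} {a : ℤ} (ha : a ∈ Icc x w) (hj : j < R)
    (h : ω ∈ hexReach x w R j a) (ho : ω (a + 1, j - 1, 2) = true) : ω ∈ hexReachUp x w R j := by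
  obtain ⟨u, hu, v, rfl, h⟩ := h
  have h' := h.mono (hexDrop_subset_ext (j := j) (by omega))
  refine ⟨u, hu, (a + 1, j - 1, true), ⟨rfl, rfl⟩, h'.tail ⟨h'.mem_right, ?_, _, ho, .inr (by simp)⟩⟩
  simp [hexDropExt] at ha ⊢
  omega

lemma hexReach_up_left {ω : Config TriE} {a : ℤ} (ha : a ∈ Icc x w) (hj : j < R)
    (h : ω ∈ hexReach x w R j a) (ho : ω (a, j - 1, 1) = true) : ω ∈ hexReachUp x w R j := by
  obtain ⟨u, hu, v, rfl, h⟩ := h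
  have h' := h.mono (hexDrop_subset_ext (j := j) (by omega))
  refine ⟨u, hu, (a, j - 1, true), ⟨rfl, rfl⟩, h'.tail ⟨h'.mem_right, ?_, _, ho, .inr (by simp)⟩⟩
  simp [hexDropExt] at ha ⊢
  omega

/-- `(a, j)` is the leftmost point at height `j` joined to height `R`, and height `j - 1` is not
reached. -/
def hexFirst (x w R j a : ℤ) : Set (Config TriE) :=
  (hexReach x w R j a \ ⋃ a' ∈ Ico x a, hexReach x w R j a') \ hexReachAny x w R (j - 1)

lemma measurableSet_hexFirst (x w R j a : ℤ) : MeasurableSet (hexFirst x w R j a) :=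
  ((measurableSet_hexReach x w R j a).diff (MeasurableSet.biUnion (Set.to_countable _)
    fun a _ => measurableSet_hexReach x w R j a)).diff (measurableSet_hexReachAny x w R (j - 1))

lemma hexReach_congr {ω ω' : Config TriE} {a : ℤ} (h : ∀ e : TriE, j ≤ e.2.1 → ω e = ω' e)
    (hω : ω ∈ hexReach x w R j a) : ω' ∈ hexReach x w R j a := by
  refine (locInc_crs _ _ _ _).congr ω ω' ?_ hω
  intro e he
  refine h e ?_
  induction e using triE_cases <;> simp [hexDrop] at he <;> simp <;> omega

lemma hexFirst_update {ω ω' : Config TriE} {a : ℤ}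
    (h : ∀ e : TriE, e.1 ≠ a + 1 ∨ e.2.1 ≠ j - 1 → ω e = ω' e)
    (h0 : ω' (a + 1, j - 1, 0) = false) (h1 : ω' (a + 1, j - 1, 1) = false)
    (hω : ω ∈ hexFirst x w R j a) : ω' ∈ hexFirst x w R j a := by
  have h' : ∀ e : TriE, j ≤ e.2.1 → ω e = ω' e := fun e he => h e (.inr (by omega))
  obtain ⟨⟨i1, i2⟩, i3⟩ := hω
  refine ⟨⟨hexReach_congr h' i1, fun hm => i2 ?_⟩, fun hm => i3 ?_⟩
  · simp only [mem_iUnion] at hm ⊢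
    obtain ⟨a', ha', hm⟩ := hm
    exact ⟨a', ha', hexReach_congr (fun e he => (h' e he).symm) hm⟩
  · simp only [hexReachAny, mem_iUnion] at hm ⊢
    obtain ⟨a', ha', u, hu, v, rfl, hm⟩ := hm
    refine ⟨a', ha', u, hu, _, rfl, ?_⟩
    refine hm.remove_leaf (l := (a + 1, j - 1, true)) (d := (a, j, false)) (by simp) ?_ ?_ ?_
      (by simp)
    · intro e he m1 m2
      show ω e = true
      rw [h e ?_]
      · exact he
      · induction e using triE_cases <;> simp at m1 m2 ⊢ <;> omega
    · intro z hz
      rcases hz.hex_up with ⟨o, h⟩ | ⟨o, h⟩ | ⟨o, h⟩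
      · simp [Op, h0] at o
      · simp [Op, h1] at o
      · simpa using h
    · rintro rfl
      simp [hexTop] at hu

lemma hexFirst_le {P : TriE → ℝ} (hP : ∀ e, P e ∈ Icc (0 : ℝ) 1) (a : ℤ) :
    ENNReal.ofReal (P (a + 1, j - 1, 2) * (1 - P (a + 1, j - 1, 0)) * (1 - P (a + 1, j - 1, 1))) *
      prodBern P (hexFirst x w R j a) ≤
      prodBern P (hexFirst x w R j a ∩ {ω | ω (a + 1, j - 1, 2) = true}) := by
  set H := hexFirst x w R j a ∩ {ω | ω (a + 1, j - 1, 2) = true} with hH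
  have hm : MeasurableSet H := (measurableSet_hexFirst x w R j a).inter
    (measurableSet_eq_fun (measurable_pi_apply _) measurable_const)
  have hu : ∀ e b, Measurable fun ω : Config TriE => Function.update ω e b :=
    fun e b => by fun_prop
  have r1 := resample_le (p := P) (a + 1, j - 1, 2) true hm
  have r2 := resample_le (p := P) (a + 1, j - 1, 0) false ((hu (a + 1, j - 1, 2) true) hm)
  have r3 := resample_le (p := P) (a + 1, j - 1, 1) false
    ((hu (a + 1, j - 1, 0) false) ((hu (a + 1, j - 1, 2) true) hm))
  have r4 : prodBern P (hexFirst x w R j a) ≤ prodBern P {ω | Function.update ω (a + 1, j - 1, 1)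
      false ∈ (fun ω : Config TriE => Function.update ω (a + 1, j - 1, 0) false) ⁻¹'
      ((fun ω : Config TriE => Function.update ω (a + 1, j - 1, 2) true) ⁻¹' H)} := by
    refine measure_mono fun ω hω => ?_
    simp only [mem_preimage, mem_ofPred_eq]
    refine ⟨hexFirst_update ?_ ?_ ?_ hω, ?_⟩
    · intro e he
      rw [Function.update_of_ne, Function.update_of_ne, Function.update_of_ne] <;>
        rintro rfl <;> simp at he
    · rw [Function.update_of_ne (by simp), Function.update_self]
    · rw [Function.update_of_ne (by simp), Function.update_of_ne (by simp), Function.update_self]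
    · simp
  simp only [bern_singleton (hP _)] at r1 r2 r3
  simp only [if_true, Bool.false_eq_true, if_false] at r1 r2 r3
  rw [ENNReal.ofReal_mul (mul_nonneg (hP _).1 (one_sub_mem_Icc (hP _)).1),
    ENNReal.ofReal_mul (hP _).1, mul_assoc, mul_assoc]
  refine le_trans (mul_le_mul_right ?_ _) r1
  refine le_trans (mul_le_mul_right ?_ _) r2
  exact le_trans (mul_le_mul_right r4 _) r3

end VerticalTransport

section VerticalTransport

variable {p0 p1 p2 : ℝ} {x w j R n : ℤ}

lemma hexReachAny_diff_subset :
    hexReachAny x w R j \ hexReachAny x w R (j - 1) ⊆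
      ⋃ a ∈ Finset.Icc x w, hexFirst x w R j a := by
  rintro ω ⟨h, h'⟩
  simp only [hexReachAny, mem_iUnion] at h
  obtain ⟨a, ha, h⟩ := h
  obtain ⟨b, ⟨hb, hbω⟩, hmin⟩ := Int.exists_least_of_bdd
    (P := fun b => b ∈ Icc x w ∧ ω ∈ hexReach x w R j b) ⟨x, fun z hz => hz.1.1⟩ ⟨a, ha, h⟩
  simp only [mem_iUnion]
  refine ⟨b, Finset.mem_Icc.2 hb, ⟨hbω, fun hm => ?_⟩, h'⟩
  simp only [mem_iUnion] at hm
  obtain ⟨c, hc, hcω⟩ := hm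
  have := hmin c ⟨⟨hc.1, hc.2.le.trans hb.2⟩, hcω⟩
  exact absurd hc.2 (by omega)

lemma hexFirst_disjoint {a b : ℤ} (ha : x ≤ a) (h : a < b) :
    Disjoint (hexFirst x w R j a) (hexFirst x w R j b) := by
  rw [Set.disjoint_left]
  rintro ω ⟨⟨h1, -⟩, -⟩ ⟨⟨-, h2⟩, -⟩
  refine h2 ?_
  simp only [mem_iUnion]
  exact ⟨a, ⟨ha, h⟩, h1⟩

/-- Lower bound for the probability of dropping by less than one row. -/
lemma hexReachUp_ge {P : TriE → ℝ} (hP : ∀ e, P e ∈ Icc (0 : ℝ) 1) (hj : j < R) {η : ℝ}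
    (h0 : 0 ≤ η) (h1 : η ≤ 1)
    (hη : ∀ a, η ≤ P (a, j - 1, 2) * (1 - P (a, j - 1, 0)) * (1 - P (a, j - 1, 1))) :
    (1 - η) * (prodBern P).real (hexReachAny x w R (j - 1)) +
      η * (prodBern P).real (hexReachAny x w R j) ≤ (prodBern P).real (hexReachUp x w R j) := by
  set B := hexReachAny x w R (j - 1) with hB
  set H : ℤ → Set (Config TriE) :=
    fun a => hexFirst x w R j a ∩ {ω | ω (a + 1, j - 1, 2) = true} with hH
  have mB : MeasurableSet B := measurableSet_hexReachAny _ _ _ _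
  have mH : ∀ a, MeasurableSet (H a) := fun a => (measurableSet_hexFirst x w R j a).inter
    (measurableSet_eq_fun (measurable_pi_apply _) measurable_const)
  have e1 : B ∪ ⋃ a ∈ Finset.Icc x w, H a ⊆ hexReachUp x w R j := by
    refine union_subset (hexReachAny_subset_up (by omega)) (iUnion₂_subset fun a ha ω hω => ?_)
    exact hexReach_up_right (Finset.mem_Icc.1 ha) hj hω.1.1.1 hω.2
  have e2 : Disjoint B (⋃ a ∈ Finset.Icc x w, H a) := by
    simp only [disjoint_iUnion_right]
    intro a _
    rw [Set.disjoint_left]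
    exact fun ω h h' => h'.1.2 h
  have e3 : (prodBern P).real (⋃ a ∈ Finset.Icc x w, H a) =
      ∑ a ∈ Finset.Icc x w, (prodBern P).real (H a) := by
    refine measureReal_biUnion_finset ?_ fun a _ => mH a
    intro a ha b hb hab
    rcases lt_or_gt_of_ne hab with h | h
    · exact (hexFirst_disjoint (Finset.mem_Icc.1 ha).1 h).mono inter_subset_left inter_subset_left
    · exact ((hexFirst_disjoint (Finset.mem_Icc.1 hb).1 h).mono inter_subset_left
        inter_subset_left).symm
  have e4 : ∀ a, η * (prodBern P).real (hexFirst x w R j a) ≤ (prodBern P).real (H a) := by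
    intro a
    refine (mul_le_mul_of_nonneg_right (hη (a + 1)) measureReal_nonneg).trans ?_
    have := ENNReal.toReal_mono (measure_ne_top _ _) (hexFirst_le (x := x) (w := w) (j := j)
      (R := R) hP a)
    rw [ENNReal.toReal_mul, ENNReal.toReal_ofReal] at this
    · exact this
    · exact mul_nonneg (mul_nonneg (hP _).1 (one_sub_mem_Icc (hP _)).1) (one_sub_mem_Icc (hP _)).1
  have e5 : (prodBern P).real (hexReachAny x w R j) - (prodBern P).real B ≤
      ∑ a ∈ Finset.Icc x w, (prodBern P).real (hexFirst x w R j a) :=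
    (le_measureReal_sdiff (measure_ne_top _ _)).trans ((measureReal_mono hexReachAny_diff_subset (measure_ne_top _ _)).trans
      (measureReal_biUnion_finset_le _ _))
  have e6 := measureReal_mono (μ := prodBern P) e1
  rw [measureReal_union e2 (MeasurableSet.biUnion (Set.to_countable _) fun a _ => mH a)
    (measure_ne_top _ _) (measure_ne_top _ _), e3] at e6
  have e7 : η * ∑ a ∈ Finset.Icc x w, (prodBern P).real (hexFirst x w R j a) ≤
      ∑ a ∈ Finset.Icc x w, (prodBern P).real (H a) := by
    rw [Finset.mul_sum]
    exact Finset.sum_le_sum fun a _ => e4 a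
  have e8 := mul_le_mul_of_nonneg_left e5 h0
  linarith

lemma triReach_le_hexReachAny (h0 : p0 ∈ Icc (0 : ℝ) 1) (h1 : p1 ∈ Icc (0 : ℝ) 1)
    (h2 : p2 ∈ Icc (0 : ℝ) 1) (hsd : kappaT p0 p1 p2 = 0) (hj : j < R) :
    (prodBern (mixed p0 p1 p2 n)).real (triReach x w R j) ≤
      (prodBern fun e => 1 - mixed p0 p1 p2 n e).real (hexReachAny x w R j) :=
  ENNReal.toReal_mono (measure_ne_top _ _) (tri_le_hex (mixed_mem h0 h1 h2 n)
    (mixed_selfDual hsd n) (measurableSet_crs _ _ _ _)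
    fun t s hc h => triReach_hexReachAny hc hj h)

lemma hexReachUp_le_triReach (h0 : p0 ∈ Icc (0 : ℝ) 1) (h1 : p1 ∈ Icc (0 : ℝ) 1)
    (h2 : p2 ∈ Icc (0 : ℝ) 1) (hsd : kappaT p0 p1 p2 = 0) (hn : n < R) :
    (prodBern fun e => 1 - mixed p0 p1 p2 n e).real (hexReachUp x w R j) ≤
      (prodBern (mixed p0 p1 p2 (n + 1))).real (triReach x (w + 1) R j) :=
  ENNReal.toReal_mono (measure_ne_top _ _) (mixed_hex_le h0 h1 h2 hsd hn
    (measurableSet_crs _ _ _ _) fun s t hc ht h => hexReachUp_triReach hc ht h)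

lemma triReach_step (h0 : p0 ∈ Icc (0 : ℝ) 1) (h1 : p1 ∈ Icc (0 : ℝ) 1)
    (h2 : p2 ∈ Icc (0 : ℝ) 1) (hsd : kappaT p0 p1 p2 = 0) (hn : n < R) (hj : j < R) (hjn : j ≤ n) :
    (1 - (1 - p2) * p0 * p1) * (prodBern (mixed p0 p1 p2 n)).real (triReach x w R (j - 1)) +
      (1 - p2) * p0 * p1 * (prodBern (mixed p0 p1 p2 n)).real (triReach x w R j) ≤
      (prodBern (mixed p0 p1 p2 (n + 1))).real (triReach x (w + 1) R j) := by
  have a1 : 0 ≤ (1 - p2) * p0 := mul_nonneg (one_sub_mem_Icc h2).1 h0.1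
  have a2 : (1 - p2) * p0 ≤ 1 := mul_le_one₀ (one_sub_mem_Icc h2).2 h0.1 h0.2
  have a3 : 0 ≤ (1 - p2) * p0 * p1 := mul_nonneg a1 h1.1
  have a4 : (1 - p2) * p0 * p1 ≤ 1 := mul_le_one₀ a2 h1.1 h1.2
  refine le_trans (le_trans ?_ (hexReachUp_ge (x := x) (w := w) (j := j) (R := R)
    (fun e => one_sub_mem_Icc (mixed_mem h0 h1 h2 n e)) hj a3 a4 ?_))
    (hexReachUp_le_triReach h0 h1 h2 hsd hn)
  · exact add_le_add (mul_le_mul_of_nonneg_left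
      (triReach_le_hexReachAny h0 h1 h2 hsd (by omega)) (by linarith))
      (mul_le_mul_of_nonneg_left (triReach_le_hexReachAny h0 h1 h2 hsd hj) a3)
  · intro a
    have : j - 1 < n := by omega
    simp [mixed, triHI, this]

lemma triReach_step_of_lt (h0 : p0 ∈ Icc (0 : ℝ) 1) (h1 : p1 ∈ Icc (0 : ℝ) 1)
    (h2 : p2 ∈ Icc (0 : ℝ) 1) (hsd : kappaT p0 p1 p2 = 0) (hn : n < R) (hj : j < R) (hjn : n < j) :
    (prodBern (mixed p0 p1 p2 n)).real (triReach x w R j) ≤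
      (prodBern (mixed p0 p1 p2 (n + 1))).real (triReach x (w + 1) R j) := by
  refine (triReach_le_hexReachAny h0 h1 h2 hsd hj).trans (le_trans ?_
    (hexReachUp_le_triReach h0 h1 h2 hsd hn))
  have hz := prodBern_exists_eq_zero (p := fun e => 1 - mixed p0 p1 p2 n e)
    (range fun a : ℤ => ((a, j - 1, 1) : TriE)) false (by
      rintro _ ⟨a, rfl⟩
      have : ¬ j - 1 < n := by omega
      simp [mixed, triHI, this])
  have hsub : hexReachAny x w R j ⊆ hexReachUp x w R j ∪
      {ω | ∃ e ∈ range fun a : ℤ => ((a, j - 1, 1) : TriE), ω e = false} := ?_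
  · have := (measure_mono hsub).trans (measure_union_le (μ := prodBern fun e =>
      1 - mixed p0 p1 p2 n e) _ _)
    rw [hz, add_zero] at this
    exact ENNReal.toReal_mono (measure_ne_top _ _) this
  intro ω hω
  by_cases h : ∃ e ∈ range fun a : ℤ => ((a, j - 1, 1) : TriE), ω e = false
  · exact .inr h
  · left
    simp only [hexReachAny, mem_iUnion] at hω
    obtain ⟨a, ha, hω⟩ := hω
    refine hexReach_up_left ha hj hω ?_
    by_contra h'
    exact h ⟨_, ⟨a, rfl⟩, by simpa using h'⟩

lemma triReach_mono {i : ℤ} (h : i ≤ j) : triReach x w R i ⊆ triReach x w R j :=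
  crs_mono le_rfl le_rfl fun z (hz : z.2 ≤ i) => hz.trans h

lemma triReach_iterate (h0 : p0 ∈ Icc (0 : ℝ) 1) (h1 : p1 ∈ Icc (0 : ℝ) 1)
    (h2 : p2 ∈ Icc (0 : ℝ) 1) (hsd : kappaT p0 p1 p2 = 0) (K k : ℕ) (hk : k ≤ K) (i : ℕ)
    (hi : i < K) :
    (prodBern (mixed p0 p1 p2 (R - K))).real (triReach x w R (R - K)) *
      (1 - (2 - (1 - p2) * p0 * p1) ^ k / 2 ^ (i + 1)) ≤
      (prodBern (mixed p0 p1 p2 (R - K + k))).real (triReach x (w + k) R (R - K + i)) := by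
  set G := (prodBern (mixed p0 p1 p2 (R - K))).real (triReach x w R (R - K)) with hG
  have G0 : 0 ≤ G := measureReal_nonneg
  set η := (1 - p2) * p0 * p1 with hη
  have a1 : 0 ≤ (1 - p2) * p0 := mul_nonneg (one_sub_mem_Icc h2).1 h0.1
  have a2 : (1 - p2) * p0 ≤ 1 := mul_le_one₀ (one_sub_mem_Icc h2).2 h0.1 h0.2
  have a3 : 0 ≤ η := mul_nonneg a1 h1.1
  have a4 : η ≤ 1 := mul_le_one₀ a2 h1.1 h1.2
  induction k generalizing i with
  | zero =>
    have m : G ≤ (prodBern (mixed p0 p1 p2 (R - K))).real (triReach x w R (R - K + i)) :=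
      measureReal_mono (triReach_mono (by omega))
    have : 0 ≤ G * ((2 - η) ^ 0 / 2 ^ (i + 1)) := by positivity
    simp only [Nat.cast_zero, add_zero]
    linarith
  | succ k ih =>
    have ih' := ih (by omega)
    have hx1 : 1 ≤ (2 - η) ^ k := one_le_pow₀ (by linarith)
    push_cast
    rw [← add_assoc, ← add_assoc]
    rcases le_or_gt i k with hik | hik
    · have st := triReach_step (x := x) (w := w + k) (n := R - K + k) (j := R - K + i) (R := R)
        h0 h1 h2 hsd (by omega) (by omega) (by omega)
      refine le_trans ?_ st
      cases i with
      | zero =>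
        have := mul_le_mul_of_nonneg_left (ih' 0 hi) a3
        have p1 : 0 ≤ (1 - η) * (prodBern (mixed p0 p1 p2 (R - K + k))).real
          (triReach x (w + k) R (R - K + (0 : ℕ) - 1)) :=
          mul_nonneg (by linarith) measureReal_nonneg
        have p2 : 0 ≤ G * ((1 - η) * ((2 - η) ^ k - 1)) :=
          mul_nonneg G0 (mul_nonneg (by linarith) (by linarith))
        rw [pow_succ]
        norm_num at this p1 ⊢
        nlinarith
      | succ i =>
        have b1 := mul_le_mul_of_nonneg_left (ih' (i + 1) hi) a3
        have b2 := mul_le_mul_of_nonneg_left (ih' i (by omega)) (sub_nonneg.2 a4)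
        have : R - K + ((i + 1 : ℕ) : ℤ) - 1 = R - K + i := by push_cast; ring
        rw [this]
        refine le_trans (le_of_eq ?_) (add_le_add b2 b1)
        field_simp
        ring
    · refine le_trans ?_ (triReach_step_of_lt h0 h1 h2 hsd (by omega) (by omega) (by omega))
      refine le_trans (mul_le_mul_of_nonneg_left ?_ G0) (ih' i hi)
      have : (2 - η) ^ k ≤ (2 - η) ^ (k + 1) := pow_le_pow_right₀ (by linarith) (by omega)
      gcongr

/-- Transport of vertical crossings from the square to the triangular lattice. -/
lemma vertical_transport (h0 : p0 ∈ Ioc (0 : ℝ) 1) (h1 : p1 ∈ Ioc (0 : ℝ) 1)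
    (h2 : p2 ∈ Ico (0 : ℝ) 1) (hsd : kappaT p0 p1 p2 = 0) :
    ∃ B : ℕ, 1 ≤ B ∧ ∀ m : ℕ, 1 ≤ m → ∀ x₁ x₂ R : ℤ,
      (prodBern (triInt p0 0 (1 - p0))).real
          (Crs triEnd {z | x₁ ≤ z.1 ∧ z.1 ≤ x₂ ∧ R - (B * m : ℕ) ≤ z.2 ∧ z.2 ≤ R} {z | z.2 = R}
            {z | z.2 = R - (B * m : ℕ)}) * (1 - (1 / 2) ^ m) ≤
        (prodBern (triInt p0 p1 p2)).real
          (Crs triEnd {z | x₁ ≤ z.1 ∧ z.1 ≤ x₂ + (B * m : ℕ) ∧ R - m ≤ z.2 ∧ z.2 ≤ R}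
            {z | z.2 = R} {z | z.2 = R - m}) := by
  have h0' : p0 ∈ Icc (0 : ℝ) 1 := ⟨h0.1.le, h0.2⟩
  have h1' : p1 ∈ Icc (0 : ℝ) 1 := ⟨h1.1.le, h1.2⟩
  have h2' : p2 ∈ Icc (0 : ℝ) 1 := ⟨h2.1, h2.2.le⟩
  set η := (1 - p2) * p0 * p1 with hη
  have a1 : 0 < η := mul_pos (mul_pos (by linarith [h2.2]) h0.1) h1.1
  have a2 : (1 - p2) * p0 ≤ 1 := mul_le_one₀ (one_sub_mem_Icc h2').2 h0'.1 h0.2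
  have a4 : η ≤ 1 := mul_le_one₀ a2 h1'.1 h1.2
  obtain ⟨B, hB⟩ := exists_pow_lt_of_lt_one (show (0 : ℝ) < 1 / 4 by norm_num)
    (show 1 - η / 2 < 1 by linarith)
  refine ⟨B + 1, by omega, fun m hm x₁ x₂ R => ?_⟩
  set K := (B + 1) * m with hK
  have hmK : m ≤ K := Nat.le_mul_of_pos_left _ (by omega)
  have key := triReach_iterate (x := x₁) (w := x₂) (R := R) h0' h1' h2' hsd K K le_rfl (K - m)
    (by omega)
  rw [← hη] at key
  have hpow : (2 - η) ^ K / 2 ^ (K - m + 1) ≤ (1 / 2) ^ m := by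
    have b0 : (1 - η / 2) ^ (B + 1) ≤ 1 / 4 := by
      rw [pow_succ]
      have : 0 ≤ (1 - η / 2) ^ B := pow_nonneg (by linarith) _
      nlinarith
    have b1 : (1 - η / 2) ^ K ≤ (1 / 4) ^ m := by
      rw [hK, pow_mul]
      exact pow_le_pow_left₀ (pow_nonneg (by linarith) _) b0 m
    have b2 : (2 - η) ^ K = 2 ^ K * (1 - η / 2) ^ K := by
      rw [← mul_pow]; congr 1; ring
    have b3 : (2 : ℝ) ^ K = 2 ^ (K - m) * 2 ^ m := by rw [← pow_add]; congr 1; omega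
    have b4 : ((1 : ℝ) / 4) ^ m = (1 / 2) ^ m * (1 / 2) ^ m := by rw [← mul_pow]; norm_num
    have b5 : (2 : ℝ) ^ m * (1 / 2) ^ m = 1 := by rw [← mul_pow]; norm_num
    rw [div_le_iff₀ (by positivity), b2, b3]
    calc (2 : ℝ) ^ (K - m) * 2 ^ m * (1 - η / 2) ^ K
        ≤ 2 ^ (K - m) * 2 ^ m * ((1 / 2) ^ m * (1 / 2) ^ m) := by rw [← b4]; gcongr
      _ = 2 ^ (K - m) * (2 ^ m * (1 / 2) ^ m) * (1 / 2) ^ m := by ring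
      _ = 2 ^ (K - m) * (1 / 2) ^ m := by rw [b5, mul_one]
      _ ≤ 2 ^ (K - m) * (1 / 2) ^ m * 2 := by
        have : (0 : ℝ) ≤ 2 ^ (K - m) * (1 / 2) ^ m := by positivity
        linarith
      _ = _ := by ring
  have c1 : R - (K : ℤ) + (K : ℤ) = R := by ring
  have c2 : R - (K : ℤ) + ((K - m : ℕ) : ℤ) = R - m := by push_cast [hmK]; ring
  rw [c1, c2] at key
  set A₀ := Crs triEnd {z : ℤ × ℤ | x₁ ≤ z.1 ∧ z.1 ≤ x₂ ∧ R - K ≤ z.2 ∧ z.2 ≤ R} {z | z.2 = R}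
    {z | z.2 = R - K} with hA₀
  have d1 : (prodBern (triInt p0 0 (1 - p0))).real A₀ ≤
      (prodBern (mixed p0 p1 p2 (R - K))).real (triReach x₁ x₂ R (R - K)) := by
    have : prodBern (triInt p0 0 (1 - p0)) A₀ = prodBern (mixed p0 p1 p2 (R - K)) A₀ := by
      refine prodBern_crs_congr fun e m1 m2 => (mixed_eq_of_le fun h => ?_).symm
      induction e using triE_cases <;> simp at h m1 m2 ⊢ <;> omega
    rw [measureReal_def, this]
    refine measureReal_mono (crs_mono ?_ le_rfl ?_)
    · rintro z ⟨h1, h2, h3, h4⟩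
      exact ⟨h1, h2, h4⟩
    · intro z (hz : z.2 = _)
      exact hz.le
  have d2 : (prodBern (mixed p0 p1 p2 R)).real (triReach x₁ (x₂ + K) R (R - m)) ≤
      (prodBern (triInt p0 p1 p2)).real (triReach x₁ (x₂ + K) R (R - m)) := by
    have : prodBern (mixed p0 p1 p2 R) (triReach x₁ (x₂ + K) R (R - m)) =
        prodBern (triInt p0 p1 p2) (triReach x₁ (x₂ + K) R (R - m)) := by
      refine prodBern_crs_congr fun e m1 m2 => mixed_eq_of_lt fun h => ?_
      induction e using triE_cases <;> simp at h m1 m2 ⊢ <;> omega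
    rw [measureReal_def, this, measureReal_def]
  have d3 : triReach x₁ (x₂ + K) R (R - m) ⊆
      Crs triEnd {z | x₁ ≤ z.1 ∧ z.1 ≤ x₂ + K ∧ R - m ≤ z.2 ∧ z.2 ≤ R} {z | z.2 = R}
        {z | z.2 = R - m} := by
    rintro ω ⟨u, hu, v, hv, h⟩
    have hu' : u.2 = R := hu
    have hv' : v.2 ≤ R - m := hv
    obtain ⟨y, z, e1, e2, e3⟩ := h.first_hit {z | z.2 ≤ R - m} (by simp; omega) hv
    have m1 := e1.mem_right
    have m2 := e2.2.1
    simp only [mem_ofPred_eq, mem_sdiff] at e3 m1 m2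
    have hz : z.2 = R - m := by
      obtain ⟨-, -, e, -, he⟩ := e2
      induction e using triE_cases <;> simp [Prod.ext_iff] at he <;> omega
    refine ⟨u, hu, z, hz, (e1.mono ?_).tail ⟨?_, ?_, e2.2.2⟩⟩
    · rintro z ⟨hz, hz'⟩
      simp only [mem_ofPred_eq] at hz hz' ⊢
      refine ⟨hz.1, hz.2.1, ?_, hz.2.2⟩
      omega
    · simp only [mem_ofPred_eq]
      refine ⟨m1.1.1, m1.1.2.1, ?_, m1.1.2.2⟩
      omega
    · simp only [mem_ofPred_eq]
      refine ⟨m2.1, m2.2.1, ?_, m2.2.2⟩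
      omega
  have d4 := d2.trans (measureReal_mono d3)
  refine le_trans ?_ (key.trans d4)
  have hm2 : (1 / 2 : ℝ) ^ m ≤ 1 := pow_le_one₀ (by norm_num) (by norm_num)
  exact mul_le_mul d1 (by linarith) (by linarith) measureReal_nonneg

end VerticalTransport

section Trim

variable {E V : Type} {en : E → V × V}

/-- A crossing between two levels of `f` can be trimmed to the region between them. -/
lemma crs_trim {f : V → ℤ} (hf : ∀ e, |f (en e).1 - f (en e).2| ≤ 1) {S : Set V} {x₁ x₂ : ℤ}
    (hx : x₁ < x₂) :
    Crs en S {z | f z ≤ x₁} {z | x₂ ≤ f z} ⊆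
      Crs en {z | z ∈ S ∧ x₁ ≤ f z ∧ f z ≤ x₂} {z | f z = x₁} {z | f z = x₂} := by
  have hstep : ∀ {o : E → Prop} {S : Set V} {y z : V}, Stp en o S y z → |f y - f z| ≤ 1 := by
    rintro o S y z ⟨-, -, e, -, h | h⟩
    · simpa [h] using hf e
    · simpa [h, abs_sub_comm] using hf e
  rintro ω ⟨u, hu, v, hv, h⟩
  have hu' : f u ≤ x₁ := hu
  obtain ⟨y, z, h1, h2, h3⟩ := h.first_hit {z | x₂ ≤ f z} (by simp; omega) hv
  have h3' : x₂ ≤ f z := h3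
  have hy : ¬ x₂ ≤ f y := h1.mem_right.2
  have hz : f z = x₂ := by have := abs_le.1 (hstep h2); omega
  have h4 : Conn en (Op ω) {z | z ∈ S ∧ f z ≤ x₂} u z := by
    refine (h1.mono ?_).tail ⟨⟨h2.1, by omega⟩, ⟨h2.2.1, hz.le⟩, h2.2.2⟩
    rintro w ⟨hw, hw'⟩
    exact ⟨hw, (not_le.1 hw').le⟩
  obtain ⟨y', z', h5, h6, h7⟩ := h4.symm.first_hit {z | f z ≤ x₁} (by simp; omega) hu
  have h7' : f z' ≤ x₁ := h7
  have hy' : ¬ f y' ≤ x₁ := h5.mem_right.2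
  have hz' : f z' = x₁ := by have := abs_le.1 (hstep h6); omega
  refine ⟨z', hz', z, hz, Conn.symm ((h5.mono ?_).tail ⟨?_, ?_, h6.2.2⟩)⟩
  · rintro w ⟨hw, hw'⟩
    exact ⟨hw.1, (not_le.1 hw').le, hw.2⟩
  · exact ⟨h6.1.1, by omega, h6.1.2⟩
  · exact ⟨h6.2.1.1, hz'.ge, h6.2.1.2⟩

lemma triEnd_col (e : TriE) : |(triEnd e).1.1 - (triEnd e).2.1| ≤ 1 := by
  induction e using triE_cases <;> simp

lemma triEnd_row (e : TriE) : |(triEnd e).1.2 - (triEnd e).2.2| ≤ 1 := by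
  induction e using triE_cases <;> simp

lemma hexEnd_col (e : TriE) : |(hexEnd e).1.1 - (hexEnd e).2.1| ≤ 1 := by
  induction e using triE_cases <;> simp

lemma hexEnd_row (e : TriE) : |(hexEnd e).1.2.1 - (hexEnd e).2.2.1| ≤ 1 := by
  induction e using triE_cases <;> simp

end Trim

section Tubes

variable {E V : Type}

/-- Vertices within distance `r` of the segment from `u` to `v`. -/
def tube (pos : V → Pt) (u v : Pt) (r : ℝ) : Set V := {x | ∃ w ∈ segment ℝ u v, dist (pos x) w ≤ r}

/-- Existence of an open path close to a segment, joining neighbourhoods of its endpoints. -/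
def tubeEvent (en : E → V × V) (pos : V → Pt) (u v : Pt) (r : ℝ) : Set (Config E) :=
  Crs en (tube pos u v r) {x | dist (pos x) u ≤ r} {x | dist (pos x) v ≤ r}

/-- Segments of length at most `n` are followed, up to an error `ε n`, by open paths with
probability bounded away from zero. -/
def TubeCrossing (en : E → V × V) (pos : V → Pt) (P : Measure (Config E)) : Prop :=
  ∀ ε : ℝ, 0 < ε → ∃ δ : ℝ, 0 < δ ∧ ∃ n₀ : ℕ, ∀ n : ℕ, n₀ ≤ n → ∀ u v : Pt, dist u v ≤ n →
    ENNReal.ofReal δ ≤ P (tubeEvent en pos u v (ε * n))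

/-- Position of a triangular vertex in lattice coordinates. -/
def triPos (z : ℤ × ℤ) : Pt := ((z.1 : ℝ), (z.2 : ℝ))

/-- Crossings of long horizontal strips and of wide vertical boxes, at scales divisible by `b`. -/
def AxisCrossing (p : TriE → ℝ) : Prop :=
  ∃ b : ℕ, 1 ≤ b ∧
    (∀ ρ : ℕ, ∃ δ : ℝ, 0 < δ ∧ ∃ m₀ : ℕ, ∀ m : ℕ, m₀ ≤ m → ∀ r x : ℤ,
      ENNReal.ofReal δ ≤ prodBern p (Crs triEnd {z | r ≤ z.2 ∧ z.2 ≤ r + (b * m : ℕ)}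
        {z | z.1 ≤ x} {z | x + (ρ * (b * m) : ℕ) ≤ z.1})) ∧
    ∃ C : ℕ, 1 ≤ C ∧ ∃ δ : ℝ, 0 < δ ∧ ∃ m₀ : ℕ, ∀ m : ℕ, m₀ ≤ m → ∀ r x : ℤ,
      ENNReal.ofReal δ ≤ prodBern p (Crs triEnd {z | x ≤ z.1 ∧ z.1 ≤ x + (C * (b * m) : ℕ)}
        {z | z.2 ≤ r} {z | r + (b * m : ℕ) ≤ z.2})

end Tubes

section Gluing

/-- Crossing of a long horizontal box around the cell `(i, j)` of size `W × s`. -/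
def cellH (W s i j : ℤ) : Set (Config TriE) :=
  Crs triEnd {z | (j * s ≤ z.2 ∧ z.2 ≤ j * s + s) ∧ (i - 2) * W ≤ z.1 ∧ z.1 ≤ (i + 3) * W}
    {z | z.1 = (i - 2) * W} {z | z.1 = (i + 3) * W}

/-- Crossing of a tall box around the cell `(i, j)` of size `W × s`. -/
def cellV (W s i j : ℤ) : Set (Config TriE) :=
  Crs triEnd {z | (i * W ≤ z.1 ∧ z.1 ≤ i * W + W) ∧ (j - 2) * s ≤ z.2 ∧ z.2 ≤ (j + 3) * s}
    {z | z.2 = (j - 2) * s} {z | z.2 = (j + 3) * s}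

lemma cells_conn {ω : Config TriE} {W s : ℤ} (hW : 0 < W) (hs : 0 < s) {M : ℕ} {i j : ℕ → ℤ}
    (hi : ∀ k < M, |i (k + 1) - i k| ≤ 1) (hj : ∀ k < M, |j (k + 1) - j k| ≤ 1)
    (hH : ∀ k ≤ M, ω ∈ cellH W s (i k) (j k)) (hV : ∀ k ≤ M, ω ∈ cellV W s (i k) (j k))
    {S : Set (ℤ × ℤ)}
    (hS : ∀ k ≤ M, ∀ z : ℤ × ℤ, (i k - 2) * W ≤ z.1 → z.1 ≤ (i k + 3) * W →
      (j k - 2) * s ≤ z.2 → z.2 ≤ (j k + 3) * s → z ∈ S) :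
    ∃ u v : ℤ × ℤ, (u.1 = (i 0 - 2) * W ∧ j 0 * s ≤ u.2 ∧ u.2 ≤ j 0 * s + s) ∧
      (v.1 = (i M - 2) * W ∧ j M * s ≤ v.2 ∧ v.2 ≤ j M * s + s) ∧ Conn triEnd (Op ω) S u v := by
  choose! h hh h' hh' hc using hH
  choose! v hv v' hv' hc' using hV
  have sub1 : ∀ k ≤ M, {z : ℤ × ℤ | (j k * s ≤ z.2 ∧ z.2 ≤ j k * s + s) ∧
      (i k - 2) * W ≤ z.1 ∧ z.1 ≤ (i k + 3) * W} ⊆ S := by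
    rintro k hk z ⟨⟨a1, a2⟩, a3, a4⟩
    exact hS k hk z a3 a4 (by nlinarith) (by nlinarith)
  have sub2 : ∀ k ≤ M, {z : ℤ × ℤ | (i k * W ≤ z.1 ∧ z.1 ≤ i k * W + W) ∧
      (j k - 2) * s ≤ z.2 ∧ z.2 ≤ (j k + 3) * s} ⊆ S := by
    rintro k hk z ⟨⟨a1, a2⟩, a3, a4⟩
    exact hS k hk z (by nlinarith) (by nlinarith) a3 a4
  have meet : ∀ k ≤ M, ∀ l ≤ M, |i l - i k| ≤ 1 → |j l - j k| ≤ 1 →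
      Conn triEnd (Op ω) S (h l) (v k) := by
    intro k hk l hl h1 h2
    have m1 : v k ∈ {z : ℤ × ℤ | z.2 = (j k - 2) * s} := hv k hk
    have m2 : v' k ∈ {z : ℤ × ℤ | z.2 = (j k + 3) * s} := hv' k hk
    have m3 : h l ∈ {z : ℤ × ℤ | z.1 = (i l - 2) * W} := hh l hl
    have m4 : h' l ∈ {z : ℤ × ℤ | z.1 = (i l + 3) * W} := hh' l hl
    simp only [mem_ofPred_eq] at m1 m2 m3 m4
    obtain ⟨h1, h1'⟩ := abs_le.1 h1
    obtain ⟨h2, h2'⟩ := abs_le.1 h2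
    obtain ⟨z, a1, a2⟩ := cross_meet (c₁ := i k * W) (c₂ := i k * W + W + 1) (r₁ := j l * s)
      (r₂ := j l * s + s) (hc' k hk) (hc l hl) (fun z hz => hz.1)
      (by nlinarith) (by nlinarith) (fun z hz => ⟨hz.1.1, by have := hz.1.2; omega⟩)
      (by nlinarith) (by nlinarith)
    exact (a2.mono (sub1 l hl)).trans (a1.mono (sub2 k hk)).symm
  have key : ∀ k ≤ M, Conn triEnd (Op ω) S (h 0) (h k) := by
    intro k
    induction k with
    | zero => intro hk; exact .refl (sub1 0 hk (hc 0 hk).1)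
    | succ k ih =>
      intro hk
      exact (ih (by omega)).trans ((meet k (by omega) k (by omega) (by simp) (by simp)).trans
        (meet k (by omega) (k + 1) hk (hi k hk) (hj k hk)).symm)
  exact ⟨h 0, h M, ⟨hh 0 (by omega), (hc 0 (by omega)).1.1⟩, ⟨hh M le_rfl, (hc M le_rfl).1.1⟩,
    key M le_rfl⟩

end Gluing

section Gluing

lemma finite_triEdges {S : Set (ℤ × ℤ)} (hS : S.Finite) :
    {e | (triEnd e).1 ∈ S ∧ (triEnd e).2 ∈ S}.Finite := by
  refine ((hS.prod (Set.finite_univ (α := Fin 3))).image fun x : (ℤ × ℤ) × Fin 3 =>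
    ((if x.2 = 1 then x.1.1 - 1 else x.1.1, x.1.2, x.2) : TriE)).subset ?_
  rintro e ⟨h, -⟩
  refine ⟨((triEnd e).1, e.2.2), ⟨h, trivial⟩, ?_⟩
  induction e using triE_cases <;> simp

lemma finite_box (x₁ x₂ y₁ y₂ : ℤ) :
    {z : ℤ × ℤ | (x₁ ≤ z.1 ∧ z.1 ≤ x₂) ∧ y₁ ≤ z.2 ∧ z.2 ≤ y₂}.Finite :=
  ((Set.finite_Icc x₁ x₂).prod (Set.finite_Icc y₁ y₂)).subset fun z hz => ⟨hz.1, hz.2⟩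

lemma abs_floor_sub_le {W a b : ℝ} (hW : 0 < W) (h : |a - b| ≤ W) :
    |⌊a / W⌋ - ⌊b / W⌋| ≤ 1 := by
  obtain ⟨h1, h2⟩ := abs_le.1 h
  have e1 : a / W ≤ b / W + 1 := by
    rw [div_add_one hW.ne']; exact div_le_div_of_nonneg_right (by linarith) hW.le
  have e2 : b / W ≤ a / W + 1 := by
    rw [div_add_one hW.ne']; exact div_le_div_of_nonneg_right (by linarith) hW.le
  have f1 := Int.floor_le_floor e1
  have f2 := Int.floor_le_floor e2
  rw [Int.floor_add_one] at f1 f2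
  exact abs_le.2 ⟨by omega, by omega⟩

lemma floor_div_bounds {W a : ℝ} (hW : 0 < W) :
    (⌊a / W⌋ : ℝ) * W ≤ a ∧ a < (⌊a / W⌋ : ℝ) * W + W := by
  have h1 := Int.floor_le (a / W)
  have h2 := Int.lt_floor_add_one (a / W)
  rw [le_div_iff₀ hW] at h1
  rw [div_lt_iff₀ hW] at h2
  exact ⟨h1, by linarith⟩

lemma biInter_pow_le {E : Type} {p : E → ℝ} (hp : ∀ e, p e ∈ Icc (0 : ℝ) 1)
    {A B : ℕ → Set (Config E)} {η : ENNReal} (n : ℕ)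
    (hA : ∀ k, ∃ F : Set E, F.Finite ∧ LocInc F (A k))
    (hB : ∀ k, ∃ F : Set E, F.Finite ∧ LocInc F (B k))
    (h : ∀ k, η ≤ prodBern p (A k) * prodBern p (B k)) :
    η ^ n ≤ prodBern p (⋂ k ∈ Finset.range n, A k ∩ B k) := by
  choose F hF hA using hA
  choose F' hF' hB using hB
  set G : Set E := ⋃ k ∈ (Finset.range n : Set ℕ), (F k ∪ F' k) with hG
  have hGf : G.Finite := (Finset.finite_toSet _).biUnion fun k _ => (hF k).union (hF' k)
  have sub : ∀ k ∈ Finset.range n, F k ∪ F' k ⊆ G := fun k hk =>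
    subset_biUnion_of_mem (u := fun k => F k ∪ F' k) (Finset.mem_coe.2 hk)
  have l1 : ∀ k ∈ Finset.range n, LocInc G (A k) := fun k hk =>
    (hA k).mono (subset_union_left.trans (sub k hk))
  have l2 : ∀ k ∈ Finset.range n, LocInc G (B k) := fun k hk =>
    (hB k).mono (subset_union_right.trans (sub k hk))
  refine le_trans ?_ (prodBern_biInter_ge hp hGf (Finset.range n)
    fun k hk => (l1 k hk).inter (l2 k hk))
  calc η ^ n = ∏ k ∈ Finset.range n, η := by simp
    _ ≤ _ := Finset.prod_le_prod' fun k hk =>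
      (h k).trans (prodBern_inter_ge hp hGf (l1 k hk) (l2 k hk))

lemma exists_locInc_cellH (W s i j : ℤ) : ∃ F : Set TriE, F.Finite ∧ LocInc F (cellH W s i j) :=
  ⟨_, finite_triEdges ((finite_box _ _ _ _).subset fun z hz => ⟨hz.2, hz.1⟩), locInc_crs _ _ _ _⟩

lemma exists_locInc_cellV (W s i j : ℤ) : ∃ F : Set TriE, F.Finite ∧ LocInc F (cellV W s i j) :=
  ⟨_, finite_triEdges (finite_box _ _ _ _), locInc_crs _ _ _ _⟩

/-- Axis-parallel crossings can be glued into crossings along arbitrary segments. -/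
lemma AxisCrossing.tubeCrossing {p : TriE → ℝ} (hp : ∀ e, p e ∈ Icc (0 : ℝ) 1) (h : AxisCrossing p) :
    TubeCrossing triEnd triPos (prodBern p) := by
  obtain ⟨b, hb, hH, C, hC, δV, hδV, mV, hV⟩ := h
  obtain ⟨δH, hδH, mH, hH⟩ := hH (25 * C)
  intro ε hε
  set M := ⌈30 * C / ε⌉₊ with hM
  have hb' : (1 : ℝ) ≤ b := by exact_mod_cast hb
  have hC' : (1 : ℝ) ≤ C := by exact_mod_cast hC
  have hM0 : 0 < M := Nat.ceil_pos.2 (by positivity)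
  set m₁ := mH + mV + 2
  refine ⟨(δH * δV) ^ (M + 1), by positivity, ⌈m₁ * (15 * C * b) / ε⌉₊, fun n hn u v huv => ?_⟩
  have hn' : m₁ ≤ ε * n / (15 * C * b) := by
    have := (Nat.ceil_le.1 hn)
    rw [div_le_iff₀ hε] at this
    rw [le_div_iff₀ (by positivity)]
    linarith
  set m := ⌊ε * n / (15 * C * b)⌋₊ with hm
  have hm1 : m₁ ≤ m := Nat.le_floor hn'
  have hm2 : (m : ℝ) ≤ ε * n / (15 * C * b) := Nat.floor_le (by positivity)
  have hm3 : ε * n / (15 * C * b) < m + 1 := Nat.lt_floor_add_one _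
  have hmpos : 1 ≤ m := by omega
  have hmpos' : (1 : ℝ) ≤ m := by exact_mod_cast hmpos
  set s : ℕ := b * m with hs
  set W : ℕ := 5 * C * s with hW
  have hs0 : 0 < s := Nat.mul_pos (by omega) (by omega)
  have hW0 : 0 < W := by positivity
  have hsR : (0 : ℝ) < s := by exact_mod_cast hs0
  have hWR : (0 : ℝ) < W := by exact_mod_cast hW0
  have hsW : (s : ℝ) ≤ W := by
    have : s ≤ W := by rw [hW]; exact Nat.le_mul_of_pos_left _ (by omega)
    exact_mod_cast this
  have hWε : 3 * (W : ℝ) ≤ ε * n := by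
    rw [le_div_iff₀ (by positivity)] at hm2
    rw [hW, hs]; push_cast; linarith
  have hMs : (n : ℝ) ≤ M * s := by
    have h1 : 30 * C / ε ≤ M := Nat.le_ceil _
    have h2 : ε * n ≤ 30 * C * s := by
      rw [div_lt_iff₀ (by positivity)] at hm3
      have : (m + 1 : ℝ) * (15 * C * b) ≤ 2 * m * (15 * C * b) := by gcongr; linarith
      rw [hs]; push_cast; linarith
    rw [div_le_iff₀ hε] at h1
    have h3 : 30 * C * (s : ℝ) ≤ M * ε * s := by gcongr
    have : ε * n ≤ ε * (M * s) := by linarith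
    exact le_of_mul_le_mul_left this hε
  have hMR : (0 : ℝ) < M := by exact_mod_cast hM0
  set c : ℕ → Pt := fun k => AffineMap.lineMap u v ((k : ℝ) / M) with hc
  have hc1 : ∀ k, (c k).1 = u.1 + k / M * (v.1 - u.1) := by
    intro k; simp [hc, AffineMap.lineMap_apply]; ring
  have hc2 : ∀ k, (c k).2 = u.2 + k / M * (v.2 - u.2) := by
    intro k; simp [hc, AffineMap.lineMap_apply]; ring
  have hc0 : c 0 = u := by simp [hc]
  have hcM : c M = v := by simp [hc, hMR.ne']
  have hcs : ∀ k ≤ M, c k ∈ segment ℝ u v := by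
    intro k hk
    rw [segment_eq_image_lineMap]
    refine ⟨_, ⟨by positivity, ?_⟩, rfl⟩
    rw [div_le_one hMR]; exact_mod_cast hk
  have hstep : ∀ x y : ℝ, |x - y| ≤ n → ∀ k : ℕ,
      |(x + ((k + 1 : ℕ) : ℝ) / M * (y - x)) - (x + k / M * (y - x))| ≤ s := by
    intro x y hxy k
    have : (x + ((k + 1 : ℕ) : ℝ) / M * (y - x)) - (x + k / M * (y - x)) = (y - x) / M := by
      push_cast; field_simp; ring
    rw [this, abs_div, abs_of_pos hMR, div_le_iff₀ hMR, abs_sub_comm]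
    linarith
  rw [Prod.dist_eq, max_le_iff, Real.dist_eq, Real.dist_eq] at huv
  set i : ℕ → ℤ := fun k => ⌊(c k).1 / (W : ℝ)⌋ with hi
  set j : ℕ → ℤ := fun k => ⌊(c k).2 / (s : ℝ)⌋ with hj
  have hbi : ∀ k, (i k : ℝ) * W ≤ (c k).1 ∧ (c k).1 < i k * W + W := fun k => floor_div_bounds hWR
  have hbj : ∀ k, (j k : ℝ) * s ≤ (c k).2 ∧ (c k).2 < j k * s + s := fun k => floor_div_bounds hsR
  have hη : ∀ k, ENNReal.ofReal (δH * δV) ≤ prodBern p (cellH W s (i k) (j k)) *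
      prodBern p (cellV W s (i k) (j k)) := by
    intro k
    rw [ENNReal.ofReal_mul hδH.le]
    refine mul_le_mul' ((hH m (by omega) (j k * s) ((i k - 2) * W)).trans (measure_mono ?_))
      ((hV (5 * m) (by omega) ((j k - 2) * s) (i k * W)).trans (measure_mono ?_))
    · have e : (i k - 2) * (W : ℤ) + ((25 * C * (b * m) : ℕ) : ℤ) = (i k + 3) * W := by
        rw [hW, hs]; push_cast; ring
      rw [e]
      exact crs_trim triEnd_col (by nlinarith)
    · have e : (j k - 2) * (s : ℤ) + ((b * (5 * m) : ℕ) : ℤ) = (j k + 3) * s := by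
        rw [hs]; push_cast; ring
      have e' : ((C * (b * (5 * m)) : ℕ) : ℤ) = W := by
        rw [hW, hs]; push_cast; ring
      rw [e, e']
      exact crs_trim triEnd_row (by nlinarith)
  have hii : ∀ k, |i (k + 1) - i k| ≤ 1 := fun k => abs_floor_sub_le hWR (by
    rw [hc1, hc1]; exact (hstep _ _ huv.1 k).trans hsW)
  have hjj : ∀ k, |j (k + 1) - j k| ≤ 1 := fun k => abs_floor_sub_le hsR (by
    rw [hc2, hc2]; exact hstep _ _ huv.2 k)
  have hsZ : (0 : ℤ) < s := Int.natCast_pos.2 hs0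
  have hWZ : (0 : ℤ) < W := Int.natCast_pos.2 hW0
  clear_value i j c
  clear_value W
  clear_value s
  rw [ENNReal.ofReal_pow (by positivity)]
  refine (biInter_pow_le hp (M + 1) (fun k => exists_locInc_cellH W s (i k) (j k))
    (fun k => exists_locInc_cellV W s (i k) (j k)) hη).trans (measure_mono ?_)
  intro ω hω
  simp only [mem_iInter, Finset.mem_range] at hω
  have bound : ∀ k ≤ M, ∀ z : ℤ × ℤ, (i k - 2) * W ≤ z.1 → z.1 ≤ (i k + 3) * W →
      (j k - 2) * s ≤ z.2 → z.2 ≤ (j k + 3) * s → dist (triPos z) (c k) ≤ ε * n := by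
    intro k hk z h1 h2 h3 h4
    have h1' : ((i k : ℝ) - 2) * W ≤ z.1 := by exact_mod_cast h1
    have h2' : (z.1 : ℝ) ≤ (i k + 3) * W := by exact_mod_cast h2
    have h3' : ((j k : ℝ) - 2) * s ≤ z.2 := by exact_mod_cast h3
    have h4' : (z.2 : ℝ) ≤ (j k + 3) * s := by exact_mod_cast h4
    have := hbi k
    have := hbj k
    rw [Prod.dist_eq, max_le_iff, Real.dist_eq, Real.dist_eq, abs_le, abs_le]
    simp only [triPos]
    refine ⟨⟨by linarith, by linarith⟩, by linarith, by linarith⟩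
  obtain ⟨y, z, hy, hz, hyz⟩ := cells_conn (ω := ω) (W := W) (s := s) hWZ hsZ (M := M) (i := i) (j := j)
    (fun k _ => hii k) (fun k _ => hjj k)
    (fun k hk => (hω k (by omega)).1) (fun k hk => (hω k (by omega)).2)
    (S := tube triPos u v (ε * n)) (fun k hk z h1 h2 h3 h4 =>
      ⟨c k, hcs k hk, bound k hk z h1 h2 h3 h4⟩)
  have hmono : ∀ a w b c : ℤ, 0 < w → b ≤ c → (a + b) * w ≤ (a + c) * w := fun a w b c hw h =>
    mul_le_mul_of_nonneg_right (by omega) hw.le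
  have key : ∀ k ≤ M, ∀ z : ℤ × ℤ, (z.1 = (i k - 2) * W ∧ j k * s ≤ z.2 ∧ z.2 ≤ j k * s + s) →
      dist (triPos z) (c k) ≤ ε * n := by
    rintro k hk z ⟨e1, e2, e3⟩
    refine bound k hk z e1.ge (e1.trans_le ?_) (le_trans ?_ e2) (e3.trans ?_)
    · exact hmono _ _ (-2) 3 hWZ (by norm_num)
    · have := hmono (j k) _ (-2) 0 hsZ (by norm_num)
      linarith
    · have := hmono (j k) _ 1 3 hsZ (by norm_num)
      linarith
  refine ⟨y, ?_, z, ?_, hyz⟩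
  · rw [← hc0]; exact key 0 (by omega) y hy
  · rw [← hcM]; exact key M le_rfl z hz

end Gluing

section TubeTransfer

/-- Position of a hexagonal vertex in lattice coordinates. -/
noncomputable def hexPos (z : HV) : Pt :=
  if z.2.2 then ((z.1 : ℝ) + 1 / 3, (z.2.1 : ℝ) + 1 / 3)
  else ((z.1 : ℝ) + 2 / 3, (z.2.1 : ℝ) - 1 / 3)

lemma triInt_eq_triHI (p0 p1 p2 : ℝ) : triInt p0 p1 p2 = triHI p0 (fun _ => p1) (fun _ => p2) := by
  funext e
  induction e using triE_cases <;> simp [triInt, triHI]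

lemma triInt_mem {p0 p1 p2 : ℝ} (h0 : p0 ∈ Icc (0 : ℝ) 1) (h1 : p1 ∈ Icc (0 : ℝ) 1)
    (h2 : p2 ∈ Icc (0 : ℝ) 1) (e : TriE) : triInt p0 p1 p2 e ∈ Icc (0 : ℝ) 1 := by
  induction e using triE_cases
  · simpa [triInt] using h0
  · simpa [triInt] using h1
  · simpa [triInt] using h2

lemma one_sub_triInt (p0 p1 p2 : ℝ) :
    (fun e => 1 - triInt p0 p1 p2 e) = triInt (1 - p0) (1 - p1) (1 - p2) := by
  funext e
  induction e using triE_cases <;> simp [triInt]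

variable {E V : Type} {en : E → V × V} {pos : V → Pt}

lemma tube_near {V' : Type} {pos' : V' → Pt} {u v : Pt} {r c r' : ℝ} (hr : r + c ≤ r') {x : V}
    {y : V'} (h : dist (pos' y) (pos x) ≤ c) (hx : x ∈ tube pos u v r) :
    y ∈ tube pos' u v r' := by
  obtain ⟨w, hw, hd⟩ := hx
  exact ⟨w, hw, (dist_triangle _ (pos x) _).trans (by linarith)⟩

lemma TubeCrossing.of_le {E' V' : Type} {en' : E' → V' × V'} {pos' : V' → Pt}
    {P : Measure (Config E)} {P' : Measure (Config E')} (h : TubeCrossing en pos P) {c : ℝ}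
    (hP : ∀ u v r, P (tubeEvent en pos u v r) ≤ P' (tubeEvent en' pos' u v (r + c))) :
    TubeCrossing en' pos' P' := by
  intro ε hε
  obtain ⟨δ, hδ, n₀, hn⟩ := h (ε / 2) (half_pos hε)
  refine ⟨δ, hδ, max n₀ ⌈2 * c / ε⌉₊, fun n hn' u v huv =>
    (hn n (le_trans (le_max_left _ _) hn') u v huv).trans ((hP _ _ _).trans (measure_mono ?_))⟩
  have h1 : 2 * c / ε ≤ n := (Nat.le_ceil _).trans (by exact_mod_cast (le_max_right _ _).trans hn')
  rw [div_le_iff₀ hε] at h1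
  have h2 : ε / 2 * n + c ≤ ε * n := by linarith
  refine crs_mono ?_ ?_ ?_
  · rintro x ⟨w, hw, hd⟩
    exact ⟨w, hw, hd.trans h2⟩
  · intro x hx
    exact le_trans hx h2
  · intro x hx
    exact le_trans hx h2

lemma TubeCrossing.swap {P : Measure (Config E)} (h : TubeCrossing en pos P) :
    TubeCrossing en (fun x => (pos x).swap) P := by
  have hd : ∀ a b : Pt, dist a.swap b = dist a b.swap := by
    intro a b
    simp [Prod.dist_eq, max_comm]
  intro ε hε
  obtain ⟨δ, hδ, n₀, hn⟩ := h ε hε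
  refine ⟨δ, hδ, n₀, fun n hn' u v huv => (hn n hn' u.swap v.swap ?_).trans (measure_mono ?_)⟩
  · rw [hd]; simpa using huv
  · refine crs_mono ?_ ?_ ?_
    · rintro x ⟨w, hw, hdw⟩
      refine ⟨w.swap, ?_, by rwa [hd, Prod.swap_swap]⟩
      obtain ⟨a, b, ha, hb, hab, rfl⟩ := hw
      exact ⟨a, b, ha, hb, hab, by ext <;> simp⟩
    · intro x hx
      simp only [mem_ofPred_eq] at hx ⊢
      rwa [hd]
    · intro x hx
      simp only [mem_ofPred_eq] at hx ⊢
      rwa [hd]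

/-- Paths following segments contain crossings of horizontal strips. -/
lemma TubeCrossing.strip {P : Measure (Config E)} (h : TubeCrossing en pos P) {f g : V → ℤ}
    (hf : ∀ x, |(pos x).1 - f x| ≤ 1) (hg : ∀ x, |(pos x).2 - g x| ≤ 1) (ρ : ℕ) :
    ∃ δ : ℝ, 0 < δ ∧ ∃ n₀ : ℕ, ∀ m : ℕ, n₀ ≤ m → ∀ r x : ℤ,
      ENNReal.ofReal δ ≤
        P (Crs en {z | r < g z ∧ g z < r + m} {z | f z ≤ x} {z | x + (ρ * m : ℕ) ≤ f z}) := by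
  obtain ⟨δ, hδ, n₀, hn⟩ := h (1 / (4 * (ρ + 2))) (by positivity)
  refine ⟨δ, hδ, max n₀ 12, fun m hm r x => ?_⟩
  have hm1 : n₀ ≤ m := (le_max_left _ _).trans hm
  have hm2 : 12 ≤ m := (le_max_right _ _).trans hm
  have hm3 : (12 : ℝ) ≤ m := by exact_mod_cast hm2
  refine (hn ((ρ + 2) * m) (hm1.trans (Nat.le_mul_of_pos_left _ (by omega)))
    (x - m, r + m / 2) (x + (ρ + 1) * m, r + m / 2) ?_).trans (measure_mono ?_)
  · rw [Prod.dist_eq, Real.dist_eq, Real.dist_eq]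
    refine max_le ?_ ?_
    · rw [abs_le]; push_cast
      have : 0 ≤ (ρ : ℝ) * m := by positivity
      constructor <;> linarith
    · simp; positivity
  have he : 1 / (4 * ((ρ : ℝ) + 2)) * ((ρ + 2) * m : ℕ) = m / 4 := by
    push_cast; field_simp
  rw [he]
  refine crs_mono ?_ ?_ ?_
  · rintro z ⟨w, hw, hd⟩
    have hw2 : w.2 = r + m / 2 := by
      obtain ⟨a, b, ha, hb, hab, rfl⟩ := hw
      simp only [Prod.smul_mk, smul_eq_mul, Prod.mk_add_mk]
      rw [← add_mul, hab, one_mul]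
    rw [Prod.dist_eq, max_le_iff, Real.dist_eq, Real.dist_eq, hw2] at hd
    have h1 := abs_le.1 hd.2
    have h2 := abs_le.1 (hg z)
    have h3 : (r : ℝ) < g z := by linarith
    have h4 : (g z : ℝ) < r + m := by linarith
    exact ⟨by exact_mod_cast h3, by exact_mod_cast h4⟩
  · intro z hz
    simp only [mem_ofPred_eq, Prod.dist_eq, max_le_iff, Real.dist_eq] at hz ⊢
    have h1 := abs_le.1 hz.1
    have h2 := abs_le.1 (hf z)
    have h3 : (f z : ℝ) ≤ x := by linarith
    exact_mod_cast h3
  · intro z hz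
    simp only [mem_ofPred_eq, Prod.dist_eq, max_le_iff, Real.dist_eq] at hz ⊢
    have h1 := abs_le.1 hz.1
    have h2 := abs_le.1 (hf z)
    have h3 : (x : ℝ) + (ρ * m : ℕ) ≤ f z := by push_cast; linarith
    exact_mod_cast h3

lemma triPos_fst (x : ℤ × ℤ) : |(triPos x).1 - x.1| ≤ 1 := by simp [triPos]

lemma triPos_snd (x : ℤ × ℤ) : |(triPos x).2 - x.2| ≤ 1 := by simp [triPos]

lemma hexPos_fst (x : HV) : |(hexPos x).1 - x.1| ≤ 1 := by
  obtain ⟨a, b, i⟩ := x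
  cases i <;> simp [hexPos] <;> norm_num [abs_le]

lemma hexPos_snd (x : HV) : |(hexPos x).2 - x.2.1| ≤ 1 := by
  obtain ⟨a, b, i⟩ := x
  cases i <;> simp [hexPos] <;> norm_num [abs_le]

lemma dist_hexPos_triPos_le {x : HV} {z : ℤ × ℤ} (h1 : |x.1 - z.1| ≤ 2) (h2 : |x.2.1 - z.2| ≤ 2) :
    dist (hexPos x) (triPos z) ≤ 3 := by
  have a1 := abs_le.1 (hexPos_fst x)
  have a2 := abs_le.1 (hexPos_snd x)
  have b1 : |(x.1 : ℝ) - z.1| ≤ 2 := by exact_mod_cast h1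
  have b2 : |(x.2.1 : ℝ) - z.2| ≤ 2 := by exact_mod_cast h2
  rw [abs_le] at b1 b2
  rw [Prod.dist_eq, Real.dist_eq, Real.dist_eq, max_le_iff, abs_le, abs_le]
  simp only [triPos]
  refine ⟨⟨?_, ?_⟩, ?_, ?_⟩ <;> linarith

variable {p0 p1 p2 : ℝ}

/-- The star–triangle transformation preserves the existence of paths close to segments. -/
lemma TubeCrossing.tri_to_hex (h0 : p0 ∈ Icc (0 : ℝ) 1) (h1 : p1 ∈ Icc (0 : ℝ) 1)
    (h2 : p2 ∈ Icc (0 : ℝ) 1) (hsd : kappaT p0 p1 p2 = 0)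
    (h : TubeCrossing triEnd triPos (prodBern (triInt p0 p1 p2))) :
    TubeCrossing hexEnd hexPos (prodBern (fun e => 1 - triInt p0 p1 p2 e)) := by
  refine h.of_le (c := 3) fun u v r => ?_
  have hp := triInt_mem h0 h1 h2
  rw [triInt_eq_triHI] at hp ⊢
  refine tri_le_hex hp (fun _ => hsd) (measurableSet_crs _ _ _ _) ?_
  rintro t s hc ⟨y, hy, z, hz, hyz⟩
  have near : ∀ x : ℤ × ℤ, dist (hexPos (x.1, x.2, false)) (triPos x) ≤ 3 := fun x =>
    dist_hexPos_triPos_le (by simp) (by simp)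
  refine ⟨_, (dist_triangle _ _ _).trans ((add_le_add (near y) hy).trans (add_comm _ _).le), _,
    (dist_triangle _ _ _).trans ((add_le_add (near z) hz).trans (add_comm _ _).le),
    hyz.tri_to_hex hc (fun x hx => tube_near le_rfl (near x) hx) ?_⟩
  intro e he _
  refine tube_near le_rfl (dist_hexPos_triPos_le ?_ ?_) he <;>
    (induction e using triE_cases <;> simp [edgeUp])

lemma Conn.hex_exists_up {s : TriE → Prop} {S : Set HV} {u v : HV} (h : Conn hexEnd s S u v) :
    (∃ z : ℤ × ℤ, (|z.1 - u.1| ≤ 1 ∧ |z.2 - u.2.1| ≤ 1) ∧ Conn hexEnd s S (z.1, z.2, true) v) ∨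
      u = v ∧ u.2.2 = false := by
  obtain ⟨a, b, i⟩ := u
  cases i
  · rcases h.head_cases with h' | ⟨w, hw, h'⟩
    · exact .inr ⟨h', rfl⟩
    · obtain ⟨z, rfl⟩ := hw.exists_up
      refine .inl ⟨z, ?_, h'⟩
      obtain ⟨-, -, e, -, he⟩ := hw
      have c1 := hexEnd_col e
      have c2 := hexEnd_row e
      rcases he with he | he <;> rw [he] at c1 c2 <;> simp only at c1 c2 ⊢
      · rw [abs_sub_comm] at c1 c2; exact ⟨c1, c2⟩
      · exact ⟨c1, c2⟩
  · exact .inl ⟨(a, b), by simp, h⟩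

lemma TubeCrossing.hex_to_tri (h0 : p0 ∈ Icc (0 : ℝ) 1) (h1 : p1 ∈ Icc (0 : ℝ) 1)
    (h2 : p2 ∈ Icc (0 : ℝ) 1) (hsd : kappaT p0 p1 p2 = 0)
    (h : TubeCrossing hexEnd hexPos (prodBern (fun e => 1 - triInt p0 p1 p2 e))) :
    TubeCrossing triEnd triPos (prodBern (triInt p0 p1 p2)) := by
  refine h.of_le (c := 3) fun u v r => ?_
  have hp := triInt_mem h0 h1 h2
  rw [triInt_eq_triHI] at hp ⊢
  refine hex_le_tri hp (fun _ => hsd) (measurableSet_crs _ _ _ _) ?_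
  rintro s t hc ⟨y, hy, z, hz, hyz⟩
  have near : ∀ (x : HV) (w : ℤ × ℤ), |x.1 - w.1| ≤ 2 → |x.2.1 - w.2| ≤ 2 →
      dist (triPos w) (hexPos x) ≤ 3 := fun x w a b => by
    rw [dist_comm]; exact dist_hexPos_triPos_le a b
  have end_near : ∀ (x : HV) (w : ℤ × ℤ) (q : Pt), dist (hexPos x) q ≤ r →
      |w.1 - x.1| ≤ 1 ∧ |w.2 - x.2.1| ≤ 1 → dist (triPos (w.1, w.2 + 1)) q ≤ r + 3 := by
    intro x w q hq hw
    rw [abs_le, abs_le] at hw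
    have := near x (w.1, w.2 + 1) (by rw [abs_le]; constructor <;> omega)
      (by rw [abs_le]; constructor <;> omega)
    linarith [dist_triangle (triPos (w.1, w.2 + 1)) (hexPos x) q]
  have up : ∀ (x : ℤ × ℤ) (x' : ℤ × ℤ), Conn hexEnd (Op s) (tube hexPos u v r) (x.1, x.2, true)
      (x'.1, x'.2, true) → Conn triEnd (Op t) (tube triPos u v (r + 3)) (x.1, x.2 + 1)
      (x'.1, x'.2 + 1) := by
    intro x x' hx
    refine hx.hex_to_tri hc ?_ ?_
    · intro a b hab
      exact tube_near le_rfl (near _ _ (by simp) (by simp)) hab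
    · intro a b hab
      exact ⟨.inl (tube_near le_rfl (near _ _ (by simp) (by simp)) hab),
        tube_near le_rfl (near _ _ (by simp) (by simp)) hab,
        tube_near le_rfl (near _ _ (by simp) (by simp)) hab⟩
  rcases hyz.hex_exists_up with ⟨y', hy', h3⟩ | ⟨rfl, -⟩
  · rcases h3.symm.hex_exists_up with ⟨z', hz', h4⟩ | ⟨h4, h5⟩
    · exact ⟨_, end_near _ _ _ hy hy', _, end_near _ _ _ hz hz', up _ _ h4.symm⟩
    · simp [h4] at h5
  · have hy' : |y.1 - y.1| ≤ 1 ∧ |y.2.1 - y.2.1| ≤ 1 := by simp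
    refine ⟨_, end_near _ (y.1, y.2.1) _ hy hy', _, end_near _ (y.1, y.2.1) _ hz hy',
      .refl (tube_near le_rfl (near y _ (by simp) (by simp)) hyz.mem_right)⟩

end TubeTransfer

section AxisTransfer

variable {p0 p1 p2 : ℝ}

lemma ofReal_le_measure_iff {Ω : Type*} [MeasurableSpace Ω] {P : Measure Ω} [IsFiniteMeasure P]
    {δ : ℝ} {A : Set Ω} : ENNReal.ofReal δ ≤ P A ↔ δ ≤ P.real A :=
  ENNReal.ofReal_le_iff_le_toReal (measure_ne_top _ _)

lemma half_le_one_sub_half_pow {m : ℕ} (hm : 1 ≤ m) : (1 / 2 : ℝ) ≤ 1 - (1 / 2) ^ m := by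
  have : (1 / 2 : ℝ) ^ m ≤ (1 / 2) ^ 1 := pow_le_pow_of_le_one (by norm_num) (by norm_num) hm
  linarith

lemma TubeCrossing.axisCrossing_tri (h0 : p0 ∈ Ioc (0 : ℝ) 1) (h1 : p1 ∈ Ioc (0 : ℝ) 1)
    (h2 : p2 ∈ Ico (0 : ℝ) 1) (hsd : kappaT p0 p1 p2 = 0)
    (h : TubeCrossing triEnd triPos (prodBern (triInt p0 0 (1 - p0)))) :
    AxisCrossing (triInt p0 p1 p2) := by
  have h0' : p0 ∈ Icc (0 : ℝ) 1 := ⟨h0.1.le, h0.2⟩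
  have h1' : p1 ∈ Icc (0 : ℝ) 1 := ⟨h1.1.le, h1.2⟩
  have h2' : p2 ∈ Icc (0 : ℝ) 1 := ⟨h2.1, h2.2.le⟩
  refine ⟨1, le_rfl, fun ρ => ?_, ?_⟩
  · obtain ⟨δ, hδ, n₀, hn⟩ := h.strip triPos_fst triPos_snd (ρ + 1)
    refine ⟨δ, hδ, n₀, fun m hm r x => ?_⟩
    rw [one_mul]
    refine ((hn m hm r (x - m)).trans (measure_mono ?_)).trans
      ((horizontal_transport h0' h1' h2' hsd (r := r) (x₁ := x - m) (x₂ := x + (ρ * m : ℕ)) m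
        (by push_cast; nlinarith)).trans (measure_mono ?_))
    · refine crs_mono (fun z hz => ⟨hz.1.le, hz.2.le⟩) le_rfl fun z hz => ?_
      simp only [mem_ofPred_eq] at hz ⊢
      push_cast at hz ⊢
      linarith
    · exact crs_mono le_rfl (fun z hz => by simp only [mem_ofPred_eq] at hz ⊢; linarith) le_rfl
  · obtain ⟨B, hB, hv⟩ := vertical_transport h0 h1 h2 hsd
    obtain ⟨δ, hδ, n₀, hn⟩ := h.swap.strip (f := fun z => z.2) (g := fun z => z.1) triPos_snd
      triPos_fst B
    refine ⟨B + 1, by omega, δ / 2, half_pos hδ, max n₀ 1, fun m hm r x => ?_⟩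
    rw [one_mul]
    have hm1 : 1 ≤ m := (le_max_right _ _).trans hm
    have hBm : (0 : ℤ) < (B * m : ℕ) := by
      have : 0 < B * m := Nat.mul_pos hB hm1
      exact_mod_cast this
    have e1 := hn m ((le_max_left _ _).trans hm) x (r + m - (B * m : ℕ))
    have e2 := hv m hm1 x (x + m) (r + m)
    rw [ofReal_le_measure_iff] at e1 ⊢
    have e3 : δ ≤ (prodBern (triInt p0 0 (1 - p0))).real
        (Crs triEnd {z | x ≤ z.1 ∧ z.1 ≤ x + m ∧ r + m - (B * m : ℕ) ≤ z.2 ∧ z.2 ≤ r + m}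
          {z | z.2 = r + m} {z | z.2 = r + m - (B * m : ℕ)}) := by
      refine e1.trans (measureReal_mono ?_ (measure_ne_top _ _))
      refine (crs_mono (S' := {z | x ≤ z.1 ∧ z.1 ≤ x + m}) (fun z hz => ⟨hz.1.le, hz.2.le⟩) le_rfl
        (B' := {z | r + m ≤ z.2}) fun z hz => ?_).trans
        ((crs_trim triEnd_row (by linarith)).trans ?_)
      · simp only [mem_ofPred_eq] at hz ⊢; linarith
      · rintro ω ⟨u, hu, v, hv, hc⟩
        refine ⟨v, hv, u, hu, hc.symm.mono ?_⟩
        rintro z ⟨⟨h1, h2⟩, h3, h4⟩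
        exact ⟨h1, h2, h3, h4⟩
    have e4 : δ / 2 ≤ δ * (1 - (1 / 2) ^ m) := by
      have := mul_le_mul_of_nonneg_left (half_le_one_sub_half_pow hm1) hδ.le
      linarith
    refine (e4.trans (mul_le_mul_of_nonneg_right e3 ?_)).trans
      (e2.trans (measureReal_mono ?_ (measure_ne_top _ _)))
    · linarith [half_le_one_sub_half_pow hm1]
    · rintro ω ⟨u, hu, v, hv, hc⟩
      refine ⟨v, ?_, u, ?_, hc.symm.mono ?_⟩
      · simp only [mem_ofPred_eq] at hv ⊢; linarith
      · simp only [mem_ofPred_eq] at hu ⊢; linarith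
      · rintro z ⟨h1, h2, -⟩
        refine ⟨h1, ?_⟩
        push_cast at h2 ⊢; linarith

lemma prodBern_real_add_compl_le {E : Type} [Countable E] {p : E → ℝ}
    (hp : ∀ e, p e ∈ Icc (0 : ℝ) 1)
    {A B : Set (Config E)} (hA : MeasurableSet A) (hB : MeasurableSet B)
    (h : ∀ ω ∈ A, (fun e => !(ω e)) ∉ B) :
    (prodBern p).real A + (prodBern fun e => 1 - p e).real B ≤ 1 := by
  have e : (prodBern fun e => 1 - p e) = (prodBern p).map (fun ω e => !(ω e)) := by
    rw [prodBern_map_not hp]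
  have hm : Measurable (fun (ω : Config E) e => !(ω e)) :=
    measurable_pi_lambda _ fun e => (measurable_of_finite (fun b : Bool => !b)).comp
      (measurable_pi_apply e)
  rw [e, measureReal_def (μ := Measure.map _ _), Measure.map_apply hm hB, ← measureReal_def,
    ← measureReal_union _ (hm hB)]
  · exact measureReal_le_one
  · rw [Set.disjoint_left]
    exact h

lemma one_le_prodBern_real_add {E : Type} [Countable E] {p : E → ℝ}
    (hp : ∀ e, p e ∈ Icc (0 : ℝ) 1)
    {A B : Set (Config E)} (hA : MeasurableSet A) (hB : MeasurableSet B)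
    (h : ∀ ω ∉ A, (fun e => !(ω e)) ∈ B) :
    1 ≤ (prodBern p).real A + (prodBern fun e => 1 - p e).real B := by
  have e : (prodBern fun e => 1 - p e) = (prodBern p).map (fun ω e => !(ω e)) := by
    rw [prodBern_map_not hp]
  have hm : Measurable (fun (ω : Config E) e => !(ω e)) :=
    measurable_pi_lambda _ fun e => (measurable_of_finite (fun b : Bool => !b)).comp
      (measurable_pi_apply e)
  rw [e, measureReal_def (μ := Measure.map _ _), Measure.map_apply hm hB, ← measureReal_def]
  have h1 : (prodBern p).real (A ∪ (fun (ω : Config E) e => !(ω e)) ⁻¹' B) = 1 := by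
    have : A ∪ (fun (ω : Config E) e => !(ω e)) ⁻¹' B = univ := by
      ext ω
      by_cases hω : ω ∈ A
      · simp [hω]
      · have := h ω hω
        simp [hω, this]
    rw [this, probReal_univ]
  rw [← h1]
  exact measureReal_union_le _ _

lemma op_not {E : Type} (ω : Config E) : Op (fun e => !(ω e)) = fun e => ¬ Op ω e := by
  funext e; simp [Op]

lemma TubeCrossing.axisCrossing_sq (h0 : p0 ∈ Ioc (0 : ℝ) 1) (h1 : p1 ∈ Ioc (0 : ℝ) 1)
    (h2 : p2 ∈ Ico (0 : ℝ) 1) (hsd : kappaT p0 p1 p2 = 0)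
    (h : TubeCrossing triEnd triPos (prodBern (triInt p0 p1 p2))) :
    AxisCrossing (triInt p0 0 (1 - p0)) := by
  have h0' : p0 ∈ Icc (0 : ℝ) 1 := ⟨h0.1.le, h0.2⟩
  have h1' : p1 ∈ Icc (0 : ℝ) 1 := ⟨h1.1.le, h1.2⟩
  have h2' : p2 ∈ Icc (0 : ℝ) 1 := ⟨h2.1, h2.2.le⟩
  have hsq : kappaT p0 0 (1 - p0) = 0 := by simp [kappaT]
  have hp := triInt_mem h0' h1' h2'
  have hps := triInt_mem h0' ⟨le_rfl, zero_le_one⟩ (one_sub_mem_Icc h0')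
  have hx := h.tri_to_hex h0' h1' h2' hsd
  -- a dual crossing of a box on the square lattice becomes a primal crossing
  have hex_le : ∀ {A A' : Set (Config TriE)}, MeasurableSet A →
      (∀ s t : Config TriE, CompatDown (Op s) (Op t) → s ∈ A → t ∈ A') →
      (prodBern fun e => 1 - triInt p0 0 (1 - p0) e).real A ≤
        (prodBern (triInt p0 0 (1 - p0))).real A' := by
    intro A A' hA hAA
    rw [triInt_eq_triHI] at hps ⊢
    exact ENNReal.toReal_mono (measure_ne_top _ _) (hex_le_tri hps (fun _ => hsq) hA hAA)
  obtain ⟨B, hB, hv⟩ := vertical_transport h0 h1 h2 hsd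
  refine ⟨2 * B, by omega, fun ρ => ?_, ?_⟩
  · obtain ⟨δ, hδ, n₀, hn⟩ := hx.strip hexPos_fst hexPos_snd (ρ * (2 * B) + B + 3)
    obtain ⟨M, hM⟩ := exists_pow_lt_of_lt_one (half_pos hδ) (show (1 / 2 : ℝ) < 1 by norm_num)
    refine ⟨δ / 2, half_pos hδ, max n₀ (max 1 M), fun m hm r x => ?_⟩
    have hm1 : 1 ≤ m := (le_max_left _ _).trans ((le_max_right _ _).trans hm)
    have hmM : M ≤ m := (le_max_right _ _).trans ((le_max_right _ _).trans hm)
    have hBm : 1 ≤ B * m := Nat.mul_pos hB hm1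
    have hBmZ : (1 : ℤ) ≤ (B * m : ℕ) := by exact_mod_cast hBm
    have hm1Z : (1 : ℤ) ≤ m := by exact_mod_cast hm1
    obtain ⟨w, hw⟩ : ∃ w : ℕ, w = ρ * (2 * B * m) := ⟨_, rfl⟩
    have hsplit : ((ρ * (2 * B) + B + 3) * m : ℕ) = w + B * m + 3 * m := by rw [hw]; ring
    have e1 := hn m ((le_max_left _ _).trans hm) (r + (B * m : ℕ) - m) (x - 1)
    have e2 := hv m hm1 x (x + w) (r + (B * m : ℕ))
    rw [hsplit] at e1
    rw [ofReal_le_measure_iff] at e1 ⊢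
    rw [← hw]
    push_cast at hBmZ e1 e2
    set K : ℤ := (B : ℤ) * m with hK
    clear_value K
    -- dual horizontal crossings for `p` prevent vertical crossings
    have e3 := prodBern_real_add_compl_le hp
      (A := Crs triEnd {z | x ≤ z.1 ∧ z.1 ≤ x + w + K ∧ r + K - m ≤ z.2 ∧ z.2 ≤ r + K}
        {z | z.2 = r + K} {z | z.2 = r + K - m})
      (B := Crs hexEnd {z | r + K - m < z.2.1 ∧ z.2.1 < r + K - m + m} {z | z.1 ≤ x - 1}
        {z | x - 1 + (w + K + 3 * m) ≤ z.1})
      (measurableSet_crs _ _ _ _) (measurableSet_crs _ _ _ _) (by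
        rintro ω ⟨u, hu, v, hv, hc⟩ ⟨y, hy, z, hz, hc'⟩
        simp only [mem_ofPred_eq] at hu hv hy hz
        rw [op_not] at hc'
        refine not_cross_swap (t := Op ω) (fun e he he' => he' he) hc.symm
          (fun z hz => ⟨hz.1, hz.2.1⟩) hv.le hu.ge hc' (fun z hz _ => ?_) (by omega) (by omega)
        simp only [mem_ofPred_eq] at hz
        omega)
    have e4 := one_le_prodBern_real_add hps
      (A := Crs triEnd {z | x ≤ z.1 ∧ z.1 ≤ x + w ∧ r + K - K ≤ z.2 ∧ z.2 ≤ r + K}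
        {z | z.2 = r + K} {z | z.2 = r + K - K})
      (B := Crs hexEnd {z | if z.2.2 then x ≤ z.1 ∧ z.1 ≤ x + w ∧ r ≤ z.2.1 ∧ z.2.1 < r + K
        else x ≤ z.1 + 1 ∧ z.1 + 1 ≤ x + w ∧ r < z.2.1 ∧ z.2.1 ≤ r + K}
        {z | z.1 = x - 1 ∧ z.2.2 = false} {z | z.1 = x + w ∧ z.2.2 = true})
      (measurableSet_crs _ _ _ _) (measurableSet_crs _ _ _ _) (by
        intro ω hω
        obtain ⟨b, b', hc⟩ := exists_dual_cross_swap (o := Op ω) (x₁ := x) (x₂ := x + w)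
          (r₁ := r) (r₂ := r + K) (by omega) (by omega) (by
            intro u v hu hv hc
            refine hω ⟨v, hv, u, by simp [hu], hc.symm.mono ?_⟩
            rintro z ⟨z1, z2, z3, z4⟩
            exact ⟨z1, z2, by omega, z4⟩)
        refine ⟨(x - 1, b, false), ⟨rfl, rfl⟩, (x + w, b', true), ⟨rfl, rfl⟩, ?_⟩
        rw [op_not]
        exact hc)
    have e5 := hex_le (A' := Crs triEnd {z | r ≤ z.2 ∧ z.2 ≤ r + (2 * B * m : ℕ)}
        {z | z.1 ≤ x} {z | x + (w : ℤ) ≤ z.1}) (measurableSet_crs hexEnd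
        {z | if z.2.2 then x ≤ z.1 ∧ z.1 ≤ x + w ∧ r ≤ z.2.1 ∧ z.2.1 < r + K
        else x ≤ z.1 + 1 ∧ z.1 + 1 ≤ x + w ∧ r < z.2.1 ∧ z.2.1 ≤ r + K}
        {z | z.1 = x - 1 ∧ z.2.2 = false} {z | z.1 = x + w ∧ z.2.2 = true}) (by
      have hK2 : ((2 * B * m : ℕ) : ℤ) = 2 * K := by rw [hK]; push_cast; ring
      rw [hK2]
      rintro s t hc ⟨⟨ua, ub, ui⟩, ⟨hu, hui⟩, ⟨va, vb, vi⟩, ⟨hv, hvi⟩, hcon⟩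
      simp only at hu hui hv hvi
      subst hui hvi hu hv
      rcases hcon.hex_exists_up with ⟨z, ⟨hz1, hz2⟩, hcz⟩ | ⟨h', -⟩
      · refine ⟨_, ?_, _, ?_, Conn.hex_to_tri hc ?_ ?_ (u := z) (v := (x + w, vb)) hcz⟩
        · simp only [mem_ofPred_eq]
          rw [abs_le] at hz1
          simp only at hz1
          omega
        · simp
        · intro a b hab
          simp only [mem_ofPred_eq] at hab ⊢
          simp at hab
          omega
        · intro a b hab
          simp only [mem_ofPred_eq] at hab ⊢
          simp at hab
          refine ⟨.inl ?_, ?_, ?_⟩ <;> omega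
      · simp at h')
    have e6 : (1 / 2 : ℝ) ^ m ≤ δ / 2 :=
      (pow_le_pow_of_le_one (by norm_num) (by norm_num) hmM).trans hM.le
    have e7 : (prodBern (triInt p0 0 (1 - p0))).real
        (Crs triEnd {z | x ≤ z.1 ∧ z.1 ≤ x + w ∧ r + K - K ≤ z.2 ∧ z.2 ≤ r + K}
        {z | z.2 = r + K} {z | z.2 = r + K - K}) ≤ 1 := measureReal_le_one
    have e8 := mul_le_mul_of_nonneg_right e7 (by positivity : (0 : ℝ) ≤ (1 / 2) ^ m)
    linarith
  · obtain ⟨δ, hδ, n₀, hn⟩ := hx.swap.strip (f := fun z => z.2.1) (g := fun z => z.1) hexPos_snd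
      hexPos_fst 3
    refine ⟨3, by norm_num, δ, hδ, max n₀ 2, fun m hm r x => ?_⟩
    have hm1 : 2 ≤ m := (le_max_right _ _).trans hm
    obtain ⟨k, hk⟩ : ∃ k : ℕ, k = 2 * B * m := ⟨_, rfl⟩
    have hkm : m ≤ k := by rw [hk]; exact Nat.le_mul_of_pos_left _ (by omega)
    rw [← hk]
    have e1 := hn k (((le_max_left _ _).trans hm).trans hkm) (x + k) (r - 3)
    have e2 := horizontal_transport h0' h1' h2' hsd (r := r - 1) (x₁ := x) (x₂ := x + 3 * k) k
      (by omega)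
    rw [ofReal_le_measure_iff] at e1 ⊢
    have e2' := ENNReal.toReal_mono (measure_ne_top _ _) e2
    rw [← measureReal_def, ← measureReal_def] at e2'
    have e3 := prodBern_real_add_compl_le hp
      (A := Crs triEnd {z | r - 1 ≤ z.2 ∧ z.2 ≤ r - 1 + k} {z | z.1 ≤ x + k}
        {z | x + 3 * k ≤ z.1})
      (B := Crs hexEnd {z | x + k < z.1 ∧ z.1 < x + k + k} {z | z.2.1 ≤ r - 3}
        {z | r - 3 + (3 * k : ℕ) ≤ z.2.1})
      (measurableSet_crs _ _ _ _) (measurableSet_crs _ _ _ _) (by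
        rintro ω ⟨u, hu, v, hv, hc⟩ ⟨y, hy, z, hz, hc'⟩
        simp only [mem_ofPred_eq] at hu hv hy hz
        rw [op_not] at hc'
        have strip_le : ∀ y : HV, Perc.strip y ≤ y.2.1 ∧ y.2.1 - 1 ≤ Perc.strip y := by
          rintro ⟨a, b, i⟩; cases i <;> simp [Perc.strip]
        have := strip_le y
        have := strip_le z
        refine not_cross (t := Op ω) (fun e he he' => he' he) hc
          (fun z hz => hz) hu hv hc' (fun z hz _ => ?_) (by omega) (by omega)
        simp only [mem_ofPred_eq] at hz
        omega)
    have e4 := one_le_prodBern_real_add hps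
      (A := Crs triEnd {z | r - 1 ≤ z.2 ∧ z.2 ≤ r - 1 + k} {z | z.1 ≤ x} {z | x + 3 * k ≤ z.1})
      (B := Crs hexEnd {z | x ≤ z.1 ∧ z.1 < x + 3 * k ∧ r - 1 ≤ z.2.1 ∧ z.2.1 ≤ r - 1 + k}
        {z | z.2.1 = r - 1 ∧ z.2.2 = false} {z | z.2.1 = r - 1 + k ∧ z.2.2 = true})
      (measurableSet_crs _ _ _ _) (measurableSet_crs _ _ _ _) (by
        intro ω hω
        obtain ⟨b, b', hc⟩ := exists_dual_cross (o := Op ω) (x₁ := x) (x₂ := x + 3 * k)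
          (r₁ := r - 1) (r₂ := r - 1 + k) (by omega) (by omega) (by
            intro u v hu hv hc
            refine hω ⟨u, hu.le, v, hv.ge, hc.mono ?_⟩
            rintro z ⟨z1, z2, z3, z4⟩
            exact ⟨z3, z4⟩)
        refine ⟨(b, r - 1, false), ⟨rfl, rfl⟩, (b', r - 1 + k, true), ⟨rfl, rfl⟩, ?_⟩
        rw [op_not]
        exact hc)
    have e5 := hex_le (A' := Crs triEnd {z | x ≤ z.1 ∧ z.1 ≤ x + (3 * k : ℕ)}
        {z | z.2 ≤ r} {z | r + k ≤ z.2}) (measurableSet_crs hexEnd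
        {z | x ≤ z.1 ∧ z.1 < x + 3 * k ∧ r - 1 ≤ z.2.1 ∧ z.2.1 ≤ r - 1 + k}
        {z | z.2.1 = r - 1 ∧ z.2.2 = false} {z | z.2.1 = r - 1 + k ∧ z.2.2 = true}) (by
      rintro s t hc ⟨⟨ua, ub, ui⟩, ⟨hu, hui⟩, ⟨va, vb, vi⟩, ⟨hv, hvi⟩, hcon⟩
      simp only at hu hui hv hvi
      subst hui hvi hu hv
      obtain h' | ⟨w, hw, hcz⟩ := hcon.head_cases
      · simp at h'
      obtain ⟨z, rfl⟩ := hw.exists_up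
      have hzr : z.2 ≤ r - 1 := by
        obtain ⟨-, -, e, -, he⟩ := hw
        induction e using triE_cases <;> simp at he <;> omega
      refine ⟨_, ?_, _, ?_, Conn.hex_to_tri hc ?_ ?_ (u := z) (v := (va, r - 1 + k)) hcz⟩
      · simp only [mem_ofPred_eq]
        omega
      · simp only [mem_ofPred_eq]
        omega
      · intro a b hab
        simp only [mem_ofPred_eq] at hab ⊢
        push_cast
        omega
      · intro a b hab
        simp only [mem_ofPred_eq] at hab ⊢
        push_cast
        refine ⟨.inl ?_, ?_, ?_⟩ <;> omega)
    linarith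

end AxisTransfer

section Curves

lemma exists_first_eq {φ : ℝ → ℝ} {a b c : ℝ} (hab : a ≤ b) (hφ : ContinuousOn φ (Icc a b))
    (ha : φ a ≤ c) (hb : c ≤ φ b) :
    ∃ t ∈ Icc a b, φ t = c ∧ ∀ s ∈ Icc a t, φ s ≤ c := by
  set K := Icc a b ∩ φ ⁻¹' {c} with hK
  have hKc : IsCompact K :=
    isCompact_Icc.of_isClosed_subset (hφ.preimage_isClosed_of_isClosed isClosed_Icc
      isClosed_singleton) inter_subset_left
  obtain ⟨t₀, ht₀, h₀⟩ := intermediate_value_Icc hab hφ ⟨ha, hb⟩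
  obtain ⟨t, ⟨ht, htc⟩, hmin⟩ := hKc.exists_isLeast ⟨t₀, ht₀, h₀⟩
  refine ⟨t, ht, htc, fun s hs => ?_⟩
  by_contra! hlt
  have hs' : s ≤ b := hs.2.trans ht.2
  obtain ⟨r, hr, hrc⟩ := intermediate_value_Icc hs.1
    (hφ.mono (Icc_subset_Icc le_rfl hs')) ⟨ha, hlt.le⟩
  have h1 : t ≤ r := hmin ⟨⟨hr.1, hr.2.trans hs'⟩, hrc⟩
  have h2 : s = t := le_antisymm hs.2 (h1.trans hr.2)
  rw [h2, show φ t = c from htc] at hlt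
  exact lt_irrefl _ hlt

lemma exists_last_eq {φ : ℝ → ℝ} {a b c : ℝ} (hab : a ≤ b) (hφ : ContinuousOn φ (Icc a b))
    (ha : φ a ≤ c) (hb : c ≤ φ b) :
    ∃ t ∈ Icc a b, φ t = c ∧ ∀ s ∈ Icc t b, c ≤ φ s := by
  have hm : MapsTo (fun s => a + b - s) (Icc a b) (Icc a b) :=
    fun s hs => ⟨by linarith [hs.2], by linarith [hs.1]⟩
  obtain ⟨t, ht, htc, h⟩ := exists_first_eq (φ := fun s => -φ (a + b - s)) (c := -c) hab
    (hφ.comp (by fun_prop) hm).neg (by simpa using hb) (by simpa using ha)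
  refine ⟨a + b - t, hm ht, by linarith, fun s hs => ?_⟩
  have := h (a + b - s) ⟨by linarith [hs.2, ht.1], by linarith [hs.1]⟩
  simp only [sub_sub_cancel] at this
  linarith

variable {E V : Type} {en : E → V × V} {pos : V → Pt}

/-- Edges of an embedded graph have bounded length, meet only at common vertices, and are
locally finite. -/
structure PlaneGraph (en : E → V × V) (pos : V → Pt) : Prop where
  len : ∃ c : ℝ, 0 ≤ c ∧ ∀ e, dist (pos (en e).1) (pos (en e).2) ≤ c
  fin : ∀ R : ℝ, {e | ‖pos (en e).1‖ ≤ R}.Finite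
  meet : ∀ e e', (segment ℝ (pos (en e).1) (pos (en e).2) ∩
      segment ℝ (pos (en e').1) (pos (en e').2)).Nonempty →
    (en e).1 = (en e').1 ∨ (en e).1 = (en e').2 ∨ (en e).2 = (en e').1 ∨ (en e).2 = (en e').2

/-- Union of the embedded open edges. -/
def openSegs (en : E → V × V) (pos : V → Pt) (ω : Config E) : Set Pt :=
  ⋃ e ∈ {e : E | ω e = true}, segment ℝ (pos (en e).1) (pos (en e).2)

lemma mem_openSegs {ω : Config E} {z : Pt} :
    z ∈ openSegs en pos ω ↔ ∃ e, ω e = true ∧ z ∈ segment ℝ (pos (en e).1) (pos (en e).2) := by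
  simp [openSegs]

lemma dist_le_of_mem_segment {x y z : Pt} (h : z ∈ segment ℝ x y) :
    dist x z ≤ dist x y ∧ dist y z ≤ dist x y := by
  have := dist_add_dist_of_mem_segment h
  constructor
  · linarith [dist_nonneg (x := z) (y := y)]
  · rw [dist_comm y z]; linarith [dist_nonneg (x := x) (y := z)]

lemma isClosed_segment' (x y : Pt) : IsClosed (segment ℝ x y) := by
  rw [segment_eq_image_lineMap]
  exact (isCompact_Icc.image (by fun_prop)).isClosed

/-- A curve along open edges determines an open path. -/
lemma PlaneGraph.conn_of_curve (hG : PlaneGraph en pos) {c : ℝ}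
    (hc : ∀ e, dist (pos (en e).1) (pos (en e).2) ≤ c) {ω : Config E} {γ : ℝ → Pt} {b : ℝ}
    (hb : 0 ≤ b) (hγ : ContinuousOn γ (Icc 0 b)) {S₀ : Set Pt} (hS₀ : Bornology.IsBounded S₀)
    (h : ∀ t ∈ Icc 0 b, γ t ∈ S₀ ∩ openSegs en pos ω) :
    ∃ x y : V, dist (pos x) (γ 0) ≤ c ∧ dist (pos y) (γ b) ≤ c ∧
      Conn en (Op ω) {x | ∃ w ∈ S₀, dist (pos x) w ≤ c} x y := by
  set S : Set V := {x | ∃ w ∈ S₀, dist (pos x) w ≤ c} with hS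
  set F : Set E := {e | ω e = true ∧
    (segment ℝ (pos (en e).1) (pos (en e).2) ∩ S₀).Nonempty} with hF
  have hends : ∀ e ∈ F, (en e).1 ∈ S ∧ (en e).2 ∈ S := by
    rintro e ⟨-, w, hw, hwS⟩
    exact ⟨⟨w, hwS, (dist_le_of_mem_segment hw).1.trans (hc e)⟩,
      ⟨w, hwS, (dist_le_of_mem_segment hw).2.trans (hc e)⟩⟩
  have hFfin : F.Finite := by
    obtain ⟨R, hR⟩ := hS₀.exists_norm_le
    refine (hG.fin (R + c)).subset fun e he => ?_
    obtain ⟨w, hw, hd⟩ := (hends e he).1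
    have := norm_le_norm_add_norm_sub' (pos (en e).1) w
    rw [← dist_eq_norm] at this
    simp only [mem_ofPred_eq]
    linarith [hR w hw]
  have h0 := h 0 ⟨le_rfl, hb⟩
  obtain ⟨e₀, he₀, hm₀⟩ := mem_openSegs.1 h0.2
  have he₀F : e₀ ∈ F := ⟨he₀, _, hm₀, h0.1⟩
  set C : Set E := {e | e ∈ F ∧ Conn en (Op ω) S (en e₀).1 (en e).1} with hC
  have hstep : ∀ e ∈ F, Stp en (Op ω) S (en e).1 (en e).2 := fun e he =>
    ⟨(hends e he).1, (hends e he).2, e, he.1, .inl rfl⟩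
  have hadj : ∀ e ∈ C, ∀ e' ∈ F, (segment ℝ (pos (en e).1) (pos (en e).2) ∩
      segment ℝ (pos (en e').1) (pos (en e').2)).Nonempty → e' ∈ C := by
    rintro e ⟨he, hcon⟩ e' he' hne
    refine ⟨he', ?_⟩
    have s := hstep e he
    have s' := (hstep e' he').symm
    rcases hG.meet e e' hne with h | h | h | h
    · rwa [h] at hcon
    · rw [h] at hcon; exact hcon.tail s'
    · rw [h] at s; exact hcon.tail s
    · rw [h] at s; exact (hcon.tail s).tail s'
  set K₁ : Set Pt := ⋃ e ∈ C, segment ℝ (pos (en e).1) (pos (en e).2) with hK₁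
  set K₂ : Set Pt := ⋃ e ∈ F \ C, segment ℝ (pos (en e).1) (pos (en e).2) with hK₂
  have hcl₁ : IsClosed K₁ := (hFfin.subset fun e he => he.1).isClosed_biUnion
    fun e _ => isClosed_segment' _ _
  have hcl₂ : IsClosed K₂ := (hFfin.subset sdiff_subset).isClosed_biUnion
    fun e _ => isClosed_segment' _ _
  have hpre : IsPreconnected (γ '' Icc 0 b) := isPreconnected_Icc.image _ hγ
  have hcover : γ '' Icc 0 b ⊆ K₁ ∪ K₂ := by
    rintro _ ⟨t, ht, rfl⟩
    obtain ⟨hS, ho⟩ := h t ht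
    obtain ⟨e, he, hm⟩ := mem_openSegs.1 ho
    have heF : e ∈ F := ⟨he, _, hm, hS⟩
    by_cases heC : e ∈ C
    · exact .inl (mem_biUnion heC hm)
    · exact .inr (mem_biUnion (show e ∈ F \ C from ⟨heF, heC⟩) hm)
  have hdisj : K₁ ∩ K₂ = ∅ := by
    rw [eq_empty_iff_forall_notMem]
    rintro z ⟨h1, h2⟩
    simp only [hK₁, hK₂, mem_iUnion, exists_prop] at h1 h2
    obtain ⟨e, he, hz⟩ := h1
    obtain ⟨e', he', hz'⟩ := h2
    exact he'.2 (hadj e he e' he'.1 ⟨z, hz, hz'⟩)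
  have he₀C : e₀ ∈ C := ⟨he₀F, .refl (hends e₀ he₀F).1⟩
  have hb1 : γ b ∈ K₁ := by
    by_contra hcon
    have hb2 : γ b ∈ K₂ := (hcover ⟨b, ⟨hb, le_rfl⟩, rfl⟩).resolve_left hcon
    obtain ⟨z, -, hz⟩ := isPreconnected_closed_iff.1 hpre K₁ K₂ hcl₁ hcl₂ hcover
      ⟨γ 0, ⟨0, ⟨le_rfl, hb⟩, rfl⟩, mem_biUnion he₀C hm₀⟩ ⟨γ b, ⟨b, ⟨hb, le_rfl⟩, rfl⟩, hb2⟩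
    rw [hdisj] at hz
    exact hz
  simp only [hK₁, mem_iUnion, exists_prop] at hb1
  obtain ⟨e, he, hm⟩ := hb1
  exact ⟨_, _, (dist_le_of_mem_segment hm₀).1.trans (hc e₀),
    (dist_le_of_mem_segment hm).1.trans (hc e), he.2⟩

/-- An open path determines a curve along open edges. -/
lemma Conn.joinedIn {ω : Config E} {S : Set V} {W : Set Pt} (hW : Convex ℝ W)
    (hSW : ∀ x ∈ S, pos x ∈ W) {x y : V} (h : Conn en (Op ω) S x y) :
    x = y ∨ JoinedIn (W ∩ openSegs en pos ω) (pos x) (pos y) := by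
  induction h using Conn.induct with
  | h0 hx => exact .inl rfl
  | hs y z hy hyz ih =>
    obtain ⟨h1, h2, e, he, hor⟩ := hyz
    have hj : JoinedIn (W ∩ openSegs en pos ω) (pos y) (pos z) := by
      refine JoinedIn.of_segment_subset (subset_inter (hW.segment_subset (hSW _ h1) (hSW _ h2)) ?_)
      intro w hw
      refine mem_openSegs.2 ⟨e, he, ?_⟩
      rcases hor with h | h <;> rw [h]
      · exact hw
      · rwa [segment_symm]
    rcases ih with rfl | ih
    · exact .inr hj
    · exact .inr (ih.trans hj)

end Curves

section RotTrans

lemma rot_add_vec (θ : ℝ) (z w : Pt) : rot θ (z + w) = rot θ z + rot θ w := by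
  ext <;> simp [rot] <;> ring

lemma rot_smul (θ a : ℝ) (z : Pt) : rot θ (a • z) = a • rot θ z := by
  ext <;> simp [rot] <;> ring

lemma rot_rot (θ η : ℝ) (z : Pt) : rot θ (rot η z) = rot (θ + η) z := by
  ext <;> simp [rot, Real.cos_add, Real.sin_add] <;> ring

lemma rot_zero (z : Pt) : rot 0 z = z := by ext <;> simp [rot]

lemma norm_rot_le (θ : ℝ) (z : Pt) : ‖rot θ z‖ ≤ 2 * ‖z‖ := by
  have h1 : |z.1| ≤ ‖z‖ := norm_fst_le z
  have h2 : |z.2| ≤ ‖z‖ := norm_snd_le z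
  have hc := Real.abs_cos_le_one θ
  have hs := Real.abs_sin_le_one θ
  have key : ∀ {s : ℝ} (x : ℝ), |s| ≤ 1 → |s * x| ≤ |x| := fun x h => by
    rw [abs_mul]; exact mul_le_of_le_one_left (abs_nonneg x) h
  rw [Prod.norm_def, max_le_iff]
  constructor
  · exact (abs_sub _ _).trans (by linarith [key z.1 hc, key z.2 hs])
  · exact (abs_add_le _ _).trans (by linarith [key z.1 hs, key z.2 hc])

lemma IsRotTrans.comp {f g : Pt → Pt} (hf : IsRotTrans f) (hg : IsRotTrans g) :
    IsRotTrans (fun z => f (g z)) := by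
  obtain ⟨θ, t, rfl⟩ := hf
  obtain ⟨η, s, rfl⟩ := hg
  exact ⟨θ + η, rot θ s + t, funext fun z => by
    simp only [rot_add_vec, rot_rot]; rw [add_assoc]⟩

lemma isRotTrans_add (w : Pt) : IsRotTrans (fun z => z + w) :=
  ⟨0, w, funext fun z => by rw [rot_zero]⟩

lemma IsRotTrans.exists_inv {f : Pt → Pt} (hf : IsRotTrans f) :
    ∃ g, IsRotTrans g ∧ (∀ z, g (f z) = z) ∧ ∀ z, f (g z) = z := by
  obtain ⟨θ, t, rfl⟩ := hf
  refine ⟨fun z => rot (-θ) z + rot (-θ) (-t), ⟨-θ, _, rfl⟩, fun z => ?_, fun z => ?_⟩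
  · simp only [← rot_add_vec]; simp [rot_rot, rot_zero]
  · simp only [← rot_add_vec]; simp [rot_rot, rot_zero]

lemma IsRotTrans.dist_le {f : Pt → Pt} (hf : IsRotTrans f) (x y : Pt) :
    dist (f x) (f y) ≤ 2 * dist x y := by
  obtain ⟨θ, t, rfl⟩ := hf
  rw [dist_add_right, dist_eq_norm, dist_eq_norm]
  have : rot θ x - rot θ y = rot θ (x - y) := by
    rw [sub_eq_iff_eq_add, ← rot_add_vec, sub_add_cancel]
  rw [this]
  exact norm_rot_le θ _

lemma IsRotTrans.continuous {f : Pt → Pt} (hf : IsRotTrans f) : Continuous f := by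
  obtain ⟨θ, t, rfl⟩ := hf
  unfold rot
  fun_prop

lemma IsRotTrans.map_comb {f : Pt → Pt} (hf : IsRotTrans f) {a b : ℝ} (hab : a + b = 1)
    (x y : Pt) : f (a • x + b • y) = a • f x + b • f y := by
  obtain ⟨θ, t, rfl⟩ := hf
  simp only [rot_add_vec, rot_smul, smul_add]
  have : t = a • t + b • t := by rw [← add_smul, hab, one_smul]
  nth_rewrite 1 [this]
  abel

lemma IsRotTrans.map_mem_segment {f : Pt → Pt} (hf : IsRotTrans f) {x y z : Pt}
    (h : z ∈ segment ℝ x y) : f z ∈ segment ℝ (f x) (f y) := by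
  obtain ⟨a, b, ha, hb, hab, rfl⟩ := h
  exact ⟨a, b, ha, hb, hab, (hf.map_comb hab x y).symm⟩

lemma exists_rotTrans (u v : Pt) : ∃ f, IsRotTrans f ∧ ∃ D : ℝ, 0 ≤ D ∧ D ≤ 2 * dist u v ∧
    f (0, 0) = u ∧ f (D, 0) = v := by
  set z : ℂ := ⟨v.1 - u.1, v.2 - u.2⟩ with hz
  refine ⟨fun w => rot z.arg w + u, ⟨_, _, rfl⟩, ‖z‖, norm_nonneg _, ?_, ?_, ?_⟩
  · have h1 : |v.1 - u.1| ≤ dist u v := by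
      rw [dist_comm, dist_eq_norm]; exact norm_fst_le (v - u)
    have h2 : |v.2 - u.2| ≤ dist u v := by
      rw [dist_comm, dist_eq_norm]; exact norm_snd_le (v - u)
    exact (Complex.norm_le_abs_re_add_abs_im z).trans (by simp only [hz]; linarith)
  · ext <;> simp [rot]
  · have h1 := Complex.norm_mul_cos_arg z
    have h2 := Complex.norm_mul_sin_arg z
    ext
    · simp only [rot, Prod.fst_add]; simp only [mul_zero, sub_zero]
      rw [mul_comm, h1]; simp [hz]
    · simp only [rot, Prod.snd_add]; simp only [mul_zero, add_zero]
      rw [mul_comm, h2]; simp [hz]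

lemma mem_segment_axis {x D y : ℝ} (h0 : 0 ≤ x) (h1 : x ≤ D) :
    ((x, y) : Pt) ∈ segment ℝ ((0, y) : Pt) (D, y) := by
  rcases h0.eq_or_lt with rfl | hx
  · exact left_mem_segment _ _ _
  · have hD : 0 < D := hx.trans_le h1
    refine ⟨1 - x / D, x / D, ?_, by positivity, by ring, ?_⟩
    · rw [sub_nonneg, div_le_one hD]; exact h1
    · ext
      · simp; field_simp
      · simp; ring

end RotTrans

section BoxTube

variable {E V : Type} {en : E → V × V} {pos : V → Pt} {Λ : LatticeOn E}

lemma openEdgeSet_eq (hΛ : ∀ e, Λ.ends e = (pos (en e).1, pos (en e).2)) (ω : Config E) :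
    openEdgeSet Λ ω = openSegs en pos ω := by
  simp [openEdgeSet, openSegs, hΛ]

lemma isBounded_stdRect (h l : ℝ) : Bornology.IsBounded (stdRect h l) :=
  (Metric.isBounded_Icc ((0, 0) : Pt) (h, l)).subset fun z hz =>
    ⟨⟨hz.1, hz.2.2.1⟩, ⟨hz.2.1, hz.2.2.2⟩⟩

lemma dist_mk_same (x y y' : ℝ) : dist ((x, y) : Pt) (x, y') = |y - y'| := by
  rw [Prod.dist_eq, dist_self, Real.dist_eq]
  exact max_eq_right (abs_nonneg _)

/-- Box crossings contain open paths close to a segment. -/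
lemma PlaneGraph.tubeEvent_of_crossing (hG : PlaneGraph en pos) {c : ℝ}
    (hc : ∀ e, dist (pos (en e).1) (pos (en e).2) ≤ c)
    (hΛ : ∀ e, Λ.ends e = (pos (en e).1, pos (en e).2)) {f : Pt → Pt} (hf : IsRotTrans f)
    {h N D r : ℝ} (hD : 0 ≤ D) (hDh : D ≤ h) (hr : N + c ≤ r) {ω : Config E}
    (hω : CrossingIn Λ ω (f '' stdRect h N) (f '' leftSide h N) (f '' rightSide h N)) :
    ω ∈ tubeEvent en pos (f (0, N / 2)) (f (D, N / 2)) r := by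
  obtain ⟨g, hg, hgf, hfg⟩ := hf.exists_inv
  obtain ⟨γ, hγ, ⟨z₀, hz₀, h0⟩, ⟨z₁, hz₁, h1⟩, hin⟩ := hω
  have hφ : ContinuousOn (fun t => (g (γ t)).1) (Icc 0 1) :=
    continuous_fst.comp_continuousOn (hg.continuous.comp_continuousOn hγ)
  obtain ⟨t, ht, htD, hle⟩ := exists_first_eq (c := D) zero_le_one hφ
    (by simp only [← h0, hgf]; rw [hz₀.1]; exact hD)
    (by simp only [← h1, hgf]; rw [hz₁.1]; exact hDh)
  have hsub : Icc 0 t ⊆ Icc (0 : ℝ) 1 := Icc_subset_Icc le_rfl ht.2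
  have hrect : ∀ s ∈ Icc (0 : ℝ) 1, g (γ s) ∈ stdRect h N := by
    intro s hs
    obtain ⟨z, hz, hzs⟩ := (hin s hs).1
    rw [← hzs, hgf]; exact hz
  have hbd : Bornology.IsBounded (f '' stdRect D N) := by
    obtain ⟨R, hR⟩ := Metric.isBounded_iff.1 (isBounded_stdRect D N)
    refine Metric.isBounded_iff.2 ⟨2 * R, ?_⟩
    rintro _ ⟨x, hx, rfl⟩ _ ⟨y, hy, rfl⟩
    exact (hf.dist_le x y).trans (by linarith [hR hx hy])
  have hmem : ∀ s ∈ Icc 0 t, γ s ∈ f '' stdRect D N ∩ openSegs en pos ω := by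
    intro s hs
    have h1 := hrect s (hsub hs)
    refine ⟨⟨g (γ s), ⟨h1.1, hle s hs, h1.2.2⟩, hfg _⟩, ?_⟩
    rw [← openEdgeSet_eq hΛ]
    exact (hin s (hsub hs)).2
  have hmid : ∀ x y : ℝ, 0 ≤ y → y ≤ N → dist (f (x, y)) (f (x, N / 2)) ≤ N := by
    intro x y hy0 hy1
    refine (hf.dist_le _ _).trans ?_
    rw [dist_mk_same]
    have : |y - N / 2| ≤ N / 2 := abs_le.2 ⟨by linarith, by linarith⟩
    linarith
  obtain ⟨x, y, hx, hy, hcon⟩ := hG.conn_of_curve hc ht.1 (hγ.mono hsub) hbd hmem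
  refine ⟨x, ?_, y, ?_, hcon.mono ?_⟩
  · have : dist (γ 0) (f (0, N / 2)) ≤ N := by
      rw [← h0, show z₀ = (0, z₀.2) from Prod.ext hz₀.1 rfl]
      exact hmid _ _ hz₀.2.1 hz₀.2.2
    simp only [mem_ofPred_eq]
    linarith [dist_triangle (pos x) (γ 0) (f (0, N / 2))]
  · have : dist (γ t) (f (D, N / 2)) ≤ N := by
      have h1 := hrect t ht
      rw [← hfg (γ t), show g (γ t) = (D, (g (γ t)).2) from Prod.ext htD rfl]
      exact hmid _ _ h1.2.2.1 h1.2.2.2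
    simp only [mem_ofPred_eq]
    linarith [dist_triangle (pos y) (γ t) (f (D, N / 2))]
  · rintro z ⟨_, ⟨w, hw, rfl⟩, hd⟩
    refine ⟨f (w.1, N / 2), hf.map_mem_segment (mem_segment_axis hw.1 hw.2.1), ?_⟩
    have := hmid w.1 w.2 hw.2.2.1 hw.2.2.2
    linarith [dist_triangle (pos z) (f w) (f (w.1, N / 2))]

lemma BoxCrossingProperty.tubeCrossing (hG : PlaneGraph en pos)
    (hΛ : ∀ e, Λ.ends e = (pos (en e).1, pos (en e).2)) {P : Measure (Config E)}
    (hP : BoxCrossingProperty Λ P) : TubeCrossing en pos P := by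
  intro ε hε
  obtain ⟨c, hc0, hc⟩ := hG.len
  obtain ⟨δ, hδ, N₀, hN₀⟩ := hP (8 / ε) (by positivity)
  refine ⟨δ, hδ, ⌈(2 * (N₀ + 2) + 2 * c) / ε⌉₊, fun n hn u v huv => ?_⟩
  have hn' : 2 * (N₀ + 2) + 2 * c ≤ ε * n := by
    rw [mul_comm ε, ← div_le_iff₀ hε]
    exact Nat.ceil_le.1 hn
  have hx0 : 0 ≤ ε * n / 2 := by positivity
  have hfl1 := Nat.floor_le hx0
  have hfl2 := Nat.lt_floor_add_one (ε * n / 2)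
  obtain ⟨N, hN⟩ : ∃ N, N = ⌊ε * n / 2⌋₊ := ⟨_, rfl⟩
  rw [← hN] at hfl1 hfl2
  have hN0 : N₀ ≤ N := by
    have : (N₀ : ℝ) < N + 1 := by linarith [Nat.cast_nonneg (α := ℝ) N₀]
    exact Nat.lt_add_one_iff.1 (by exact_mod_cast this)
  obtain ⟨f, hf, D, hD, hDu, hfu, hfv⟩ := exists_rotTrans u v
  refine (hN₀ N hN0 _ (hf.comp (isRotTrans_add (0, -(N / 2 : ℝ))))).trans (measure_mono ?_)
  rintro ω ⟨hω, -⟩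
  have hDN : D ≤ 8 / ε * N := by
    have : (2 : ℝ) ≤ ε * n / 2 := by linarith [Nat.cast_nonneg (α := ℝ) N₀]
    rw [div_mul_eq_mul_div, le_div_iff₀ hε]
    have h2 : D * ε ≤ 2 * n * ε := mul_le_mul_of_nonneg_right (by linarith) hε.le
    nlinarith
  have := hG.tubeEvent_of_crossing hc hΛ (hf.comp (isRotTrans_add (0, -(N / 2 : ℝ)))) hD hDN
    (r := ε * n) (by linarith [Nat.cast_nonneg (α := ℝ) N₀]) hω
  simpa [hfu, hfv] using this

/-- Open paths close to a segment contain box crossings. -/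
lemma crossingIn_of_tubeEvent (hΛ : ∀ e, Λ.ends e = (pos (en e).1, pos (en e).2)) {f : Pt → Pt}
    (hf : IsRotTrans f) {h l : ℝ} (hh : 0 ≤ h) (hl : 0 < l) {ω : Config E}
    (hω : ω ∈ tubeEvent en pos (f (-l, l / 2)) (f (h + l, l / 2)) (l / 4)) :
    CrossingIn Λ ω (f '' stdRect h l) (f '' leftSide h l) (f '' rightSide h l) := by
  obtain ⟨g, hg, hgf, hfg⟩ := hf.exists_inv
  obtain ⟨x, hx, y, hy, hcon⟩ := hω
  have hnear : ∀ (z : V) (w : Pt), dist (pos z) (f w) ≤ l / 4 →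
      |(g (pos z)).1 - w.1| ≤ l / 2 ∧ |(g (pos z)).2 - w.2| ≤ l / 2 := by
    intro z w hd
    have h1 : dist (g (pos z)) w ≤ l / 2 := by
      have := hg.dist_le (pos z) (f w)
      rw [hgf] at this
      linarith
    rw [Prod.dist_eq, max_le_iff, Real.dist_eq, Real.dist_eq] at h1
    exact h1
  have hW : Convex ℝ {w : Pt | 0 ≤ (g w).2 ∧ (g w).2 ≤ l} := by
    intro z hz w hw a b ha hb hab
    simp only [mem_ofPred_eq] at hz hw ⊢
    rw [hg.map_comb hab]
    simp only [Prod.snd_add, Prod.smul_snd, smul_eq_mul]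
    constructor
    · nlinarith [mul_nonneg ha hz.1, mul_nonneg hb hw.1]
    · nlinarith [mul_nonneg ha (sub_nonneg.2 hz.2), mul_nonneg hb (sub_nonneg.2 hw.2)]
  have hSW : ∀ z ∈ tube pos (f (-l, l / 2)) (f (h + l, l / 2)) (l / 4),
      pos z ∈ {w : Pt | 0 ≤ (g w).2 ∧ (g w).2 ≤ l} := by
    rintro z ⟨w, hw, hd⟩
    have h1 := hg.map_mem_segment hw
    rw [hgf, hgf] at h1
    obtain ⟨a, b, -, -, hab, h1⟩ := h1
    have h2 : (g w).2 = l / 2 := by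
      rw [← h1]
      simp only [Prod.snd_add, Prod.smul_snd, smul_eq_mul]
      rw [← add_mul, hab, one_mul]
    rw [← hfg w] at hd
    have h3 := abs_le.1 (hnear z _ hd).2
    rw [h2] at h3
    exact ⟨by linarith, by linarith⟩
  have hx1 := (abs_le.1 (hnear x _ hx).1).2
  have hy1 := (abs_le.1 (hnear y _ hy).1).1
  simp only at hx1 hy1
  rcases hcon.joinedIn hW hSW with hxy | hj
  · rw [hxy] at hx1; linarith
  obtain ⟨γ, hγ⟩ := hj
  have hcont : Continuous (fun t => (g (γ.extend t)).1) :=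
    continuous_fst.comp (hg.continuous.comp γ.continuous_extend)
  have hmem : ∀ t, γ.extend t ∈ {w : Pt | 0 ≤ (g w).2 ∧ (g w).2 ≤ l} ∩ openSegs en pos ω :=
    fun t => hγ _
  obtain ⟨a, ha, hae, hage⟩ := exists_last_eq (c := 0) zero_le_one hcont.continuousOn
    (by simp only [γ.extend_zero]; linarith) (by simp only [γ.extend_one]; linarith)
  obtain ⟨b, hb, hbe, hble⟩ := exists_first_eq (c := h) ha.2 hcont.continuousOn
    (by rw [hae]; exact hh) (by simp only [γ.extend_one]; linarith)
  refine ⟨fun s => γ.extend (a + s * (b - a)), ?_, ?_, ?_, ?_⟩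
  · exact (γ.continuous_extend.comp (by fun_prop)).continuousOn
  · refine ⟨g (γ.extend a), ⟨hae, (hmem a).1⟩, ?_⟩
    simp [hfg]
  · refine ⟨g (γ.extend b), ⟨hbe, (hmem b).1⟩, ?_⟩
    simp [hfg]
  · intro s hs
    have hba : 0 ≤ b - a := sub_nonneg.2 hb.1
    have h1 : a ≤ a + s * (b - a) := by nlinarith [mul_nonneg hs.1 hba]
    have h2 : a + s * (b - a) ≤ b := by nlinarith [mul_nonneg (sub_nonneg.2 hs.2) hba]
    refine ⟨⟨g (γ.extend (a + s * (b - a))), ⟨?_, ?_, (hmem _).1⟩, hfg _⟩, ?_⟩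
    · exact hage _ ⟨h1, h2.trans hb.2⟩
    · exact hble _ ⟨h1, h2⟩
    · rw [openEdgeSet_eq hΛ]; exact (hmem _).2

lemma PlaneGraph.finite_tube (hG : PlaneGraph en pos) (u v : Pt) (r : ℝ) :
    {e | (en e).1 ∈ tube pos u v r ∧ (en e).2 ∈ tube pos u v r}.Finite := by
  refine (hG.fin (‖u‖ + dist u v + r)).subset ?_
  rintro e ⟨⟨w, hw, hd⟩, -⟩
  have h1 := (dist_le_of_mem_segment hw).1
  have h2 := norm_le_norm_add_norm_sub' (pos (en e).1) w
  have h3 := norm_le_norm_add_norm_sub' w u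
  rw [← dist_eq_norm] at h2 h3
  rw [dist_comm] at h3
  simp only [mem_ofPred_eq]
  linarith

lemma TubeCrossing.exists_event (hG : PlaneGraph en pos)
    (hΛ : ∀ e, Λ.ends e = (pos (en e).1, pos (en e).2)) {P : Measure (Config E)}
    (hP : TubeCrossing en pos P) {a b : ℝ} (ha : 0 < a) (hb : 0 < b) :
    ∃ δ : ℝ, 0 < δ ∧ ∃ n₀ : ℕ, ∀ N : ℕ, n₀ ≤ N → ∀ f, IsRotTrans f →
      ∃ F : Set E, F.Finite ∧ ∃ A : Set (Config E), LocInc F A ∧ ENNReal.ofReal δ ≤ P A ∧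
        ∀ ω ∈ A, CrossingIn Λ ω (f '' stdRect (a * N) (b * N)) (f '' leftSide (a * N) (b * N))
          (f '' rightSide (a * N) (b * N)) := by
  obtain ⟨k, hk⟩ : ∃ k, k = ⌈2 * a + 4 * b⌉₊ := ⟨_, rfl⟩
  have hk1 : 2 * a + 4 * b ≤ k := hk ▸ Nat.le_ceil _
  have hk0 : (0 : ℝ) < k := by linarith
  obtain ⟨δ, hδ, n₀, h⟩ := hP (b / (4 * k)) (by positivity)
  refine ⟨δ, hδ, max n₀ 1, fun N hN f hf => ?_⟩
  have hN1 : 1 ≤ N := (le_max_right _ _).trans hN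
  have hNpos : (0 : ℝ) < N := by exact_mod_cast hN1
  have hkn : n₀ ≤ k * N := ((le_max_left _ _).trans hN).trans
    (Nat.le_mul_of_pos_left N (by exact_mod_cast hk0))
  have hdist : dist (f (-(b * N), b * N / 2)) (f (a * N + b * N, b * N / 2)) ≤ (k * N : ℕ) := by
    refine (hf.dist_le _ _).trans ?_
    rw [Prod.dist_eq, dist_self, Real.dist_eq, max_eq_left (abs_nonneg _), abs_sub_comm,
      abs_of_nonneg (by nlinarith)]
    push_cast
    nlinarith
  have hr : b / (4 * k) * (k * N : ℕ) = b * N / 4 := by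
    push_cast; field_simp
  have := h (k * N) hkn _ _ hdist
  rw [hr] at this
  exact ⟨_, hG.finite_tube _ _ _, _, locInc_crs en _ _ _, this, fun ω hω =>
    crossingIn_of_tubeEvent hΛ hf (by positivity) (by positivity) hω⟩

lemma IsRotTrans.quarter {f : Pt → Pt} (hf : IsRotTrans f) (h : ℝ) :
    IsRotTrans (fun z => f (h - z.2, z.1)) := by
  have : IsRotTrans (fun z : Pt => ((h - z.2, z.1) : Pt)) := by
    refine ⟨Real.pi / 2, (h, 0), funext fun z => ?_⟩
    ext
    · simp [rot]; ring
    · simp [rot]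
  exact hf.comp this

lemma image_quarter {f : Pt → Pt} {h : ℝ} {A B : Set Pt}
    (hAB : ∀ z, z ∈ A → ((h - z.2, z.1) : Pt) ∈ B) :
    (fun z : Pt => f (h - z.2, z.1)) '' A ⊆ f '' B := by
  rintro _ ⟨z, hz, rfl⟩
  exact ⟨_, hAB z hz, rfl⟩

lemma TubeCrossing.boxCrossingProperty [Countable E] (hG : PlaneGraph en pos)
    (hΛ : ∀ e, Λ.ends e = (pos (en e).1, pos (en e).2)) {p : E → ℝ}
    (hp : ∀ e, p e ∈ Icc (0 : ℝ) 1) (hP : TubeCrossing en pos (prodBern p)) :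
    BoxCrossingProperty Λ (prodBern p) := by
  intro α hα
  obtain ⟨δ₁, hδ₁, n₁, h₁⟩ := hP.exists_event hG hΛ hα one_pos
  obtain ⟨δ₂, hδ₂, n₂, h₂⟩ := hP.exists_event hG hΛ one_pos hα
  refine ⟨δ₁ * δ₂, by positivity, max n₁ n₂, fun N hN f hf => ?_⟩
  obtain ⟨F, hF, A, hA, hPA, hAω⟩ := h₁ N ((le_max_left _ _).trans hN) f hf
  obtain ⟨F', hF', B, hB, hPB, hBω⟩ := h₂ N ((le_max_right _ _).trans hN) _ (hf.quarter (α * N))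
  rw [ENNReal.ofReal_mul hδ₁.le]
  refine (mul_le_mul' hPA hPB).trans ((prodBern_inter_ge hp (hF.union hF')
    (hA.mono subset_union_left) (hB.mono subset_union_right)).trans (measure_mono ?_))
  rintro ω ⟨hωA, hωB⟩
  have h1 := hAω ω hωA
  have h2 := hBω ω hωB
  rw [one_mul] at h1 h2
  refine ⟨h1, ?_⟩
  obtain ⟨γ, hγ, h0, h1, hin⟩ := h2
  refine ⟨γ, hγ, image_quarter ?_ h0, image_quarter ?_ h1,
    fun t ht => ⟨image_quarter ?_ (hin t ht).1, (hin t ht).2⟩⟩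
  · rintro z ⟨h1, h2, h3⟩
    exact ⟨h1, by simp only; linarith, by simp only; linarith⟩
  · rintro z ⟨h1, h2, h3⟩
    exact ⟨h1, by simp only; linarith, by simp only; linarith⟩
  · rintro z ⟨h1, h2, h3, h4⟩
    exact ⟨by simp only; linarith, by simp only; linarith, h1, h2⟩

end BoxTube

section Embeddings

variable {E V : Type} {en : E → V × V} {pos : V → Pt}

lemma TubeCrossing.map_equiv {P : Measure (Config E)} (h : TubeCrossing en pos P)
    (T : Pt ≃L[ℝ] Pt) : TubeCrossing en (fun x => T (pos x)) P := by
  intro ε hε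
  set M : ℝ := ‖(T : Pt →L[ℝ] Pt)‖ + 1 with hM
  obtain ⟨k, hk⟩ : ∃ k : ℕ, ‖(T.symm : Pt →L[ℝ] Pt)‖ + 1 ≤ k := exists_nat_ge _
  have hM0 : 0 < M := by positivity
  have hk0 : (0 : ℝ) < k := by linarith [norm_nonneg (T.symm : Pt →L[ℝ] Pt)]
  have hTd : ∀ x y, dist (T x) (T y) ≤ M * dist x y := fun x y =>
    ((T : Pt →L[ℝ] Pt).lipschitz.dist_le_mul x y).trans
      (mul_le_mul_of_nonneg_right (by simp [hM]) dist_nonneg)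
  have hSd : ∀ x y, dist (T.symm x) (T.symm y) ≤ k * dist x y := fun x y =>
    ((T.symm : Pt →L[ℝ] Pt).lipschitz.dist_le_mul x y).trans
      (mul_le_mul_of_nonneg_right (by simp; linarith) dist_nonneg)
  obtain ⟨δ, hδ, n₀, hn⟩ := h (ε / (k * M)) (by positivity)
  refine ⟨δ, hδ, n₀, fun n hn' u v huv => ?_⟩
  have hkn : n₀ ≤ k * n := hn'.trans (Nat.le_mul_of_pos_left n (by exact_mod_cast hk0))
  refine (hn (k * n) hkn (T.symm u) (T.symm v) ?_).trans (measure_mono ?_)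
  · refine (hSd u v).trans ?_
    push_cast
    exact mul_le_mul_of_nonneg_left huv hk0.le
  have hr : M * (ε / (k * M) * (k * n : ℕ)) = ε * n := by
    push_cast; field_simp
  have key : ∀ (x : V) (w : Pt), dist (pos x) (T.symm w) ≤ ε / (k * M) * (k * n : ℕ) →
      dist (T (pos x)) w ≤ ε * n := by
    intro x w hd
    have := (hTd (pos x) (T.symm w)).trans (mul_le_mul_of_nonneg_left hd hM0.le)
    rwa [hr, T.apply_symm_apply] at this
  refine crs_mono ?_ (fun x hx => key x u hx) (fun x hx => key x v hx)
  rintro x ⟨w, ⟨a, b, ha, hb, hab, rfl⟩, hd⟩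
  refine ⟨a • u + b • v, ⟨a, b, ha, hb, hab, rfl⟩, key x _ ?_⟩
  simpa using hd

lemma PlaneGraph.map_equiv (hG : PlaneGraph en pos) (T : Pt ≃L[ℝ] Pt) :
    PlaneGraph en (fun x => T (pos x)) where
  len := by
    obtain ⟨c, hc0, hc⟩ := hG.len
    refine ⟨‖(T : Pt →L[ℝ] Pt)‖ * c, by positivity, fun e => ?_⟩
    exact ((T : Pt →L[ℝ] Pt).lipschitz.dist_le_mul _ _).trans
      (mul_le_mul_of_nonneg_left (hc e) (norm_nonneg _))
  fin R := by
    refine (hG.fin (‖(T.symm : Pt →L[ℝ] Pt)‖ * R)).subset fun e he => ?_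
    have := (T.symm : Pt →L[ℝ] Pt).le_opNorm (T (pos (en e).1))
    simp only [ContinuousLinearEquiv.coe_coe, T.symm_apply_apply] at this
    exact this.trans (mul_le_mul_of_nonneg_left he (norm_nonneg _))
  meet e e' := by
    rintro ⟨z, hz, hz'⟩
    refine hG.meet e e' ⟨T.symm z, ?_, ?_⟩
    · obtain ⟨a, b, ha, hb, hab, rfl⟩ := hz
      exact ⟨a, b, ha, hb, hab, by simp⟩
    · obtain ⟨a, b, ha, hb, hab, rfl⟩ := hz'
      exact ⟨a, b, ha, hb, hab, by simp⟩

lemma PlaneGraph.comp_injective {E' : Type} (hG : PlaneGraph en pos) {ι : E' → E}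
    (hι : Function.Injective ι) : PlaneGraph (fun e => en (ι e)) pos where
  len := by
    obtain ⟨c, hc0, hc⟩ := hG.len
    exact ⟨c, hc0, fun e => hc _⟩
  fin R := (hG.fin R).preimage hι.injOn
  meet e e' := hG.meet _ _

/-- Two meeting segments between lattice points have overlapping images under an integral
linear form. -/
lemma le_of_meet {k : ℝ} (hk : 0 < k) (α β : ℤ) {u v u' v' : ℤ × ℤ} {pu pv pu' pv' : Pt}
    (hu : k • pu = triPos u) (hv : k • pv = triPos v) (hu' : k • pu' = triPos u')
    (hv' : k • pv' = triPos v') (h : (segment ℝ pu pv ∩ segment ℝ pu' pv').Nonempty) :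
    ∀ l m : ℤ, l ≤ α * u.1 + β * u.2 → l ≤ α * v.1 + β * v.2 →
      α * u'.1 + β * u'.2 ≤ m → α * v'.1 + β * v'.2 ≤ m → l ≤ m := by
  intro l m h1 h2 h3 h4
  obtain ⟨z, ⟨a, b, ha, hb, hab, rfl⟩, ⟨a', b', ha', hb', hab', hz⟩⟩ := h
  have hz1 := congrArg (fun w => k * ((α : ℝ) * w.1 + β * w.2)) hz
  simp only [Prod.fst_add, Prod.snd_add, Prod.smul_fst, Prod.smul_snd, smul_eq_mul] at hz1
  simp only [Prod.ext_iff, Prod.smul_fst, Prod.smul_snd, smul_eq_mul, triPos] at hu hv hu' hv'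
  have h1' : (l : ℝ) ≤ α * u.1 + β * u.2 := by exact_mod_cast h1
  have h2' : (l : ℝ) ≤ α * v.1 + β * v.2 := by exact_mod_cast h2
  have h3' : (α : ℝ) * u'.1 + β * u'.2 ≤ m := by exact_mod_cast h3
  have h4' : (α : ℝ) * v'.1 + β * v'.2 ≤ m := by exact_mod_cast h4
  rw [← hu.1, ← hu.2] at h1'
  rw [← hv.1, ← hv.2] at h2'
  rw [← hu'.1, ← hu'.2] at h3'
  rw [← hv'.1, ← hv'.2] at h4'
  have e1 := mul_le_mul_of_nonneg_left h1' ha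
  have e2 := mul_le_mul_of_nonneg_left h2' hb
  have e3 := mul_le_mul_of_nonneg_left h3' ha'
  have e4 := mul_le_mul_of_nonneg_left h4' hb'
  have f1 : a * (l : ℝ) + b * l = l := by rw [← add_mul, hab, one_mul]
  have f2 : a' * (m : ℝ) + b' * m = m := by rw [← add_mul, hab', one_mul]
  have : (l : ℝ) ≤ m := by linarith
  exact_mod_cast this

lemma finite_of_near {f g : E → ℤ} (hfg : ∀ x y : ℤ, {e | f e = x ∧ g e = y}.Finite)
    {q : E → Pt} (hf : ∀ e, |(q e).1 - f e| ≤ 1) (hg : ∀ e, |(q e).2 - g e| ≤ 1) (R : ℝ) :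
    {e | ‖q e‖ ≤ R}.Finite := by
  obtain ⟨m, hm⟩ := exists_nat_ge (R + 1)
  have hfin : (⋃ x ∈ Icc (-m : ℤ) m, ⋃ y ∈ Icc (-m : ℤ) m, {e | f e = x ∧ g e = y}).Finite :=
    (finite_Icc _ _).biUnion fun x _ => (finite_Icc _ _).biUnion fun y _ => hfg x y
  refine hfin.subset fun e he => ?_
  have h1 := abs_le.1 ((norm_fst_le (q e)).trans he)
  have h2 := abs_le.1 ((norm_snd_le (q e)).trans he)
  have h3 := abs_le.1 (hf e)
  have h4 := abs_le.1 (hg e)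
  have key : ∀ {x : ℝ} {z : ℤ}, -R ≤ x ∧ x ≤ R → -1 ≤ x - z ∧ x - z ≤ 1 → z ∈ Icc (-m : ℤ) m := by
    intro x z hx hz
    have a1 : (-m : ℝ) ≤ z := by linarith
    have a2 : (z : ℝ) ≤ m := by linarith
    exact ⟨by exact_mod_cast a1, by exact_mod_cast a2⟩
  exact mem_biUnion (key h1 h3) (mem_biUnion (key h2 h4) ⟨rfl, rfl⟩)

lemma finite_triE (x y : ℤ) : {e : TriE | e.1 = x ∧ e.2.1 = y}.Finite := by
  refine (finite_range (fun i : Fin 3 => ((x, y, i) : TriE))).subset ?_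
  rintro ⟨a, b, i⟩ ⟨rfl, rfl⟩
  exact ⟨i, rfl⟩

/-- A lower bound on an edge of the triangular lattice for the forms `x`, `y`, `x + y`. -/
def triLo (e : TriE) : ℤ × ℤ × ℤ :=
  (e.1, e.2.1, if e.2.2 = 1 then e.1 + e.2.1 + 1 else e.1 + e.2.1)

/-- An upper bound on an edge of the triangular lattice for the forms `x`, `y`, `x + y`. -/
def triHi (e : TriE) : ℤ × ℤ × ℤ :=
  (if e.2.2 = 2 then e.1 else e.1 + 1, if e.2.2 = 0 then e.2.1 else e.2.1 + 1, e.1 + e.2.1 + 1)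

lemma triLo_le_triHi {e e' : TriE} (h : (segment ℝ (triPos (triEnd e).1) (triPos (triEnd e).2) ∩
    segment ℝ (triPos (triEnd e').1) (triPos (triEnd e').2)).Nonempty) :
    (triLo e).1 ≤ (triHi e').1 ∧ (triLo e).2.1 ≤ (triHi e').2.1 ∧
      (triLo e).2.2 ≤ (triHi e').2.2 := by
  have key := fun α β => le_of_meet one_pos α β (one_smul ℝ (triPos (triEnd e).1))
    (one_smul ℝ (triPos (triEnd e).2)) (one_smul ℝ (triPos (triEnd e').1))
    (one_smul ℝ (triPos (triEnd e').2)) h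
  refine ⟨key 1 0 _ _ ?_ ?_ ?_ ?_, key 0 1 _ _ ?_ ?_ ?_ ?_, key 1 1 _ _ ?_ ?_ ?_ ?_⟩ <;>
    clear key h <;>
    first
      | (induction e using triE_cases <;> simp [triLo] <;> omega)
      | (induction e' using triE_cases <;> simp [triHi] <;> omega)

lemma planeGraph_tri : PlaneGraph triEnd triPos where
  len := by
    refine ⟨1, zero_le_one, fun e => ?_⟩
    induction e using triE_cases <;>
      simp [triPos, Prod.dist_eq]
  fin := by
    refine finite_of_near finite_triE (fun e => ?_) (fun e => ?_) <;>
      induction e using triE_cases <;> simp [triPos]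
  meet e e' h := by
    have h1 := triLo_le_triHi h
    have h2 := triLo_le_triHi (inter_comm _ _ ▸ h)
    clear h
    induction e using triE_cases <;> induction e' using triE_cases <;>
      simp [triLo, triHi] at * <;> omega

/-- Three times the position of a hexagonal vertex. -/
def hexPosZ (z : HV) : ℤ × ℤ :=
  if z.2.2 then (3 * z.1 + 1, 3 * z.2.1 + 1) else (3 * z.1 + 2, 3 * z.2.1 - 1)

lemma three_smul_hexPos (z : HV) : (3 : ℝ) • hexPos z = triPos (hexPosZ z) := by
  obtain ⟨a, b, i⟩ := z
  cases i <;> ext <;> simp [hexPos, hexPosZ, triPos] <;> ring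

/-- A lower bound on an edge of the hexagonal lattice for the forms `2x + y`, `x - y`, `x + 2y`
(in units of `1/3`). -/
def hexLo (e : TriE) : ℤ × ℤ × ℤ :=
  (6 * e.1 + 3 * e.2.1 + if e.2.2 = 2 then 0 else 3,
    3 * e.1 - 3 * e.2.1 - if e.2.2 = 2 then 3 else 0,
    3 * e.1 + 6 * e.2.1 + if e.2.2 = 0 then 0 else 3)

/-- An upper bound on an edge of the hexagonal lattice for the forms `2x + y`, `x - y`, `x + 2y`
(in units of `1/3`). -/
def hexHi (e : TriE) : ℤ × ℤ × ℤ :=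
  (6 * e.1 + 3 * e.2.1 + if e.2.2 = 1 then 6 else 3,
    3 * e.1 - 3 * e.2.1 + if e.2.2 = 0 then 3 else 0,
    3 * e.1 + 6 * e.2.1 + if e.2.2 = 1 then 6 else 3)

lemma hexLo_le_hexHi {e e' : TriE} (h : (segment ℝ (hexPos (hexEnd e).1) (hexPos (hexEnd e).2) ∩
    segment ℝ (hexPos (hexEnd e').1) (hexPos (hexEnd e').2)).Nonempty) :
    (hexLo e).1 ≤ (hexHi e').1 ∧ (hexLo e).2.1 ≤ (hexHi e').2.1 ∧
      (hexLo e).2.2 ≤ (hexHi e').2.2 := by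
  have key := fun α β => le_of_meet (by norm_num : (0 : ℝ) < 3) α β
    (three_smul_hexPos (hexEnd e).1) (three_smul_hexPos (hexEnd e).2)
    (three_smul_hexPos (hexEnd e').1) (three_smul_hexPos (hexEnd e').2) h
  refine ⟨key 2 1 _ _ ?_ ?_ ?_ ?_, key 1 (-1) _ _ ?_ ?_ ?_ ?_, key 1 2 _ _ ?_ ?_ ?_ ?_⟩ <;>
    clear key h <;>
    first
      | (induction e using triE_cases <;> simp [hexLo, hexPosZ] <;> omega)
      | (induction e' using triE_cases <;> simp [hexHi, hexPosZ] <;> omega)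

lemma planeGraph_hex : PlaneGraph hexEnd hexPos where
  len := by
    refine ⟨1, zero_le_one, fun e => ?_⟩
    induction e using triE_cases <;>
      simp [hexPos, Prod.dist_eq, Real.dist_eq, abs_le] <;> constructor <;> constructor <;> linarith
  fin := by
    refine finite_of_near finite_triE (fun e => ?_) (fun e => ?_) <;>
      induction e using triE_cases <;> simp [hexPos] <;> norm_num [abs_le]
  meet e e' h := by
    have h1 := hexLo_le_hexHi h
    have h2 := hexLo_le_hexHi (inter_comm _ _ ▸ h)
    clear h
    induction e using triE_cases <;> induction e' using triE_cases <;>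
      simp [hexLo, hexHi] at * <;> omega

/-- The lattice coordinates of the equilateral embedding. -/
noncomputable def skew : Pt ≃L[ℝ] Pt :=
  LinearEquiv.toContinuousLinearEquiv
    { toFun := fun z => (Real.sqrt 3 * (z.1 + z.2 / 2), 3 / 2 * z.2)
      invFun := fun z => (z.1 / Real.sqrt 3 - z.2 / 3, 2 / 3 * z.2)
      map_add' := fun z w => by ext <;> simp <;> ring
      map_smul' := fun a z => by ext <;> simp <;> ring
      left_inv := fun z => by ext <;> simp <;> field_simp <;> ring
      right_inv := fun z => by ext <;> simp <;> field_simp <;> ring }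

lemma skew_apply (z : Pt) : skew z = (Real.sqrt 3 * (z.1 + z.2 / 2), 3 / 2 * z.2) := rfl

lemma triLattice_ends (e : TriE) :
    triLattice.ends e = (skew (triPos (triEnd e).1), skew (triPos (triEnd e).2)) := by
  induction e using triE_cases <;> simp [triLattice, tv, skew_apply, triPos]

lemma hexLattice_ends (e : TriE) :
    hexLattice.ends e = (skew (hexPos (hexEnd e).1), skew (hexPos (hexEnd e).2)) := by
  induction e using triE_cases <;>
    simp [hexLattice, hup, hdown, skew_apply, hexPos] <;> ring_nf <;> simp

/-- Square-lattice edges as horizontal and left edges of the triangular lattice. -/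
def sqEmb (e : SqE) : TriE := if e.2.2 then (e.1, e.2.1, 0) else (e.1, e.2.1, 2)

lemma sqEmb_injective : Function.Injective sqEmb := by
  rintro ⟨a, b, i⟩ ⟨a', b', i'⟩ h
  cases i <;> cases i' <;> simp_all [sqEmb]

lemma sqLattice_ends (e : SqE) :
    sqLattice.ends e = (triPos (triEnd (sqEmb e)).1, triPos (triEnd (sqEmb e)).2) := by
  obtain ⟨a, b, i⟩ := e
  cases i <;> simp [sqLattice, sqEmb, triPos]

lemma prodBern_map_sqEmb (p0 : ℝ) :
    (prodBern (triInt p0 0 (1 - p0))).map (fun ω e => ω (sqEmb e)) =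
      prodBern (sqInt p0 (1 - p0)) := by
  rw [prodBern_map_comp _ _ sqEmb_injective]
  congr 1
  funext ⟨a, b, i⟩
  cases i <;> simp [sqEmb, triInt, sqInt]

lemma TubeCrossing.sq_to_tri {p0 : ℝ}
    (h : TubeCrossing (fun e => triEnd (sqEmb e)) triPos (prodBern (sqInt p0 (1 - p0)))) :
    TubeCrossing triEnd triPos (prodBern (triInt p0 0 (1 - p0))) := by
  refine h.of_le (c := 0) fun u v r => ?_
  rw [add_zero, ← prodBern_map_sqEmb, Measure.map_apply (by fun_prop)
    (show MeasurableSet (tubeEvent _ _ u v r) from measurableSet_crs _ _ _ _)]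
  refine measure_mono ?_
  rintro ω ⟨x, hx, y, hy, hc⟩
  exact ⟨x, hx, y, hy, hc.map id (fun _ h => h) fun e he => ⟨sqEmb e, he, .inl rfl⟩⟩

lemma TubeCrossing.tri_to_sq {p0 : ℝ}
    (h : TubeCrossing triEnd triPos (prodBern (triInt p0 0 (1 - p0)))) :
    TubeCrossing (fun e => triEnd (sqEmb e)) triPos (prodBern (sqInt p0 (1 - p0))) := by
  refine h.of_le (c := 0) fun u v r => ?_
  rw [add_zero, ← prodBern_map_sqEmb, Measure.map_apply (by fun_prop)
    (show MeasurableSet (tubeEvent _ _ u v r) from measurableSet_crs _ _ _ _)]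
  have hnull := prodBern_exists_eq_zero (p := triInt p0 0 (1 - p0)) {e : TriE | e.2.2 = 1} true
    (fun e he => by simp only [mem_ofPred_eq] at he; simp [triInt, he])
  set N := {ω : Config TriE | ∃ e ∈ {e : TriE | e.2.2 = 1}, ω e = true} with hN
  set B := (fun (ω : Config TriE) e => ω (sqEmb e)) ⁻¹'
    tubeEvent (fun e => triEnd (sqEmb e)) triPos u v r with hB
  refine (measure_mono (t := B ∪ N) ?_).trans
    ((measure_union_le B N).trans_eq (by rw [hnull, add_zero]))
  rintro ω ⟨x, hx, y, hy, hc⟩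
  by_cases hω : ω ∈ N
  · exact .inr hω
  refine .inl ⟨x, hx, y, hy, hc.map id (fun _ h => h) ?_⟩
  intro e he
  induction e using triE_cases with
  | h0 a b => exact ⟨(a, b, true), he, .inl rfl⟩
  | h1 a b => exact absurd ⟨_, rfl, he⟩ hω
  | h2 a b => exact ⟨(a, b, false), he, .inl rfl⟩

end Embeddings

section Transfer

lemma boxCrossing_iff_tubeCrossing {E V : Type} [Countable E] {en : E → V × V} {pos : V → Pt}
    {Λ : LatticeOn E} {p : E → ℝ} (hG : PlaneGraph en pos)
    (hΛ : ∀ e, Λ.ends e = (pos (en e).1, pos (en e).2)) (hp : ∀ e, p e ∈ Icc (0 : ℝ) 1) :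
    (∀ P : Measure (Config E), IsBernoulliProduct p P → BoxCrossingProperty Λ P) ↔
      TubeCrossing en pos (prodBern p) := by
  constructor
  · exact fun h => (h _ (isBernoulliProduct_prodBern hp)).tubeCrossing hG hΛ
  · intro h P hP
    rw [hP.eq_prodBern hp]
    exact h.boxCrossingProperty hG hΛ hp

lemma tubeCrossing_skew_iff {E V : Type} {en : E → V × V} {pos : V → Pt}
    {P : Measure (Config E)} :
    TubeCrossing en (fun x => skew (pos x)) P ↔ TubeCrossing en pos P :=
  ⟨fun h => by simpa using h.map_equiv skew.symm, fun h => h.map_equiv skew⟩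

lemma tri_iff_tubeCrossing {p : TriE → ℝ} (hp : ∀ e, p e ∈ Icc (0 : ℝ) 1) :
    (∀ P : Measure (Config TriE), IsBernoulliProduct p P → BoxCrossingProperty triLattice P) ↔
      TubeCrossing triEnd triPos (prodBern p) :=
  (boxCrossing_iff_tubeCrossing (planeGraph_tri.map_equiv skew) triLattice_ends hp).trans
    tubeCrossing_skew_iff

lemma hex_iff_tubeCrossing {p : TriE → ℝ} (hp : ∀ e, p e ∈ Icc (0 : ℝ) 1) :
    (∀ P : Measure (Config TriE), IsBernoulliProduct p P → BoxCrossingProperty hexLattice P) ↔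
      TubeCrossing hexEnd hexPos (prodBern p) :=
  (boxCrossing_iff_tubeCrossing (planeGraph_hex.map_equiv skew) hexLattice_ends hp).trans
    tubeCrossing_skew_iff

lemma sq_iff_tubeCrossing {p0 : ℝ} (h0 : p0 ∈ Icc (0 : ℝ) 1) :
    (∀ P : Measure (Config SqE), IsBernoulliProduct (sqInt p0 (1 - p0)) P →
        BoxCrossingProperty sqLattice P) ↔
      TubeCrossing triEnd triPos (prodBern (triInt p0 0 (1 - p0))) := by
  refine (boxCrossing_iff_tubeCrossing (planeGraph_tri.comp_injective sqEmb_injective)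
    sqLattice_ends ?_).trans ⟨TubeCrossing.sq_to_tri, TubeCrossing.tri_to_sq⟩
  rintro ⟨a, b, i⟩
  cases i
  · exact ⟨by simpa [sqInt] using h0.2, by simpa [sqInt] using h0.1⟩
  · simpa [sqInt] using h0

/-- The degenerate measure with only left edges open has no horizontal crossings. -/
lemma not_tubeCrossing_zero : ¬ TubeCrossing triEnd triPos (prodBern (triInt 0 0 (1 - 0))) := by
  intro h
  obtain ⟨δ, hδ, n₀, hn⟩ := h.strip (f := Prod.fst) (g := Prod.snd) (fun x => by simp [triPos])
    (fun x => by simp [triPos]) 1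
  have hpos := hn (n₀ + 1) (Nat.le_succ _) 0 0
  have hnull := prodBern_exists_eq_zero (p := triInt 0 0 (1 - 0)) {e : TriE | e.2.2 ≠ 2} true
    (fun e he => by
      induction e using triE_cases with
      | h0 a b => simp [triInt]
      | h1 a b => simp [triInt]
      | h2 a b => exact absurd rfl he)
  refine (ENNReal.ofReal_pos.2 hδ).not_ge (hpos.trans ((measure_mono ?_).trans hnull.le))
  rintro ω ⟨x, hx, y, hy, hc⟩
  by_contra hω
  have hcol : x.1 = y.1 := by
    refine hc.induct (P := fun y _ => x.1 = y.1) (fun _ => rfl) fun y z hy hyz ih => ?_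
    obtain ⟨-, -, e, he, hor⟩ := hyz
    rw [ih]
    induction e using triE_cases with
    | h0 a b => exact absurd ⟨_, by simp, he⟩ hω
    | h1 a b => exact absurd ⟨_, by simp, he⟩ hω
    | h2 a b =>
      simp only [triEnd_two, Prod.mk.injEq] at hor
      rcases hor with ⟨h1, h2⟩ | ⟨h1, h2⟩ <;> rw [← h1, ← h2]
  simp only [mem_ofPred_eq] at hx hy
  push_cast at hy
  omega

end Transfer

/-- Let `(p0,p1,p2) ∈ [0,1)³` be self-dual, `κ_△(p) = 0`.  Then:
(a) if `P^□_{(p0,1-p0)}` has the box-crossing property then so does `P^△_p`;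
(b) if `p0 > 0` and `P^△_p` has the box-crossing property then so does
`P^□_{(p0,1-p0)}`;
(c) `P^△_p` has the box-crossing property iff `P^⬡_{1-p}` has it. -/
theorem box_crossing_transfer (p0 p1 p2 : ℝ)
    (h0 : p0 ∈ Set.Ico (0 : ℝ) 1) (h1 : p1 ∈ Set.Ico (0 : ℝ) 1)
    (h2 : p2 ∈ Set.Ico (0 : ℝ) 1) (hsd : kappaT p0 p1 p2 = 0) :
    -- (a)
    ((∀ P : Measure (Config SqE),
        IsBernoulliProduct (sqInt p0 (1 - p0)) P → BoxCrossingProperty sqLattice P) →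
      ∀ P : Measure (Config TriE),
        IsBernoulliProduct (triInt p0 p1 p2) P → BoxCrossingProperty triLattice P) ∧
    -- (b)
    (0 < p0 →
      (∀ P : Measure (Config TriE),
        IsBernoulliProduct (triInt p0 p1 p2) P → BoxCrossingProperty triLattice P) →
      ∀ P : Measure (Config SqE),
        IsBernoulliProduct (sqInt p0 (1 - p0)) P → BoxCrossingProperty sqLattice P) ∧
    -- (c)
    ((∀ P : Measure (Config TriE),
        IsBernoulliProduct (triInt p0 p1 p2) P → BoxCrossingProperty triLattice P) ↔
      (∀ P : Measure (Config TriE),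
        IsBernoulliProduct (triInt (1 - p0) (1 - p1) (1 - p2)) P →
          BoxCrossingProperty hexLattice P)) := by
  have i0 := Ico_subset_Icc_self h0
  have i1 := Ico_subset_Icc_self h1
  have i2 := Ico_subset_Icc_self h2
  have iz : (0 : ℝ) ∈ Icc (0 : ℝ) 1 := ⟨le_rfl, zero_le_one⟩
  have ic : ∀ {x : ℝ}, x ∈ Icc (0 : ℝ) 1 → 1 - x ∈ Icc (0 : ℝ) 1 :=
    fun h => ⟨sub_nonneg.2 h.2, sub_le_self _ h.1⟩
  rw [sq_iff_tubeCrossing i0, tri_iff_tubeCrossing (triInt_mem i0 i1 i2),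
    hex_iff_tubeCrossing (triInt_mem (ic i0) (ic i1) (ic i2)), ← one_sub_triInt]
  have hdeg : p1 = 0 → p2 = 1 - p0 := fun h => by
    rw [h, kappaT] at hsd
    linarith
  refine ⟨fun h => ?_, fun hp0 h => ?_, fun h => h.tri_to_hex i0 i1 i2 hsd,
    fun h => h.hex_to_tri i0 i1 i2 hsd⟩
  · rcases h1.1.eq_or_lt with hp1 | hp1
    · rwa [hdeg hp1.symm, ← hp1]
    rcases h0.1.eq_or_lt with hp0 | hp0
    · rw [← hp0] at h
      exact absurd h not_tubeCrossing_zero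
    exact (h.axisCrossing_tri ⟨hp0, h0.2.le⟩ ⟨hp1, h1.2.le⟩ h2 hsd).tubeCrossing
      (triInt_mem i0 i1 i2)
  · rcases h1.1.eq_or_lt with hp1 | hp1
    · rwa [hdeg hp1.symm, ← hp1] at h
    exact (h.axisCrossing_sq ⟨hp0, h0.2.le⟩ ⟨hp1, h1.2.le⟩ h2 hsd).tubeCrossing
      (triInt_mem i0 iz (ic i0))

end Perc
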